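/- arXiv:1703.09530 — 7 statements merged into one kernel-verified Lean document; each statement's English description precedes it below -/
import Mathlib

section
/- (Spallek's theorem, smooth case) Let Ω ⊆ ℂ^N be open, let M : Ω → Mat(n×m, ℂ) be holomorphic, and let ξ ∈ Ω. Then there exists k ∈ ℕ (depending on M and ξ) with the following property: whenever U ⊆ Ω is an open neighborhood of ξ and f : U → ℂ^m is a k-times continuously real-differentiable map with M(ζ) f(ζ) = 0 for all ζ ∈ U, there exist an open neighborhood V ⊆ U of ξ and a holomorphic map h : V → ℂ^m with M(ζ) h(ζ) = 0 for all ζ ∈ V and h(ξ) = f(ξ). -/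
/-- A matrix-valued map is holomorphic on a set if each entry is
complex-differentiable on that set. -/
def MatHoloOn {E : Type*} [NormedAddCommGroup E] [NormedSpace ℂ E] {n m : ℕ}
    (f : E → Matrix (Fin n) (Fin m) ℂ) (s : Set E) : Prop :=
  ∀ i j, DifferentiableOn ℂ (fun ζ => f ζ i j) s

open scoped ENNReal
open Filter Topology Asymptotics

namespace ConvergentSeries

/-- The multiplicative weight of a multi-index: the product of the powers of the first primes
with the given exponents. -/
noncomputable def weight {N : ℕ} (α : Fin N →₀ ℕ) : ℕ :=
  ∏ i : Fin N, Nat.nth Nat.Prime i ^ α i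

section weight

variable {N : ℕ}

lemma prime_nth (i : ℕ) : (Nat.nth Nat.Prime i).Prime := Nat.prime_nth_prime i

@[simp] lemma weight_zero : weight (0 : Fin N →₀ ℕ) = 1 := by simp [weight]

lemma weight_add (α β : Fin N →₀ ℕ) : weight (α + β) = weight α * weight β := by
  simp [weight, pow_add, Finset.prod_mul_distrib]

lemma weight_pos (α : Fin N →₀ ℕ) : 0 < weight α :=
  Finset.prod_pos fun i _ => pow_pos (prime_nth i).pos _

lemma weight_injective : Function.Injective (weight : (Fin N →₀ ℕ) → ℕ) := by
  have key : ∀ (α : Fin N →₀ ℕ) (j : Fin N),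
      (weight α).factorization (Nat.nth Nat.Prime j) = α j := by
    intro α j
    rw [weight, Nat.factorization_prod fun (i : Fin N) _ => pow_ne_zero _ (prime_nth i).ne_zero,
      Finsupp.finsetSum_apply, Finset.sum_eq_single j]
    · simp
    · intro i _ hij
      rw [(prime_nth i).factorization_pow, Finsupp.single_eq_of_ne]
      intro h
      exact hij (Fin.ext (Nat.nth_injective Nat.infinite_setOfPred_prime h)).symm
    · simp
  intro α β h
  ext j
  rw [← key α j, ← key β j, h]

lemma two_pow_degree_le_weight (α : Fin N →₀ ℕ) : 2 ^ α.degree ≤ weight α := by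
  rw [Finsupp.degree_eq_sum, ← Finset.prod_pow_eq_pow_sum]
  exact Finset.prod_le_prod' fun i _ => Nat.pow_le_pow_left (prime_nth i).two_le _

lemma finite_weight_lt (n : ℕ) : {α : Fin N →₀ ℕ | weight α < n}.Finite :=
  (Set.finite_Iio n).preimage weight_injective.injOn

end weight

section norm

variable {N : ℕ}

/-- The weighted `ℓ¹` norm of a formal power series. -/
noncomputable def wnorm (s : ℕ) (f : MvPowerSeries (Fin N) ℂ) : ℝ≥0∞ :=
  ∑' α, ‖MvPowerSeries.coeff α f‖ₑ * ((weight α : ℝ≥0∞)⁻¹) ^ s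

lemma inv_weight_le_one (α : Fin N →₀ ℕ) : (weight α : ℝ≥0∞)⁻¹ ≤ 1 := by
  rw [ENNReal.inv_le_one]
  exact_mod_cast weight_pos α

lemma inv_weight_ne_top (α : Fin N →₀ ℕ) : (weight α : ℝ≥0∞)⁻¹ ≠ ∞ :=
  ne_top_of_le_ne_top ENNReal.one_ne_top (inv_weight_le_one α)

lemma inv_weight_ne_zero (α : Fin N →₀ ℕ) : (weight α : ℝ≥0∞)⁻¹ ≠ 0 := by simp

lemma inv_weight_add (α β : Fin N →₀ ℕ) :
    (weight (α + β) : ℝ≥0∞)⁻¹ = (weight α : ℝ≥0∞)⁻¹ * (weight β : ℝ≥0∞)⁻¹ := by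
  rw [weight_add, Nat.cast_mul, ENNReal.mul_inv] <;> simp

lemma wnorm_antitone (f : MvPowerSeries (Fin N) ℂ) : Antitone fun s => wnorm s f := by
  intro s t hst
  refine ENNReal.tsum_le_tsum fun α => ?_
  exact mul_le_mul_right (pow_le_pow_right_of_le_one' (inv_weight_le_one α) hst) _

lemma wnorm_zero (s : ℕ) : wnorm s (0 : MvPowerSeries (Fin N) ℂ) = 0 := by simp [wnorm]

lemma wnorm_neg (s : ℕ) (f : MvPowerSeries (Fin N) ℂ) : wnorm s (-f) = wnorm s f := by
  simp [wnorm]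

lemma wnorm_add_le (s : ℕ) (f g : MvPowerSeries (Fin N) ℂ) :
    wnorm s (f + g) ≤ wnorm s f + wnorm s g := by
  rw [wnorm, wnorm, wnorm, ← ENNReal.tsum_add]
  refine ENNReal.tsum_le_tsum fun α => ?_
  rw [← add_mul]
  gcongr
  rw [map_add]
  exact enorm_add_le _ _

lemma wnorm_sum_le {ι : Type*} (s : ℕ) (B : Finset ι) (f : ι → MvPowerSeries (Fin N) ℂ) :
    wnorm s (∑ b ∈ B, f b) ≤ ∑ b ∈ B, wnorm s (f b) := by
  classical
  induction B using Finset.induction_on with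
  | empty => simp [wnorm_zero]
  | insert a B ha ih =>
    rw [Finset.sum_insert ha, Finset.sum_insert ha]
    exact (wnorm_add_le _ _ _).trans (by gcongr)

lemma wnorm_mul_le (s : ℕ) (f g : MvPowerSeries (Fin N) ℂ) :
    wnorm s (f * g) ≤ wnorm s f * wnorm s g := by
  classical
  set a : (Fin N →₀ ℕ) → ℝ≥0∞ := fun α =>
    ‖MvPowerSeries.coeff α f‖ₑ * ((weight α : ℝ≥0∞)⁻¹) ^ s
  set b : (Fin N →₀ ℕ) → ℝ≥0∞ := fun α =>
    ‖MvPowerSeries.coeff α g‖ₑ * ((weight α : ℝ≥0∞)⁻¹) ^ s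
  have hprod : wnorm s f * wnorm s g
      = ∑' α, ∑ p ∈ Finset.HasAntidiagonal.antidiagonal α, a p.1 * b p.2 := by
    have h1 : wnorm s f * wnorm s g = ∑' p : (Fin N →₀ ℕ) × (Fin N →₀ ℕ), a p.1 * b p.2 := by
      rw [ENNReal.tsum_prod', wnorm, ← ENNReal.tsum_mul_right]
      congr 1 with α
      rw [wnorm, ← ENNReal.tsum_mul_left]
    rw [h1, ← Finset.HasAntidiagonal.sigmaAntidiagonalEquivProd.tsum_eq, ENNReal.tsum_sigma']
    congr 1 with α
    rw [tsum_fintype]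
    exact Finset.sum_coe_sort (Finset.HasAntidiagonal.antidiagonal α) (fun p => a p.1 * b p.2)
  rw [hprod]
  refine ENNReal.tsum_le_tsum fun α => ?_
  rw [MvPowerSeries.coeff_mul]
  calc _ ≤ (∑ p ∈ Finset.HasAntidiagonal.antidiagonal α,
        ‖MvPowerSeries.coeff p.1 f * MvPowerSeries.coeff p.2 g‖ₑ) *
          ((weight α : ℝ≥0∞)⁻¹) ^ s := by
        gcongr
        exact enorm_sum_le _ _
    _ = _ := by
        rw [Finset.sum_mul]
        refine Finset.sum_congr rfl fun p hp => ?_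
        rw [← Finset.HasAntidiagonal.mem_antidiagonal.1 hp, inv_weight_add, enorm_mul]
        simp only [a, b]
        ring

lemma wnorm_ne_top_of_finite_support (s : ℕ) {f : MvPowerSeries (Fin N) ℂ} {S : Set (Fin N →₀ ℕ)}
    (hS : S.Finite) (hf : ∀ α ∉ S, MvPowerSeries.coeff α f = 0) : wnorm s f ≠ ∞ := by
  rw [wnorm, tsum_eq_sum (s := hS.toFinset)]
  · exact ENNReal.sum_ne_top.2 fun α _ =>
      ENNReal.mul_ne_top enorm_ne_top (ENNReal.pow_ne_top (inv_weight_ne_top α))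
  · intro α hα
    simp [hf α (by simpa using hα)]

end norm

/-- The ring of convergent power series, as a subring of the formal power series. -/
noncomputable def conv (N : ℕ) : Subring (MvPowerSeries (Fin N) ℂ) where
  carrier := {f | ∃ s, wnorm s f ≠ ∞}
  mul_mem' := by
    rintro f g ⟨s, hs⟩ ⟨t, ht⟩
    refine ⟨max s t, ne_top_of_le_ne_top (ENNReal.mul_ne_top ?_ ?_) (wnorm_mul_le _ f g)⟩
    · exact ne_top_of_le_ne_top hs (wnorm_antitone f (le_max_left s t))
    · exact ne_top_of_le_ne_top ht (wnorm_antitone g (le_max_right s t))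
  add_mem' := by
    rintro f g ⟨s, hs⟩ ⟨t, ht⟩
    refine ⟨max s t, ne_top_of_le_ne_top (ENNReal.add_ne_top.2 ⟨?_, ?_⟩) (wnorm_add_le _ f g)⟩
    · exact ne_top_of_le_ne_top hs (wnorm_antitone f (le_max_left s t))
    · exact ne_top_of_le_ne_top ht (wnorm_antitone g (le_max_right s t))
  neg_mem' := by
    rintro f ⟨s, hs⟩
    exact ⟨s, by rwa [wnorm_neg]⟩
  zero_mem' := ⟨0, by simp [wnorm_zero]⟩
  one_mem' := by
    classical
    refine ⟨0, wnorm_ne_top_of_finite_support 0 (Set.finite_singleton 0) fun α hα => ?_⟩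
    rw [MvPowerSeries.coeff_one, if_neg (by simpa using hα)]

lemma mem_conv {N : ℕ} {f : MvPowerSeries (Fin N) ℂ} : f ∈ conv N ↔ ∃ s, wnorm s f ≠ ∞ := Iff.rfl

section division

open Classical in
/-- A chosen element of `B` below `α`, if there is one. -/
noncomputable def cover {N : ℕ} (B : Finset (Fin N →₀ ℕ)) (α : Fin N →₀ ℕ) : Fin N →₀ ℕ :=
  if h : ∃ b ∈ B, b ≤ α then h.choose else 0

open Classical in
/-- The part of a power series assigned to the monomial `b`, divided by this monomial. -/
noncomputable def quot {N : ℕ} (B : Finset (Fin N →₀ ℕ)) (b : Fin N →₀ ℕ)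
    (u : MvPowerSeries (Fin N) ℂ) : MvPowerSeries (Fin N) ℂ :=
  fun γ => if cover B (γ + b) = b then MvPowerSeries.coeff (γ + b) u else 0

open Classical in
/-- The part of a power series supported outside of the multiples of the monomials in `B`. -/
noncomputable def remainder {N : ℕ} (B : Finset (Fin N →₀ ℕ))
    (u : MvPowerSeries (Fin N) ℂ) : MvPowerSeries (Fin N) ℂ :=
  fun γ => if ∃ b ∈ B, b ≤ γ then 0 else MvPowerSeries.coeff γ u

variable {N : ℕ} {B : Finset (Fin N →₀ ℕ)}

lemma cover_spec {α : Fin N →₀ ℕ} (h : ∃ b ∈ B, b ≤ α) : cover B α ∈ B ∧ cover B α ≤ α := by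
  rw [cover, dif_pos h]
  exact h.choose_spec

open Classical in
lemma coeff_quot (b γ : Fin N →₀ ℕ) (u : MvPowerSeries (Fin N) ℂ) :
    MvPowerSeries.coeff γ (quot B b u) =
      if cover B (γ + b) = b then MvPowerSeries.coeff (γ + b) u else 0 := rfl

open Classical in
lemma coeff_remainder (γ : Fin N →₀ ℕ) (u : MvPowerSeries (Fin N) ℂ) :
    MvPowerSeries.coeff γ (remainder B u) =
      if ∃ b ∈ B, b ≤ γ then 0 else MvPowerSeries.coeff γ u := rfl

lemma remainder_add_sum_quot (u : MvPowerSeries (Fin N) ℂ) :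
    remainder B u + ∑ b ∈ B, quot B b u * MvPowerSeries.monomial b 1 = u := by
  classical
  ext α
  have h : ∀ b ∈ B, MvPowerSeries.coeff α (quot B b u * MvPowerSeries.monomial b 1) =
      if cover B α = b ∧ b ≤ α then MvPowerSeries.coeff α u else 0 := by
    intro b _
    rw [MvPowerSeries.coeff_mul_monomial]
    by_cases hb : b ≤ α
    · simp [hb, coeff_quot, tsub_add_cancel_of_le hb]
    · simp [hb]
  rw [map_add, map_sum, Finset.sum_congr rfl h, coeff_remainder]
  by_cases hα : ∃ b ∈ B, b ≤ α
  · rw [if_pos hα, Finset.sum_eq_single (cover B α)]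
    · simp [(cover_spec hα).2]
    · intro b _ hb
      rw [if_neg]
      exact fun h => hb h.1.symm
    · exact fun h => absurd (cover_spec hα).1 h
  · rw [if_neg hα, Finset.sum_eq_zero, add_zero]
    intro b hb
    rw [if_neg]
    exact fun h => hα ⟨b, hb, h.2⟩

lemma sum_wnorm_quot_le (s : ℕ) (u : MvPowerSeries (Fin N) ℂ) :
    ∑ b ∈ B, wnorm s (quot B b u) * ((weight b : ℝ≥0∞)⁻¹) ^ s ≤ wnorm s u := by
  classical
  set a : (Fin N →₀ ℕ) → ℝ≥0∞ := fun α =>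
    ‖MvPowerSeries.coeff α u‖ₑ * ((weight α : ℝ≥0∞)⁻¹) ^ s
  have h : ∀ b ∈ B, wnorm s (quot B b u) * ((weight b : ℝ≥0∞)⁻¹) ^ s ≤
      ∑' α, if cover B α = b then a α else 0 := by
    intro b _
    calc wnorm s (quot B b u) * ((weight b : ℝ≥0∞)⁻¹) ^ s
        = ∑' γ, (if cover B (γ + b) = b then a (γ + b) else 0) := by
          rw [wnorm, ← ENNReal.tsum_mul_right]
          congr 1 with γ
          rw [coeff_quot]
          split_ifs
          · simp only [a]
            rw [inv_weight_add, mul_pow, mul_assoc]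
          · simp
      _ ≤ _ := ENNReal.tsum_comp_le_tsum_of_injective (add_left_injective b)
          (fun α => if cover B α = b then a α else 0)
  refine (Finset.sum_le_sum h).trans ?_
  rw [← Summable.tsum_finsetSum fun _ _ => ENNReal.summable]
  refine ENNReal.tsum_le_tsum fun α => ?_
  rw [Finset.sum_ite_eq]
  split_ifs
  · exact le_rfl
  · exact zero_le

lemma wnorm_quot_ne_top {s : ℕ} {u : MvPowerSeries (Fin N) ℂ} (hu : wnorm s u ≠ ∞)
    {b : Fin N →₀ ℕ} (hb : b ∈ B) : wnorm s (quot B b u) ≠ ∞ := by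
  intro h
  have h1 := (Finset.single_le_sum (fun _ _ => zero_le)
    hb).trans (sum_wnorm_quot_le (B := B) s u)
  rw [h, ENNReal.top_mul (pow_ne_zero _ (inv_weight_ne_zero b))] at h1
  exact hu (top_le_iff.1 h1)

/-- The perturbation term in the division by series with prescribed leading monomials. -/
noncomputable def perturb (B : Finset (Fin N →₀ ℕ))
    (G : (Fin N →₀ ℕ) → MvPowerSeries (Fin N) ℂ) (u : MvPowerSeries (Fin N) ℂ) :
    MvPowerSeries (Fin N) ℂ :=
  ∑ b ∈ B, quot B b u * G b

lemma coeff_perturb_congr {G : (Fin N →₀ ℕ) → MvPowerSeries (Fin N) ℂ}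
    (hG : ∀ b ∈ B, ∀ δ, MvPowerSeries.coeff δ (G b) ≠ 0 → weight b < weight δ)
    {α : Fin N →₀ ℕ} {u v : MvPowerSeries (Fin N) ℂ}
    (huv : ∀ β, weight β < weight α → MvPowerSeries.coeff β u = MvPowerSeries.coeff β v) :
    MvPowerSeries.coeff α (perturb B G u) = MvPowerSeries.coeff α (perturb B G v) := by
  classical
  rw [perturb, perturb, map_sum, map_sum]
  refine Finset.sum_congr rfl fun b hb => ?_
  rw [MvPowerSeries.coeff_mul, MvPowerSeries.coeff_mul]
  refine Finset.sum_congr rfl fun p hp => ?_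
  by_cases h0 : MvPowerSeries.coeff p.2 (G b) = 0
  · rw [h0, mul_zero, mul_zero]
  · have h1 := hG b hb _ h0
    rw [coeff_quot, coeff_quot, huv]
    rw [← Finset.HasAntidiagonal.mem_antidiagonal.1 hp, weight_add, weight_add]
    exact Nat.mul_lt_mul_of_pos_left h1 (weight_pos _)

lemma wnorm_perturb_le {G : (Fin N →₀ ℕ) → MvPowerSeries (Fin N) ℂ} {s : ℕ}
    (hs : ∀ b ∈ B, wnorm s (G b) ≤ 2⁻¹ * ((weight b : ℝ≥0∞)⁻¹) ^ s)
    (u : MvPowerSeries (Fin N) ℂ) : wnorm s (perturb B G u) ≤ 2⁻¹ * wnorm s u := by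
  calc wnorm s (perturb B G u) ≤ ∑ b ∈ B, wnorm s (quot B b u * G b) := wnorm_sum_le _ _ _
    _ ≤ ∑ b ∈ B, 2⁻¹ * (wnorm s (quot B b u) * ((weight b : ℝ≥0∞)⁻¹) ^ s) := by
        refine Finset.sum_le_sum fun b hb => (wnorm_mul_le _ _ _).trans ?_
        rw [mul_left_comm]
        gcongr
        exact hs b hb
    _ ≤ _ := by
        rw [← Finset.mul_sum]
        gcongr
        exact sum_wnorm_quot_le s u

lemma exists_add_perturb_eq {G : (Fin N →₀ ℕ) → MvPowerSeries (Fin N) ℂ}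
    (hG : ∀ b ∈ B, ∀ δ, MvPowerSeries.coeff δ (G b) ≠ 0 → weight b < weight δ)
    (f : MvPowerSeries (Fin N) ℂ) : ∃ u, u + perturb B G u = f := by
  classical
  let F : ∀ α : Fin N →₀ ℕ, (∀ β, weight β < weight α → ℂ) → ℂ := fun α rec =>
    MvPowerSeries.coeff α f - MvPowerSeries.coeff α (perturb B G
      (fun β => if h : weight β < weight α then rec β h else 0))
  have wf : WellFounded fun β α : Fin N →₀ ℕ => weight β < weight α :=
    InvImage.wf weight wellFounded_lt
  let u : MvPowerSeries (Fin N) ℂ := wf.fix F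
  refine ⟨u, ?_⟩
  ext α
  have h1 : MvPowerSeries.coeff α u = F α fun β _ => u β := wf.fix_eq F α
  rw [map_add, h1]
  simp only [F]
  rw [sub_add_eq_add_sub, sub_eq_iff_eq_add, add_right_inj]
  refine coeff_perturb_congr hG fun β hβ => ?_
  change u β = if h : weight β < weight α then u β else 0
  rw [dif_pos hβ]

lemma wnorm_le_of_add_perturb_eq {G : (Fin N →₀ ℕ) → MvPowerSeries (Fin N) ℂ} {s : ℕ}
    (hG : ∀ b ∈ B, ∀ δ, MvPowerSeries.coeff δ (G b) ≠ 0 → weight b < weight δ)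
    (hs : ∀ b ∈ B, wnorm s (G b) ≤ 2⁻¹ * ((weight b : ℝ≥0∞)⁻¹) ^ s)
    {f u : MvPowerSeries (Fin N) ℂ} (hu : u + perturb B G u = f) :
    wnorm s u ≤ 2 * wnorm s f := by
  classical
  let v : ℕ → MvPowerSeries (Fin N) ℂ := fun n α =>
    if weight α < n then MvPowerSeries.coeff α u else 0
  have hv : ∀ n α, MvPowerSeries.coeff α (v n) =
    if weight α < n then MvPowerSeries.coeff α u else 0 := fun _ _ => rfl
  have hvn : ∀ n, wnorm s (v n) ≤ 2 * wnorm s f := by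
    intro n
    have hfin : wnorm s (v n) ≠ ∞ := wnorm_ne_top_of_finite_support s (finite_weight_lt n)
      fun α hα => by rw [hv, if_neg (by simpa using hα)]
    have h1 : wnorm s (v n) ≤ wnorm s (f + -perturb B G (v n)) := by
      refine ENNReal.tsum_le_tsum fun α => ?_
      rw [hv]
      split_ifs with h
      · rw [← hu, map_add, map_add, map_neg, add_assoc,
          coeff_perturb_congr (α := α) (v := v n) hG, add_neg_cancel, add_zero]
        intro β hβ
        rw [hv, if_pos (hβ.trans h)]
      · simp
    have h2 : wnorm s (v n) ≤ wnorm s f + 2⁻¹ * wnorm s (v n) := by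
      refine (h1.trans (wnorm_add_le _ _ _)).trans ?_
      rw [wnorm_neg]
      gcongr
      exact wnorm_perturb_le hs _
    have h3 : wnorm s (v n) = 2⁻¹ * wnorm s (v n) + 2⁻¹ * wnorm s (v n) := by
      rw [← add_mul, ENNReal.inv_two_add_inv_two, one_mul]
    have h4 : 2⁻¹ * wnorm s (v n) ≤ wnorm s f := by
      have h5 : 2⁻¹ * wnorm s (v n) ≠ ∞ := ENNReal.mul_ne_top (by simp) hfin
      exact (ENNReal.add_le_add_iff_right h5).1 (h3.symm.le.trans h2)
    rw [h3, two_mul]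
    gcongr
  rw [wnorm, ENNReal.tsum_eq_iSup_sum]
  refine iSup_le fun S => ?_
  refine le_trans ?_ (hvn (S.sup weight + 1))
  refine le_trans (Finset.sum_le_sum fun α hα => ?_) (ENNReal.sum_le_tsum S)
  rw [hv, if_pos (Nat.lt_succ_of_le (Finset.le_sup hα))]

end division

section noetherian

variable {N : ℕ}

lemma eventually_wnorm_le {b : Fin N →₀ ℕ} {G : MvPowerSeries (Fin N) ℂ} (hconv : G ∈ conv N)
    (hG : ∀ δ, MvPowerSeries.coeff δ G ≠ 0 → weight b < weight δ) :
    ∀ᶠ s in atTop, wnorm s G ≤ 2⁻¹ * ((weight b : ℝ≥0∞)⁻¹) ^ s := by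
  obtain ⟨t, ht⟩ := hconv
  set r : ℝ≥0∞ := weight b * ((weight b + 1 : ℕ) : ℝ≥0∞)⁻¹ with hr
  have hb0 : (weight b : ℝ≥0∞) ≠ 0 := by exact_mod_cast (weight_pos b).ne'
  have hbt : (weight b : ℝ≥0∞) ≠ ∞ := ENNReal.natCast_ne_top _
  have hr1 : r < 1 := by
    rw [hr, ← div_eq_mul_inv, ENNReal.div_lt_iff (by simp) (by simp), one_mul]
    exact_mod_cast Nat.lt_succ_self _
  have hrb : ((weight b + 1 : ℕ) : ℝ≥0∞)⁻¹ = r * (weight b : ℝ≥0∞)⁻¹ := by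
    rw [hr, mul_right_comm, ENNReal.mul_inv_cancel hb0 hbt, one_mul]
  have hle : ∀ j, wnorm (t + j) G ≤ ((weight b + 1 : ℕ) : ℝ≥0∞)⁻¹ ^ j * wnorm t G := by
    intro j
    rw [wnorm, wnorm, ← ENNReal.tsum_mul_left]
    refine ENNReal.tsum_le_tsum fun α => ?_
    by_cases h : MvPowerSeries.coeff α G = 0
    · simp [h]
    · rw [pow_add, ← mul_assoc, mul_comm]
      gcongr
      exact hG α h
  have hlim : Tendsto (fun j : ℕ => r ^ j * (wnorm t G * (weight b : ℝ≥0∞) ^ t)) atTop (𝓝 0) := by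
    have := ENNReal.Tendsto.mul_const (ENNReal.tendsto_pow_atTop_nhds_zero_of_lt_one hr1)
      (b := wnorm t G * (weight b : ℝ≥0∞) ^ t)
      (Or.inr (ENNReal.mul_ne_top ht (ENNReal.pow_ne_top hbt)))
    rwa [zero_mul] at this
  have hev := hlim.eventually_le_const (show (0 : ℝ≥0∞) < 2⁻¹ by simp)
  have hev' : ∀ᶠ j in atTop, wnorm (j + t) G ≤ 2⁻¹ * ((weight b : ℝ≥0∞)⁻¹) ^ (j + t) := by
    filter_upwards [hev] with j hj
    rw [add_comm j t]
    refine (hle j).trans ?_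
    calc ((weight b + 1 : ℕ) : ℝ≥0∞)⁻¹ ^ j * wnorm t G
        = (r ^ j * (wnorm t G * (weight b : ℝ≥0∞) ^ t)) * ((weight b : ℝ≥0∞)⁻¹) ^ (t + j) := by
          have h1 : (weight b : ℝ≥0∞) ^ t * ((weight b : ℝ≥0∞)⁻¹) ^ t = 1 := by
            rw [← mul_pow, ENNReal.mul_inv_cancel hb0 hbt, one_pow]
          rw [hrb, mul_pow, pow_add]
          calc _ = r ^ j * (weight b : ℝ≥0∞)⁻¹ ^ j * wnorm t G * 1 := by rw [mul_one]
            _ = _ := by rw [← h1]; ring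
      _ ≤ _ := by gcongr
  rw [← map_add_atTop_eq_nat t]
  exact hev'

/-- The exponents of leading monomials of elements of an ideal of convergent series. -/
def leadExponents (I : Ideal (conv N)) : Set (Fin N →₀ ℕ) :=
  {α | ∃ f ∈ I, MvPowerSeries.coeff α (f : MvPowerSeries (Fin N) ℂ) = 1 ∧
    ∀ β, MvPowerSeries.coeff β (f : MvPowerSeries (Fin N) ℂ) ≠ 0 → weight α ≤ weight β}

lemma C_mem_conv (c : ℂ) : MvPowerSeries.C c ∈ conv N := by
  classical
  refine ⟨0, wnorm_ne_top_of_finite_support 0 (Set.finite_singleton 0) fun α hα => ?_⟩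
  rw [MvPowerSeries.coeff_C, if_neg (by simpa using hα)]

lemma monomial_mem_conv (b : Fin N →₀ ℕ) (c : ℂ) : MvPowerSeries.monomial b c ∈ conv N := by
  classical
  refine ⟨0, wnorm_ne_top_of_finite_support 0 (Set.finite_singleton b) fun α hα => ?_⟩
  rw [MvPowerSeries.coeff_monomial, if_neg (by simpa using hα)]

lemma exists_mem_leadExponents {I : Ideal (conv N)} {f : conv N} (hf : f ∈ I) (h0 : f ≠ 0) :
    ∃ α ∈ leadExponents I, MvPowerSeries.coeff α (f : MvPowerSeries (Fin N) ℂ) ≠ 0 := by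
  classical
  have hex : ∃ α, MvPowerSeries.coeff α (f : MvPowerSeries (Fin N) ℂ) ≠ 0 := by
    by_contra! h
    exact h0 (Subtype.ext (MvPowerSeries.ext h))
  obtain ⟨α, hα, hmin⟩ := exists_minimalFor_of_wellFoundedLT
    (fun α => MvPowerSeries.coeff α (f : MvPowerSeries (Fin N) ℂ) ≠ 0) weight hex
  refine ⟨α, ⟨⟨MvPowerSeries.C (MvPowerSeries.coeff α (f : MvPowerSeries (Fin N) ℂ))⁻¹,
    C_mem_conv _⟩ * f, I.mul_mem_left _ hf, ?_, ?_⟩, hα⟩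
  · simp [MvPowerSeries.coeff_C_mul, inv_mul_cancel₀ hα]
  · intro β hβ
    have hβ' : MvPowerSeries.coeff β (f : MvPowerSeries (Fin N) ℂ) ≠ 0 := by
      intro h
      apply hβ
      simp [MvPowerSeries.coeff_C_mul, h]
    rcases le_total (weight α) (weight β) with h | h
    · exact h
    · exact hmin hβ' h

/-- **Rückert's basis theorem**: the ring of convergent power series is Noetherian. -/
instance isNoetherianRing_conv : IsNoetherianRing (conv N) := by
  classical
  rw [isNoetherianRing_iff_ideal_fg]
  intro I
  have hfin : {α | Minimal (· ∈ leadExponents I) α}.Finite :=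
    WellQuasiOrderedLE.finite_of_isAntichain (setOfPred_minimal_antichain _)
  set B : Finset (Fin N →₀ ℕ) := hfin.toFinset with hB
  have hBmem : ∀ b ∈ B, b ∈ leadExponents I := fun b hb => by
    have : Minimal (· ∈ leadExponents I) b := by simpa [hB] using hb
    exact this.prop
  have hBle : ∀ α ∈ leadExponents I, ∃ b ∈ B, b ≤ α := fun α hα => by
    obtain ⟨b, hb, hmin⟩ := exists_minimal_le_of_wellFoundedLT (· ∈ leadExponents I) α hα
    exact ⟨b, by simpa [hB] using hmin, hb⟩
  have hex : ∀ b : Fin N →₀ ℕ, ∃ g : conv N, b ∈ B → g ∈ I ∧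
      MvPowerSeries.coeff b (g : MvPowerSeries (Fin N) ℂ) = 1 ∧
      ∀ β, MvPowerSeries.coeff β (g : MvPowerSeries (Fin N) ℂ) ≠ 0 → weight b ≤ weight β := by
    intro b
    by_cases hb : b ∈ B
    · obtain ⟨g, hg⟩ := hBmem b hb
      exact ⟨g, fun _ => hg⟩
    · exact ⟨0, fun h => absurd h hb⟩
  choose g hg using hex
  let G : (Fin N →₀ ℕ) → MvPowerSeries (Fin N) ℂ := fun b =>
    (g b : MvPowerSeries (Fin N) ℂ) - MvPowerSeries.monomial b 1
  have hGlt : ∀ b ∈ B, ∀ δ, MvPowerSeries.coeff δ (G b) ≠ 0 → weight b < weight δ := by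
    intro b hb δ hδ
    simp only [G, map_sub, MvPowerSeries.coeff_monomial] at hδ
    by_cases hδb : δ = b
    · subst hδb
      simp [(hg δ hb).2.1] at hδ
    · rw [if_neg hδb, sub_zero] at hδ
      exact lt_of_le_of_ne ((hg b hb).2.2 δ hδ) fun h => hδb (weight_injective h).symm
  refine ⟨B.image g, le_antisymm ?_ ?_⟩
  · rw [Ideal.span_le]
    intro x hx
    obtain ⟨b, hb, rfl⟩ := Finset.mem_image.1 (Finset.mem_coe.1 hx)
    exact (hg b hb).1
  · intro f hf
    obtain ⟨u, hu⟩ := exists_add_perturb_eq hGlt (f : MvPowerSeries (Fin N) ℂ)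
    obtain ⟨t, ht⟩ := f.2
    have hev : ∀ᶠ s in atTop, ∀ b ∈ B, wnorm s (G b) ≤ 2⁻¹ * ((weight b : ℝ≥0∞)⁻¹) ^ s := by
      rw [Filter.eventually_all_finset]
      exact fun b hb => eventually_wnorm_le
        ((conv N).sub_mem (g b).2 (monomial_mem_conv b 1)) (hGlt b hb)
    obtain ⟨s, hs, hts⟩ := (hev.and (eventually_ge_atTop t)).exists
    have hfs : wnorm s (f : MvPowerSeries (Fin N) ℂ) ≠ ∞ :=
      ne_top_of_le_ne_top ht (wnorm_antitone _ hts)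
    have hus : wnorm s u ≠ ∞ := ne_top_of_le_ne_top (ENNReal.mul_ne_top (by simp) hfs)
      (wnorm_le_of_add_perturb_eq hGlt hs hu)
    let q : (Fin N →₀ ℕ) → conv N := fun b =>
      if hb : b ∈ B then ⟨quot B b u, s, wnorm_quot_ne_top hus hb⟩ else 0
    have hq : ∀ b ∈ B, (q b : MvPowerSeries (Fin N) ℂ) = quot B b u := fun b hb => by
      simp [q, hb]
    let p : conv N := f - ∑ b ∈ B, q b * g b
    have hp : (p : MvPowerSeries (Fin N) ℂ) = remainder B u := by
      have h1 : (p : MvPowerSeries (Fin N) ℂ) = f - ∑ b ∈ B, quot B b u * g b := by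
        simp only [p, AddSubgroupClass.coe_sub, AddSubmonoidClass.coe_finsetSum,
          MulMemClass.coe_mul]
        rw [Finset.sum_congr rfl fun b hb => by rw [hq b hb]]
      have h2 := remainder_add_sum_quot (B := B) u
      have h3 : perturb B G u = ∑ b ∈ B, quot B b u * g b -
          ∑ b ∈ B, quot B b u * MvPowerSeries.monomial b 1 := by
        simp only [perturb, G, mul_sub, Finset.sum_sub_distrib]
      rw [h1, ← hu, h3]
      nth_rewrite 1 [← h2]
      abel
    have hpI : p ∈ I := I.sub_mem hf (I.sum_mem fun b hb => I.mul_mem_left _ (hg b hb).1)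
    have hp0 : p = 0 := by
      by_contra hne
      obtain ⟨α, hα, hc⟩ := exists_mem_leadExponents hpI hne
      rw [hp, coeff_remainder, if_pos (hBle α hα)] at hc
      exact hc rfl
    rw [sub_eq_zero.1 hp0]
    refine Submodule.sum_mem _ fun b hb => ?_
    exact Ideal.mul_mem_left _ _ (Ideal.subset_span (Finset.mem_coe.2 (Finset.mem_image_of_mem g hb)))

end noetherian

section artinRees

variable {N : ℕ}

/-- The ideal of convergent power series generated by the variables. -/
noncomputable def varIdeal (N : ℕ) : Ideal (conv N) :=
  Ideal.span (Set.range fun i : Fin N =>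
    (⟨MvPowerSeries.monomial (Finsupp.single i 1) 1, monomial_mem_conv _ _⟩ : conv N))

lemma constantCoeff_eq_zero_of_mem_varIdeal {f : conv N} (hf : f ∈ varIdeal N) :
    MvPowerSeries.constantCoeff (f : MvPowerSeries (Fin N) ℂ) = 0 := by
  have h : varIdeal N ≤ RingHom.ker
      ((MvPowerSeries.constantCoeff (σ := Fin N) (R := ℂ)).comp (conv N).subtype) := by
    rw [varIdeal, Ideal.span_le]
    rintro _ ⟨i, rfl⟩
    change MvPowerSeries.constantCoeff (MvPowerSeries.monomial (Finsupp.single i 1) (1 : ℂ)) = 0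
    exact MvPowerSeries.constantCoeff_X i
  exact h hf

lemma mem_varIdeal_pow {K : ℕ} {f : conv N}
    (hf : ∀ α : Fin N →₀ ℕ, α.degree ≤ N * K →
      MvPowerSeries.coeff α (f : MvPowerSeries (Fin N) ℂ) = 0) :
    f ∈ varIdeal N ^ K := by
  classical
  set B : Finset (Fin N →₀ ℕ) := Finset.univ.image fun i : Fin N => Finsupp.single i K with hB
  obtain ⟨s, hs⟩ := f.2
  have hrem : remainder B (f : MvPowerSeries (Fin N) ℂ) = 0 := by
    ext α
    rw [coeff_remainder, map_zero]
    split_ifs with h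
    · rfl
    · refine hf α ?_
      rw [Finsupp.degree_eq_sum]
      refine (Finset.sum_le_card_nsmul Finset.univ _ K fun i _ => ?_).trans (by simp)
      by_contra! hi
      exact h ⟨_, Finset.mem_image_of_mem _ (Finset.mem_univ i),
        Finsupp.single_le_iff.2 hi.le⟩
  let q : (Fin N →₀ ℕ) → conv N := fun b =>
    if hb : b ∈ B then ⟨quot B b f, s, wnorm_quot_ne_top hs hb⟩ else 0
  have hq : ∀ b ∈ B, (q b : MvPowerSeries (Fin N) ℂ) = quot B b f := fun b hb => by
    simp [q, hb]
  have hsum : f = ∑ b ∈ B, q b * ⟨MvPowerSeries.monomial b 1, monomial_mem_conv b 1⟩ := by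
    apply Subtype.ext
    have h := remainder_add_sum_quot (B := B) (f : MvPowerSeries (Fin N) ℂ)
    rw [hrem, zero_add] at h
    nth_rewrite 1 [← h]
    simp only [AddSubmonoidClass.coe_finsetSum, MulMemClass.coe_mul]
    exact Finset.sum_congr rfl fun b hb => by rw [hq b hb]
  rw [hsum]
  refine Ideal.sum_mem _ fun b hb => Ideal.mul_mem_left _ _ ?_
  obtain ⟨i, -, rfl⟩ := Finset.mem_image.1 hb
  have hX : (⟨MvPowerSeries.monomial (Finsupp.single i K) 1, monomial_mem_conv _ 1⟩ : conv N) =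
      ⟨MvPowerSeries.monomial (Finsupp.single i 1) 1, monomial_mem_conv _ 1⟩ ^ K := by
    apply Subtype.ext
    rw [SubmonoidClass.coe_pow, MvPowerSeries.monomial_pow]
    simp
  rw [hX]
  exact Ideal.pow_mem_pow (Ideal.subset_span (Set.mem_range_self i)) K

lemma exists_order_forall_exists_kernel {n m : ℕ} (A : Matrix (Fin n) (Fin m) (conv N)) :
    ∃ k : ℕ, ∀ P : Fin m → conv N,
      (∀ i, ∀ α : Fin N →₀ ℕ, α.degree ≤ k →
        MvPowerSeries.coeff α (A.mulVec P i : MvPowerSeries (Fin N) ℂ) = 0) →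
      ∃ h : Fin m → conv N, A.mulVec h = 0 ∧
        ∀ j, MvPowerSeries.constantCoeff (h j : MvPowerSeries (Fin N) ℂ) =
          MvPowerSeries.constantCoeff (P j : MvPowerSeries (Fin N) ℂ) := by
  obtain ⟨k, hk⟩ := Ideal.exists_pow_inf_eq_pow_smul (varIdeal N) (LinearMap.range A.mulVecLin)
  refine ⟨N * (k + 1), fun P hP => ?_⟩
  have hmem : A.mulVec P ∈ (varIdeal N ^ (k + 1) • ⊤ : Submodule (conv N) (Fin n → conv N)) := by
    rw [pi_eq_sum_univ (A.mulVec P)]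
    exact Submodule.sum_mem _ fun i _ =>
      Submodule.smul_mem_smul (mem_varIdeal_pow (hP i)) Submodule.mem_top
  have h1 : A.mulVec P ∈ varIdeal N • LinearMap.range A.mulVecLin := by
    have h2 : A.mulVec P ∈ (varIdeal N ^ (k + 1) • ⊤ : Submodule (conv N) (Fin n → conv N)) ⊓
      LinearMap.range A.mulVecLin := ⟨hmem, P, rfl⟩
    rw [hk (k + 1) (Nat.le_succ k), Nat.add_sub_cancel_left, pow_one] at h2
    exact Submodule.smul_mono le_rfl inf_le_right h2
  rw [LinearMap.range_eq_map, ← Submodule.map_smul''] at h1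
  obtain ⟨g, hg, hgA⟩ := h1
  refine ⟨P - g, ?_, fun j => ?_⟩
  · rw [Matrix.mulVec_sub, sub_eq_zero]
    exact hgA.symm
  · have hgj : g j ∈ varIdeal N := by
      clear hgA
      induction hg using Submodule.smul_induction_on' with
      | smul r hr x _ => exact Ideal.mul_mem_right (x j) _ hr
      | add x _ y _ hx hy => exact Ideal.add_mem _ hx hy
    rw [Pi.sub_apply, AddSubgroupClass.coe_sub, map_sub,
      constantCoeff_eq_zero_of_mem_varIdeal hgj, sub_zero]

end artinRees

section eval

variable {N : ℕ}

/-- The sum of a power series at a point. -/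
noncomputable def evalSeries (f : MvPowerSeries (Fin N) ℂ) (z : Fin N → ℂ) : ℂ :=
  ∑' α, MvPowerSeries.coeff α f * ∏ i, z i ^ α i

/-- A radius on which the power series with finite `wnorm s` converge absolutely. -/
noncomputable def polyradius (N s : ℕ) : ℝ := ((∏ i : Fin N, Nat.nth Nat.Prime i : ℕ) : ℝ)⁻¹ ^ s

lemma prod_prime_pos (N : ℕ) : 0 < ∏ i : Fin N, Nat.nth Nat.Prime i :=
  Finset.prod_pos fun i _ => (prime_nth i).pos

lemma polyradius_pos (N s : ℕ) : 0 < polyradius N s :=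
  pow_pos (inv_pos.2 (by exact_mod_cast prod_prime_pos N)) _

lemma polyradius_le (i : Fin N) (s : ℕ) :
    polyradius N s ≤ ((Nat.nth Nat.Prime i : ℝ)⁻¹) ^ s := by
  have hp : (0 : ℝ) < Nat.nth Nat.Prime i := by exact_mod_cast (prime_nth i).pos
  refine pow_le_pow_left₀ (by positivity) (inv_anti₀ hp ?_) _
  exact_mod_cast Nat.le_of_dvd (prod_prime_pos N)
    (Finset.dvd_prod_of_mem (fun i : Fin N => Nat.nth Nat.Prime i) (Finset.mem_univ i))

lemma norm_monomial_le {s : ℕ} {t : ℝ} {z : Fin N → ℂ} (hz : ‖z‖ ≤ t * polyradius N s)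
    (ht : 0 ≤ t) (α : Fin N →₀ ℕ) :
    ‖∏ i, z i ^ α i‖ ≤ t ^ α.degree * ((weight α : ℝ)⁻¹) ^ s := by
  have h1 : ((weight α : ℝ)⁻¹) ^ s = ∏ i : Fin N, (((Nat.nth Nat.Prime i : ℝ)⁻¹) ^ s) ^ α i := by
    rw [weight, Nat.cast_prod, ← Finset.prod_inv_distrib, ← Finset.prod_pow]
    refine Finset.prod_congr rfl fun i _ => ?_
    push_cast
    rw [← inv_pow, ← pow_mul, ← pow_mul, mul_comm]
  rw [h1, Finsupp.degree_eq_sum, ← Finset.prod_pow_eq_pow_sum, ← Finset.prod_mul_distrib, norm_prod]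
  refine Finset.prod_le_prod (fun _ _ => norm_nonneg _) fun i _ => ?_
  rw [norm_pow, ← mul_pow]
  refine pow_le_pow_left₀ (norm_nonneg _) ?_ _
  exact (norm_le_pi_norm z i).trans (hz.trans (mul_le_mul_of_nonneg_left (polyradius_le i s) ht))

lemma norm_monomial_le_of_norm_le {s : ℕ} {z : Fin N → ℂ} (hz : ‖z‖ ≤ polyradius N s)
    (α : Fin N →₀ ℕ) : ‖∏ i, z i ^ α i‖ ≤ ((weight α : ℝ)⁻¹) ^ s := by
  simpa using norm_monomial_le (t := 1) (by simpa using hz) zero_le_one α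

lemma summable_of_wnorm_ne_top {s : ℕ} {f : MvPowerSeries (Fin N) ℂ} (hf : wnorm s f ≠ ∞) :
    Summable fun α => ‖MvPowerSeries.coeff α f‖ * ((weight α : ℝ)⁻¹) ^ s := by
  have h := ENNReal.summable_toReal hf
  refine h.congr fun α => ?_
  simp

lemma wnorm_ne_top_of_summable {s : ℕ} {f : MvPowerSeries (Fin N) ℂ}
    (hf : Summable fun α => ‖MvPowerSeries.coeff α f‖ * ((weight α : ℝ)⁻¹) ^ s) :
    wnorm s f ≠ ∞ := by
  have h := hf.tsum_ofReal_ne_top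
  rw [wnorm]
  convert h using 3 with α
  have hw : (0 : ℝ) < weight α := by exact_mod_cast weight_pos α
  rw [ENNReal.ofReal_mul (norm_nonneg _), ofReal_norm, ENNReal.ofReal_pow (by positivity),
    ENNReal.ofReal_inv_of_pos hw, ENNReal.ofReal_natCast]

lemma summable_norm_term {s : ℕ} {f : MvPowerSeries (Fin N) ℂ} (hf : wnorm s f ≠ ∞)
    {z : Fin N → ℂ} (hz : ‖z‖ ≤ polyradius N s) :
    Summable fun α => ‖MvPowerSeries.coeff α f * ∏ i, z i ^ α i‖ := by
  refine (summable_of_wnorm_ne_top hf).of_nonneg_of_le (fun _ => norm_nonneg _) fun α => ?_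
  rw [norm_mul]
  exact mul_le_mul_of_nonneg_left (norm_monomial_le_of_norm_le hz α) (norm_nonneg _)

lemma evalSeries_zero_left (z : Fin N → ℂ) : evalSeries 0 z = 0 := by simp [evalSeries]

lemma evalSeries_add {s : ℕ} {f g : MvPowerSeries (Fin N) ℂ} (hf : wnorm s f ≠ ∞)
    (hg : wnorm s g ≠ ∞) {z : Fin N → ℂ} (hz : ‖z‖ ≤ polyradius N s) :
    evalSeries (f + g) z = evalSeries f z + evalSeries g z := by
  rw [evalSeries, evalSeries, evalSeries,
    ← (summable_norm_term hf hz).of_norm.tsum_add (summable_norm_term hg hz).of_norm]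
  simp [add_mul]

lemma evalSeries_mul {s : ℕ} {f g : MvPowerSeries (Fin N) ℂ} (hf : wnorm s f ≠ ∞)
    (hg : wnorm s g ≠ ∞) {z : Fin N → ℂ} (hz : ‖z‖ ≤ polyradius N s) :
    evalSeries (f * g) z = evalSeries f z * evalSeries g z := by
  classical
  have hf' := summable_norm_term hf hz
  have hg' := summable_norm_term hg hz
  have hterm : ∀ α, MvPowerSeries.coeff α (f * g) * ∏ i, z i ^ α i =
      ∑ p ∈ Finset.HasAntidiagonal.antidiagonal α,
        (MvPowerSeries.coeff p.1 f * ∏ i, z i ^ p.1 i) *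
          (MvPowerSeries.coeff p.2 g * ∏ i, z i ^ p.2 i) := by
    intro α
    rw [MvPowerSeries.coeff_mul, Finset.sum_mul]
    refine Finset.sum_congr rfl fun p hp => ?_
    rw [← Finset.HasAntidiagonal.mem_antidiagonal.1 hp]
    simp only [Finsupp.add_apply, pow_add, Finset.prod_mul_distrib]
    ring
  have key : ∀ a b : (Fin N →₀ ℕ) → ℂ, (Summable fun α => ‖a α‖) → (Summable fun α => ‖b α‖) →
      (∑' α, a α) * ∑' α, b α =
        ∑' α, ∑ p ∈ Finset.HasAntidiagonal.antidiagonal α, a p.1 * b p.2 := fun a b ha hb =>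
    ha.of_norm.tsum_mul_tsum_eq_tsum_sum_antidiagonal hb.of_norm
      (summable_mul_of_summable_norm ha hb)
  exact (tsum_congr hterm).trans (key _ _ hf' hg').symm

lemma evalSeries_sum {ι : Type*} {s : ℕ} (B : Finset ι) {f : ι → MvPowerSeries (Fin N) ℂ}
    (hf : ∀ b ∈ B, wnorm s (f b) ≠ ∞) {z : Fin N → ℂ} (hz : ‖z‖ ≤ polyradius N s) :
    evalSeries (∑ b ∈ B, f b) z = ∑ b ∈ B, evalSeries (f b) z := by
  classical
  induction B using Finset.induction_on with
  | empty => simp [evalSeries_zero_left]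
  | insert a B ha ih =>
    rw [Finset.sum_insert ha, Finset.sum_insert ha, evalSeries_add (hf a (by simp)) _ hz,
      ih fun b hb => hf b (by simp [hb])]
    exact ne_top_of_le_ne_top (ENNReal.sum_ne_top.2 fun b hb => hf b (by simp [hb]))
      (wnorm_sum_le s B f)

lemma evalSeries_zero_right (f : MvPowerSeries (Fin N) ℂ) :
    evalSeries f 0 = MvPowerSeries.constantCoeff f := by
  rw [evalSeries, tsum_eq_single 0]
  · simp
  · intro α hα
    obtain ⟨i, hi⟩ := Finsupp.ne_iff.1 hα
    rw [Finset.prod_eq_zero (Finset.mem_univ i), mul_zero]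
    simpa using hi

lemma evalSeries_coe (p : MvPolynomial (Fin N) ℂ) (z : Fin N → ℂ) :
    evalSeries (p : MvPowerSeries (Fin N) ℂ) z = MvPolynomial.eval z p := by
  rw [evalSeries, MvPolynomial.eval_eq', tsum_eq_sum (s := p.support)]
  · simp
  · intro α hα
    simp only [MvPolynomial.coeff_coe, MvPolynomial.notMem_support_iff.1 hα, zero_mul]

lemma wnorm_coe_ne_top (s : ℕ) (p : MvPolynomial (Fin N) ℂ) :
    wnorm s (p : MvPowerSeries (Fin N) ℂ) ≠ ∞ :=
  wnorm_ne_top_of_finite_support s p.support.finite_toSet fun α hα => by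
    simpa using hα

lemma evalSeries_isLittleO {k s : ℕ} {f : MvPowerSeries (Fin N) ℂ} (hf : wnorm s f ≠ ∞)
    (h : ∀ α, α.degree ≤ k → MvPowerSeries.coeff α f = 0) :
    (fun z => evalSeries f z) =o[𝓝 0] fun z : Fin N → ℂ => ‖z‖ ^ k := by
  have hO : (fun z => evalSeries f z) =O[𝓝 0] fun z : Fin N → ℂ => ‖z‖ ^ (k + 1) := by
    refine IsBigO.of_bound ((∑' α, ‖MvPowerSeries.coeff α f‖ * ((weight α : ℝ)⁻¹) ^ s) *
      ((polyradius N s)⁻¹) ^ (k + 1)) ?_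
    filter_upwards [Metric.closedBall_mem_nhds (0 : Fin N → ℂ) (polyradius_pos N s)] with z hz
    rw [mem_closedBall_zero_iff] at hz
    have hr := polyradius_pos N s
    set t := ‖z‖ / polyradius N s with ht
    have ht0 : 0 ≤ t := by positivity
    have ht1 : t ≤ 1 := (div_le_one hr).2 hz
    have hzt : ‖z‖ ≤ t * polyradius N s := by rw [ht, div_mul_cancel₀ _ hr.ne']
    have hsum := (summable_of_wnorm_ne_top hf).mul_right (t ^ (k + 1))
    rw [norm_pow, norm_norm, mul_assoc, ← mul_pow, inv_mul_eq_div, ← ht, ← tsum_mul_right]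
    refine (norm_tsum_le_tsum_norm (summable_norm_term hf hz)).trans
      ((summable_norm_term hf hz).tsum_le_tsum (fun α => ?_) hsum)
    rcases le_or_gt α.degree k with hα | hα
    · simp [h α hα]
    · rw [norm_mul, mul_assoc]
      refine mul_le_mul_of_nonneg_left ?_ (norm_nonneg _)
      refine (norm_monomial_le hzt ht0 α).trans ?_
      rw [mul_comm]
      exact mul_le_mul_of_nonneg_left (pow_le_pow_of_le_one ht0 ht1 hα) (by positivity)
  refine hO.trans_isLittleO ?_
  exact isLittleO_norm_pow_norm_pow (Nat.lt_succ_self k)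

lemma differentiableOn_evalSeries {s : ℕ} {f : MvPowerSeries (Fin N) ℂ} (hf : wnorm s f ≠ ∞) :
    DifferentiableOn ℂ (evalSeries f) (Metric.ball 0 (polyradius N s / 2)) := by
  set r := polyradius N s / 2 with hrdef
  have hr : 0 < r := half_pos (polyradius_pos N s)
  set g : (Fin N →₀ ℕ) → (Fin N → ℂ) → ℂ := fun α z =>
    MvPowerSeries.coeff α f * ∏ i, z i ^ α i with hg
  have hgd : ∀ α, Differentiable ℂ (g α) := fun α => by
    simp only [hg]
    fun_prop
  have hbound : ∀ α, ∀ z ∈ Metric.ball (0 : Fin N → ℂ) (2 * r), ‖g α z‖ ≤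
      ‖MvPowerSeries.coeff α f‖ * ((weight α : ℝ)⁻¹) ^ s := by
    intro α z hz
    rw [mem_ball_zero_iff] at hz
    rw [hg, norm_mul]
    refine mul_le_mul_of_nonneg_left (norm_monomial_le_of_norm_le ?_ α) (norm_nonneg _)
    linarith
  have hsum := ((summable_of_wnorm_ne_top hf).mul_left 3).mul_right r⁻¹
  have hd : ∀ z ∈ Metric.ball (0 : Fin N → ℂ) r, DifferentiableAt ℂ (evalSeries f) z := by
    intro z hz
    refine (hasFDerivAt_tsum_of_isPreconnected hsum Metric.isOpen_ball
      (convex_ball (0 : Fin N → ℂ) r).isPreconnected (fun α x _ => (hgd α x).hasFDerivAt)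
      (fun α x hx => ?_) (Metric.mem_ball_self hr) ?_ hz).differentiableAt
    · rw [← div_eq_mul_inv]
      refine Complex.norm_fderiv_le_div_of_mapsTo_ball (hgd α).differentiableOn ?_ hr
      have hsub : ∀ y ∈ Metric.ball x r, y ∈ Metric.ball (0 : Fin N → ℂ) (2 * r) := by
        intro y hy
        rw [mem_ball_zero_iff] at hx ⊢
        rw [mem_ball_iff_norm] at hy
        calc ‖y‖ = ‖(y - x) + x‖ := by simp
          _ ≤ ‖y - x‖ + ‖x‖ := norm_add_le _ _
          _ < 2 * r := by linarith
      intro y hy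
      rw [mem_closedBall_iff_norm]
      have h1 := hbound α y (hsub y hy)
      have h2 := hbound α x (hsub x (Metric.mem_ball_self hr))
      have h3 : 0 ≤ ‖MvPowerSeries.coeff α f‖ * ((weight α : ℝ)⁻¹) ^ s := by positivity
      linarith [norm_sub_le (g α y) (g α x)]
    · exact (summable_norm_term hf (by simpa using (polyradius_pos N s).le)).of_norm
  exact fun z hz => (hd z hz).differentiableWithinAt

end eval

section cauchy

open MeasureTheory

lemma hasSum_prod_geometric : ∀ (N : ℕ) (u : Fin N → ℂ), (∀ i, ‖u i‖ < 1) →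
    (Summable fun a : Fin N → ℕ => ‖∏ i, u i ^ a i‖) ∧
      HasSum (fun a : Fin N → ℕ => ∏ i, u i ^ a i) (∏ i, (1 - u i)⁻¹) := by
  intro N
  induction N with
  | zero =>
    intro u _
    exact ⟨(hasSum_fintype _).summable, by simp⟩
  | succ N ih =>
    intro u hu
    obtain ⟨h1, h2⟩ := ih (fun i => u i.succ) fun i => hu i.succ
    have h3 : Summable fun n : ℕ => ‖u 0 ^ n‖ := by
      simpa using summable_geometric_of_lt_one (norm_nonneg (u 0)) (hu 0)
    have h4 := hasSum_geometric_of_norm_lt_one (hu 0)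
    have e : ∀ p : ℕ × (Fin N → ℕ), ∏ i, u i ^ (Fin.consEquiv (fun _ => ℕ) p) i =
        u 0 ^ p.1 * ∏ i : Fin N, u i.succ ^ p.2 i := by
      intro p
      rw [Fin.prod_univ_succ]
      simp [Fin.consEquiv]
    have h5 : Summable fun p : ℕ × (Fin N → ℕ) =>
        ‖u 0 ^ p.1 * ∏ i : Fin N, u i.succ ^ p.2 i‖ :=
      h3.mul_norm (g := fun a : Fin N → ℕ => ∏ i, u i.succ ^ a i) h1
    constructor
    · rw [← (Fin.consEquiv fun _ => ℕ).summable_iff]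
      refine h5.congr fun p => ?_
      rw [Function.comp_apply, e]
    · rw [← (Fin.consEquiv fun _ => ℕ).hasSum_iff, Fin.prod_univ_succ]
      have h6 := HasSum.mul (g := fun a : Fin N → ℕ => ∏ i, u i.succ ^ a i) h4 h2 h5.of_norm
      exact (funext e : (fun a : Fin (N + 1) → ℕ => ∏ i, u i ^ a i) ∘ _ = _) ▸ h6

variable {N : ℕ}

lemma norm_torusMap (r : ℝ) (hr : 0 ≤ r) (θ : Fin N → ℝ) (i : Fin N) :
    ‖torusMap (0 : Fin N → ℂ) (fun _ => r) θ i‖ = r := by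
  simp [torusMap, abs_of_nonneg hr]

lemma torusMap_mem_closedBall {r : ℝ} (hr : 0 ≤ r) (θ : Fin N → ℝ) :
    torusMap (0 : Fin N → ℂ) (fun _ => r) θ ∈ Metric.closedBall 0 r := by
  rw [mem_closedBall_zero_iff, pi_norm_le_iff_of_nonneg hr]
  exact fun i => (norm_torusMap r hr θ i).le

lemma continuous_torusMap (c : Fin N → ℂ) (R : Fin N → ℝ) : Continuous (torusMap c R) := by
  unfold torusMap
  fun_prop

lemma continuous_torusMap_apply (c : Fin N → ℂ) (R : Fin N → ℝ) (i : Fin N) :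
    Continuous fun θ => torusMap c R θ i := by
  unfold torusMap
  fun_prop

lemma continuous_cauchy_integrand {r : ℝ} (hr : 0 < r) {g : (Fin N → ℂ) → ℂ}
    (hg : ContinuousOn g (Metric.closedBall 0 r)) {w : Fin N → ℂ} (hw : ‖w‖ < r) :
    Continuous fun θ : Fin N → ℝ =>
      (∏ i, (torusMap (0 : Fin N → ℂ) (fun _ => r) θ i - w i)⁻¹) *
        g (torusMap 0 (fun _ => r) θ) := by
  refine Continuous.mul (continuous_finsetProd _ fun i _ => ?_)
    (hg.comp_continuous (continuous_torusMap _ _) fun θ => torusMap_mem_closedBall hr.le θ)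
  have hc : Continuous fun θ : Fin N → ℝ => torusMap (0 : Fin N → ℂ) (fun _ => r) θ i - w i :=
    (continuous_torusMap_apply _ _ i).sub continuous_const
  refine hc.inv₀ fun θ h => ?_
  have h1 := norm_torusMap r hr.le θ i
  rw [sub_eq_zero] at h
  rw [h] at h1
  exact absurd (h1 ▸ norm_le_pi_norm w i) (not_le.2 hw)

/-- The Cauchy integral formula on a polydisc. -/
lemma torusIntegral_prod_sub_inv_mul : ∀ (N : ℕ) {r : ℝ} (_ : 0 < r) {g : (Fin N → ℂ) → ℂ}
    (_ : DifferentiableOn ℂ g (Metric.closedBall 0 r)) {w : Fin N → ℂ} (_ : ‖w‖ < r),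
    torusIntegral (fun z => (∏ i, (z i - w i)⁻¹) * g z) 0 (fun _ => r) =
      (2 * Real.pi * Complex.I) ^ N * g w := by
  intro N
  induction N with
  | zero =>
    intro r hr g hg w hw
    rw [torusIntegral_dim0]
    simp [Subsingleton.elim w 0]
  | succ N ih =>
    intro r hr g hg w hw
    have hint : TorusIntegrable (fun z : Fin (N + 1) → ℂ => (∏ i, (z i - w i)⁻¹) * g z) 0
        (fun _ => r) :=
      (continuous_cauchy_integrand hr hg.continuousOn hw).continuousOn.integrableOn_compact
        isCompact_Icc
    have hcons : ∀ (x : ℂ) (y : Fin N → ℂ), ‖x‖ ≤ r → ‖y‖ ≤ r →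
        (Fin.cons x y : Fin (N + 1) → ℂ) ∈ Metric.closedBall 0 r := by
      intro x y hx hy
      rw [mem_closedBall_zero_iff, pi_norm_le_iff_of_nonneg hr.le]
      exact Fin.cases (by simpa) fun i => by simpa using (norm_le_pi_norm y i).trans hy
    have hw' : ‖fun i : Fin N => w i.succ‖ < r :=
      (pi_norm_lt_iff hr).2 fun i => (norm_le_pi_norm w i.succ).trans_lt hw
    have hw0 : ‖w 0‖ < r := (norm_le_pi_norm w 0).trans_lt hw
    rw [torusIntegral_succ hint]
    have hinner : ∀ x ∈ Metric.sphere (0 : ℂ) r,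
        torusIntegral (fun y : Fin N → ℂ => (∏ i, ((Fin.cons x y : Fin (N + 1) → ℂ) i - w i)⁻¹) *
          g (Fin.cons x y)) 0 (fun _ => r) =
        (x - w 0)⁻¹ • ((2 * Real.pi * Complex.I) ^ N * g (Fin.cons x fun i => w i.succ)) := by
      intro x hx
      have hx' : ‖x‖ ≤ r := by simpa using (mem_sphere_zero_iff_norm.1 hx).le
      have hgx : DifferentiableOn ℂ (fun y : Fin N → ℂ => g (Fin.cons x y))
          (Metric.closedBall 0 r) := by
        refine hg.comp (t := Metric.closedBall 0 r) ?_ fun y hy =>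
          hcons x y hx' (mem_closedBall_zero_iff.1 hy)
        refine Differentiable.differentiableOn (differentiable_pi.2 ?_)
        exact Fin.cases (by simp) fun i => by simp only [Fin.cons_succ]; fun_prop
      rw [← ih hr hgx hw', smul_eq_mul, ← torusIntegral_const_mul]
      congr 1
      ext y
      rw [Fin.prod_univ_succ]
      simp [mul_assoc]
    have hout : DifferentiableOn ℂ (fun x : ℂ => (2 * Real.pi * Complex.I) ^ N *
        g (Fin.cons x fun i => w i.succ)) (Metric.closedBall 0 r) := by
      refine DifferentiableOn.const_mul (hg.comp (t := Metric.closedBall 0 r) ?_ fun x hx =>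
          hcons x _ (mem_closedBall_zero_iff.1 hx) hw'.le) _
      refine Differentiable.differentiableOn (differentiable_pi.2 ?_)
      exact Fin.cases (by simp) fun i => by simp
    have houter := hout.circleIntegral_sub_inv_smul (w := w 0) (by simpa using hw0)
    rw [show (0 : Fin (N + 1) → ℂ) 0 = 0 from rfl]
    refine (circleIntegral.integral_congr hr.le fun x hx => ?_).trans
      (houter.trans ?_)
    · exact hinner x hx
    · have : (Fin.cons (w 0) fun i : Fin N => w i.succ : Fin (N + 1) → ℂ) = w :=
        Fin.cons_self_tail w
      rw [this, smul_eq_mul, pow_succ]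
      ring

lemma summable_inv_weight_sq : Summable fun α : Fin N →₀ ℕ => ((weight α : ℝ)⁻¹) ^ 2 := by
  have h : Summable fun n : ℕ => ((n : ℝ)⁻¹) ^ 2 := by
    simp
  exact h.comp_injective weight_injective

/-- The Taylor coefficients at the origin, given by Cauchy integrals over a torus of radius `r`. -/
noncomputable def cauchySeries (g : (Fin N → ℂ) → ℂ) (r : ℝ) : MvPowerSeries (Fin N) ℂ := fun α =>
  ((2 * Real.pi * Complex.I) ^ N)⁻¹ *
    torusIntegral (fun z => (∏ i, (z i)⁻¹ ^ (α i + 1)) * g z) 0 (fun _ => r)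

lemma coeff_cauchySeries (g : (Fin N → ℂ) → ℂ) (r : ℝ) (α : Fin N →₀ ℕ) :
    MvPowerSeries.coeff α (cauchySeries g r) = ((2 * Real.pi * Complex.I) ^ N)⁻¹ *
      torusIntegral (fun z => (∏ i, (z i)⁻¹ ^ (α i + 1)) * g z) 0 (fun _ => r) := rfl

lemma norm_coeff_cauchySeries_le {r C : ℝ} (hr : 0 < r) {g : (Fin N → ℂ) → ℂ}
    (hC : ∀ z ∈ Metric.closedBall 0 r, ‖g z‖ ≤ C) (α : Fin N →₀ ℕ) :
    ‖MvPowerSeries.coeff α (cauchySeries g r)‖ ≤ C * r⁻¹ ^ α.degree := by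
  have h := norm_torusIntegral_le_of_norm_le_const (n := N) (c := 0) (R := fun _ => r)
    (f := fun z => (∏ i, (z i)⁻¹ ^ (α i + 1)) * g z) (C := r⁻¹ ^ (α.degree + N) * C) (by
      intro θ
      rw [norm_mul, norm_prod]
      simp only [norm_pow, norm_inv, norm_torusMap r hr.le]
      rw [Finset.prod_pow_eq_pow_sum, Finset.sum_add_distrib, ← Finsupp.degree_eq_sum]
      simp only [Finset.sum_const, Finset.card_univ, Fintype.card_fin, smul_eq_mul, mul_one]
      exact mul_le_mul_of_nonneg_left (hC _ (torusMap_mem_closedBall hr.le θ)) (by positivity))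
  rw [coeff_cauchySeries, norm_mul]
  refine (mul_le_mul_of_nonneg_left h (norm_nonneg _)).trans (le_of_eq ?_)
  have hpi := Real.pi_pos
  simp only [norm_inv, norm_pow, norm_mul, Complex.norm_ofNat, Complex.norm_real, Real.norm_eq_abs,
    abs_of_pos hpi, Complex.norm_I, abs_of_pos hr, Finset.prod_const, Finset.card_univ,
    Fintype.card_fin, mul_one]
  rw [pow_add, inv_pow r N]
  field_simp

lemma cauchySeries_mem_conv {r C : ℝ} (hr : 0 < r) {g : (Fin N → ℂ) → ℂ}
    (hC : ∀ z ∈ Metric.closedBall 0 r, ‖g z‖ ≤ C) : cauchySeries g r ∈ conv N := by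
  obtain ⟨s, hs⟩ := exists_pow_lt_of_lt_one hr (one_half_lt_one : (1 / 2 : ℝ) < 1)
  refine mem_conv.2 ⟨s + 2, wnorm_ne_top_of_summable ?_⟩
  refine (summable_inv_weight_sq.mul_left C).of_nonneg_of_le (fun _ => by positivity) fun α => ?_
  have hC0 : 0 ≤ C := (norm_nonneg _).trans (hC 0 (by simpa using hr.le))
  have hw : (0 : ℝ) < weight α := by exact_mod_cast weight_pos α
  have h2 : ((weight α : ℝ)⁻¹) ^ s ≤ r ^ α.degree := by
    calc ((weight α : ℝ)⁻¹) ^ s ≤ (((2 : ℝ) ^ α.degree)⁻¹) ^ s := by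
          refine pow_le_pow_left₀ (by positivity) (inv_anti₀ (by positivity) ?_) _
          exact_mod_cast two_pow_degree_le_weight α
      _ = ((1 / 2 : ℝ) ^ s) ^ α.degree := by
          rw [← inv_pow, ← pow_mul, ← pow_mul, one_div, mul_comm]
      _ ≤ r ^ α.degree := pow_le_pow_left₀ (by positivity) hs.le _
  calc _ ≤ C * r⁻¹ ^ α.degree * ((weight α : ℝ)⁻¹) ^ (s + 2) :=
        mul_le_mul_of_nonneg_right (norm_coeff_cauchySeries_le hr hC α) (by positivity)
    _ = C * ((weight α : ℝ)⁻¹) ^ 2 * (r⁻¹ ^ α.degree * ((weight α : ℝ)⁻¹) ^ s) := by ring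
    _ ≤ C * ((weight α : ℝ)⁻¹) ^ 2 * (r⁻¹ ^ α.degree * r ^ α.degree) := by gcongr
    _ = C * ((weight α : ℝ)⁻¹) ^ 2 := by
        rw [← mul_pow, inv_mul_cancel₀ hr.ne', one_pow, mul_one]

lemma evalSeries_cauchySeries {r C : ℝ} (hr : 0 < r) {g : (Fin N → ℂ) → ℂ}
    (hg : DifferentiableOn ℂ g (Metric.closedBall 0 r))
    (hC : ∀ z ∈ Metric.closedBall 0 r, ‖g z‖ ≤ C) {w : Fin N → ℂ} (hw : ‖w‖ < r) :
    evalSeries (cauchySeries g r) w = g w := by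
  have hC0 : 0 ≤ C := (norm_nonneg _).trans (hC 0 (by simpa using hr.le))
  have hgeom : ∀ z : Fin N → ℂ, (∀ i, ‖z i‖ = r) →
      (Summable fun α : Fin N →₀ ℕ => ‖∏ i, (w i / z i) ^ α i‖) ∧
        HasSum (fun α : Fin N →₀ ℕ => ∏ i, (w i / z i) ^ α i) (∏ i, (1 - w i / z i)⁻¹) := by
    intro z hz
    obtain ⟨h1, h2⟩ := hasSum_prod_geometric N (fun i => w i / z i) fun i => by
      rw [norm_div, hz i, div_lt_one hr]
      exact (norm_le_pi_norm w i).trans_lt hw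
    exact ⟨(Finsupp.equivFunOnFinite (α := Fin N) (M := ℕ)).summable_iff
        (f := fun a : Fin N → ℕ => ‖∏ i, (w i / z i) ^ a i‖).2 h1,
      (Finsupp.equivFunOnFinite (α := Fin N) (M := ℕ)).hasSum_iff
        (f := fun a : Fin N → ℕ => ∏ i, (w i / z i) ^ a i).2 h2⟩
  have hfac : ∀ z : Fin N → ℂ, (∀ i, ‖z i‖ = r) → ∀ α : Fin N →₀ ℕ,
      (∏ i, (z i)⁻¹ ^ (α i + 1)) * ∏ i, w i ^ α i = (∏ i, (z i)⁻¹) * ∏ i, (w i / z i) ^ α i := by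
    intro z hz α
    rw [← Finset.prod_mul_distrib, ← Finset.prod_mul_distrib]
    refine Finset.prod_congr rfl fun i _ => ?_
    rw [div_eq_mul_inv]
    ring
  have hnz : ∀ z : Fin N → ℂ, (∀ i, ‖z i‖ = r) → ∀ i, z i ≠ 0 := fun z hz i h => by
    have := hz i
    rw [h, norm_zero] at this
    exact hr.ne this
  have hsum : HasSum (fun α : Fin N →₀ ℕ =>
      torusIntegral (fun z => (∏ i, (z i)⁻¹ ^ (α i + 1)) * g z * ∏ i, w i ^ α i) 0 (fun _ => r))
      (torusIntegral (fun z => (∏ i, (z i - w i)⁻¹) * g z) 0 (fun _ => r)) := by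
    have hb := (hgeom (fun _ => r) fun i => by simp [abs_of_pos hr]).1
    refine hasSum_integral_of_dominated_convergence
      (fun α _ => r ^ N * (r⁻¹ ^ N * ‖∏ i, (w i / (r : ℂ)) ^ α i‖ * C)) (fun α => ?_)
      (fun α => Eventually.of_forall fun θ => ?_) (Eventually.of_forall fun θ => ?_) ?_
      (Eventually.of_forall fun θ => ?_)
    · refine Continuous.aestronglyMeasurable ?_
      have h1 := hg.continuousOn.comp_continuous (continuous_torusMap (0 : Fin N → ℂ) fun _ => r)
        fun θ => torusMap_mem_closedBall hr.le θ
      have h2 : ∀ i, Continuous fun θ : Fin N → ℝ =>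
          (torusMap (0 : Fin N → ℂ) (fun _ => r) θ i)⁻¹ := fun i =>
        (continuous_torusMap_apply _ _ i).inv₀ fun θ => hnz _ (norm_torusMap r hr.le θ) i
      have h3 : Continuous fun θ : Fin N → ℝ =>
          ∏ i : Fin N, ((r : ℂ) * Complex.exp (θ i * Complex.I) * Complex.I) := by fun_prop
      exact h3.smul (((continuous_finsetProd _ fun i _ =>
        (h2 i).pow _).mul h1).mul continuous_const)
    · have hz := norm_torusMap r hr.le θ
      beta_reduce
      rw [norm_smul, mul_right_comm _ (g _), hfac _ hz, norm_mul, norm_mul]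
      simp only [norm_prod, norm_mul, norm_pow, norm_inv, norm_div, hz, Complex.norm_real,
        Real.norm_eq_abs, abs_of_pos hr, Complex.norm_I, Complex.norm_exp_ofReal_mul_I, mul_one,
        Finset.prod_const, Finset.card_univ, Fintype.card_fin]
      gcongr
      exact hC _ (torusMap_mem_closedBall hr.le θ)
    · exact ((hb.mul_left _).mul_right _).mul_left _
    · exact integrableOn_const (by exact isCompact_Icc.measure_lt_top.ne)
    · have hz := norm_torusMap r hr.le θ
      have h := ((hgeom _ hz).2.mul_left
        (∏ i, (torusMap (0 : Fin N → ℂ) (fun _ => r) θ i)⁻¹)).mul_right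
          (g (torusMap (0 : Fin N → ℂ) (fun _ => r) θ))
      simp only [smul_eq_mul]
      refine HasSum.mul_left _ ?_
      convert h using 1
      · ext α
        rw [mul_right_comm, hfac _ hz]
      · congr 1
        rw [← Finset.prod_mul_distrib]
        refine Finset.prod_congr rfl fun i _ => ?_
        rw [← mul_inv, mul_sub, mul_one, mul_div_cancel₀ _ (hnz _ hz i)]
  rw [torusIntegral_prod_sub_inv_mul N hr hg hw] at hsum
  have h2 := hsum.mul_left ((2 * Real.pi * Complex.I : ℂ) ^ N)⁻¹
  rw [inv_mul_cancel_left₀ (pow_ne_zero _ Complex.two_pi_I_ne_zero)] at h2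
  rw [← h2.tsum_eq, evalSeries]
  refine tsum_congr fun α => ?_
  rw [coeff_cauchySeries, mul_assoc, mul_comm (torusIntegral _ _ _), ← torusIntegral_const_mul]
  congr 3
  ext z
  ring

/-- A function that is holomorphic near the origin is the sum of a convergent power series. -/
lemma exists_evalSeries_eq {U : Set (Fin N → ℂ)} (hU : U ∈ 𝓝 0) {g : (Fin N → ℂ) → ℂ}
    (hg : DifferentiableOn ℂ g U) :
    ∃ F : conv N, ∀ᶠ z in 𝓝 0, evalSeries (F : MvPowerSeries (Fin N) ℂ) z = g z := by
  obtain ⟨r, hr, hrU⟩ := Metric.nhds_basis_closedBall.mem_iff.1 hU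
  have hgr := hg.mono hrU
  obtain ⟨C, hC⟩ := (isCompact_closedBall (0 : Fin N → ℂ) r).exists_bound_of_continuousOn
    hgr.continuousOn
  refine ⟨⟨_, cauchySeries_mem_conv hr hC⟩, ?_⟩
  filter_upwards [Metric.ball_mem_nhds 0 hr] with w hw
  exact evalSeries_cauchySeries hr hgr hC (mem_ball_zero_iff.1 hw)

end cauchy

end ConvergentSeries

section jets

variable {ι : Type*} [Fintype ι]

/-- The value of a complex polynomial at a point with real coordinates. -/
noncomputable def MvPolynomial.evalReal (R : MvPolynomial ι ℂ) (x : ι → ℝ) : ℂ :=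
  MvPolynomial.eval (fun i => (x i : ℂ)) R

lemma MvPolynomial.exists_hasDerivAt_evalReal (a : ι) (Q : MvPolynomial ι ℂ) :
    ∃ P : MvPolynomial ι ℂ, P.evalReal 0 = 0 ∧ ∀ (x : ι → ℝ) (t : ℝ),
      HasDerivAt (fun t : ℝ => P.evalReal (t • x)) (x a * Q.evalReal (t • x)) t := by
  induction Q using MvPolynomial.induction_on' with
  | monomial α c =>
    have hmon : ∀ (x : ι → ℝ) (t : ℝ),
        (MvPolynomial.monomial α c).evalReal (t • x) =
          c * ((t : ℂ) ^ α.degree * ∏ i, (x i : ℂ) ^ α i) := by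
      intro x t
      rw [MvPolynomial.evalReal, MvPolynomial.eval_monomial, Finsupp.degree_eq_sum,
        ← Finset.prod_pow_eq_pow_sum, ← Finset.prod_mul_distrib]
      rw [Finsupp.prod_fintype _ _ fun i => pow_zero _]
      simp [mul_pow]
    refine ⟨MvPolynomial.X a * MvPolynomial.C ((α.degree + 1 : ℂ)⁻¹) * MvPolynomial.monomial α c,
      by simp [MvPolynomial.evalReal], fun x t => ?_⟩
    have h1 : (fun t : ℝ => (MvPolynomial.X a * MvPolynomial.C ((α.degree + 1 : ℂ)⁻¹) *
        MvPolynomial.monomial α c).evalReal (t • x)) = fun t : ℝ =>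
          (t : ℂ) ^ (α.degree + 1) *
            ((α.degree + 1 : ℂ)⁻¹ * x a * c * ∏ i, (x i : ℂ) ^ α i) := by
      ext t
      have := hmon x t
      rw [MvPolynomial.evalReal] at this ⊢
      rw [map_mul, this]
      simp only [map_mul, MvPolynomial.eval_X, MvPolynomial.eval_C, Pi.smul_apply, smul_eq_mul,
        Complex.ofReal_mul]
      ring
    rw [h1, hmon]
    have h2 := (((hasDerivAt_id t).ofReal_comp.pow (α.degree + 1)).mul_const
      ((α.degree + 1 : ℂ)⁻¹ * x a * c * ∏ i, (x i : ℂ) ^ α i))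
    refine h2.congr_deriv ?_
    have h3 : (α.degree + 1 : ℂ) ≠ 0 := Nat.cast_add_one_ne_zero _
    push_cast
    simp only [id]
    field_simp
  | add p q hp hq =>
    obtain ⟨P, hP0, hP⟩ := hp
    obtain ⟨P', hP0', hP'⟩ := hq
    refine ⟨P + P', ?_, fun x t => ?_⟩
    · simp only [MvPolynomial.evalReal, map_add] at *
      rw [hP0, hP0', add_zero]
    · have := (hP x t).add (hP' x t)
      simp only [MvPolynomial.evalReal, map_add, mul_add] at *
      exact this

/-- Taylor's theorem with Peano remainder. -/
lemma ContDiffAt.exists_mvPolynomial_isLittleO (k : ℕ) : ∀ {g : (ι → ℝ) → ℂ},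
    ContDiffAt ℝ k g 0 → ∃ R : MvPolynomial ι ℂ,
      (fun x => g x - R.evalReal x) =o[𝓝 0] fun x => ‖x‖ ^ k := by
  classical
  induction k with
  | zero =>
    intro g hg
    refine ⟨MvPolynomial.C (g 0), ?_⟩
    simp only [pow_zero]
    rw [isLittleO_one_iff]
    have := hg.continuousAt.tendsto.sub_const (g 0)
    simpa [MvPolynomial.evalReal] using this
  | succ k ih =>
    intro g hg
    have hpart : ∀ a : ι, ∃ Q : MvPolynomial ι ℂ,
        (fun x => fderiv ℝ g x (fun j => if a = j then 1 else 0) - Q.evalReal x) =o[𝓝 0]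
          fun x => ‖x‖ ^ k := fun a =>
      ih ((hg.fderiv_right (m := k) le_rfl).clm_apply contDiffAt_const)
    choose Q hQ using hpart
    choose P hP0 hP using fun a => MvPolynomial.exists_hasDerivAt_evalReal a (Q a)
    refine ⟨MvPolynomial.C (g 0) + ∑ a, P a, ?_⟩
    have hR : ∀ x, (MvPolynomial.C (g 0) + ∑ a, P a).evalReal x =
        g 0 + ∑ a, (P a).evalReal x := fun x => by
      simp [MvPolynomial.evalReal]
    simp only [hR]
    have herr : (fun x => ∑ a, ‖fderiv ℝ g x (fun j => if a = j then 1 else 0) -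
        (Q a).evalReal x‖) =o[𝓝 0] fun x => ‖x‖ ^ k :=
      IsLittleO.fun_sum fun a _ => (hQ a).norm_left
    rw [isLittleO_iff]
    intro c hc
    have hdiff : ∀ᶠ x in 𝓝 (0 : ι → ℝ), DifferentiableAt ℝ g x := by
      filter_upwards [hg.eventually (by simp)] with x hx
      exact hx.differentiableAt (by simp)
    obtain ⟨δ, hδ, hball⟩ := Metric.eventually_nhds_iff_ball.1
      (hdiff.and ((isLittleO_iff.1 herr) hc))
    filter_upwards [Metric.ball_mem_nhds 0 hδ] with x hx
    have hseg : ∀ t ∈ Set.Icc (0 : ℝ) 1, ‖t • x‖ ≤ ‖x‖ := fun t ht => by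
      rw [norm_smul, Real.norm_of_nonneg ht.1]
      exact mul_le_of_le_one_left (norm_nonneg _) ht.2
    have hmem : ∀ t ∈ Set.Icc (0 : ℝ) 1, t • x ∈ Metric.ball (0 : ι → ℝ) δ := fun t ht =>
      mem_ball_zero_iff.2 ((hseg t ht).trans_lt (mem_ball_zero_iff.1 hx))
    have hderiv : ∀ t ∈ Set.Icc (0 : ℝ) 1, HasDerivAt
        (fun t : ℝ => g (t • x) - (g 0 + ∑ a, (P a).evalReal (t • x)))
        (∑ a, (x a : ℂ) * (fderiv ℝ g (t • x) (fun j => if a = j then 1 else 0) -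
          (Q a).evalReal (t • x))) t := by
      intro t ht
      have h1 : HasDerivAt (fun t : ℝ => t • x) x t := by
        simpa using (hasDerivAt_id t).smul_const x
      have h2 := (hball _ (hmem t ht)).1.hasFDerivAt.comp_hasDerivAt t h1
      have h3 := HasDerivAt.fun_sum (u := Finset.univ) fun a _ => hP a x t
      refine (h2.sub (h3.const_add (g 0))).congr_deriv ?_
      have h4 := LinearMap.pi_apply_eq_sum_univ (fderiv ℝ g (t • x)).toLinearMap x
      rw [ContinuousLinearMap.coe_coe] at h4
      rw [h4, ← Finset.sum_sub_distrib]
      refine Finset.sum_congr rfl fun a _ => ?_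
      rw [Complex.real_smul, mul_sub]
    have hbound : ∀ t ∈ Set.Ico (0 : ℝ) 1, ‖∑ a, (x a : ℂ) *
        (fderiv ℝ g (t • x) (fun j => if a = j then 1 else 0) - (Q a).evalReal (t • x))‖ ≤
          c * ‖x‖ ^ (k + 1) := by
      intro t ht
      have ht' := Set.Ico_subset_Icc_self ht
      have h1 := (hball _ (hmem t ht')).2
      rw [Real.norm_of_nonneg (Finset.sum_nonneg fun _ _ => norm_nonneg _), norm_pow,
        norm_norm] at h1
      calc _ ≤ ∑ a, ‖x‖ * ‖fderiv ℝ g (t • x) (fun j => if a = j then 1 else 0) -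
              (Q a).evalReal (t • x)‖ := by
            refine norm_sum_le_of_le _ fun a _ => ?_
            rw [norm_mul, Complex.norm_real]
            exact mul_le_mul_of_nonneg_right (norm_le_pi_norm x a) (norm_nonneg _)
        _ ≤ ‖x‖ * (c * ‖x‖ ^ k) := by
            rw [← Finset.mul_sum]
            refine mul_le_mul_of_nonneg_left (h1.trans ?_) (norm_nonneg _)
            gcongr
            exact hseg t ht'
        _ = c * ‖x‖ ^ (k + 1) := by ring
    have hmv := norm_image_sub_le_of_norm_deriv_le_segment_01'
      (fun t ht => (hderiv t ht).hasDerivWithinAt) hbound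
    simpa [hP0] using hmv

lemma Polynomial.coeff_eq_zero_of_isLittleO (k : ℕ) : ∀ {p : Polynomial ℂ},
    ((fun t : ℝ => p.eval (t : ℂ)) =o[𝓝[≠] 0] fun t : ℝ => t ^ k) → ∀ j ≤ k, p.coeff j = 0 := by
  have hzero : ∀ {p : Polynomial ℂ} {k : ℕ},
      ((fun t : ℝ => p.eval (t : ℂ)) =o[𝓝[≠] 0] fun t : ℝ => t ^ k) → p.coeff 0 = 0 := by
    intro p k hp
    have h1 : Tendsto (fun t : ℝ => p.eval (t : ℂ)) (𝓝[≠] 0) (𝓝 0) := by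
      rw [← isLittleO_one_iff ℝ]
      refine hp.trans_isBigO ?_
      have : Tendsto (fun t : ℝ => t ^ k) (𝓝[≠] 0) (𝓝 (0 ^ k)) :=
        ((continuous_pow k).tendsto 0).mono_left nhdsWithin_le_nhds
      exact this.isBigO_one ℝ
    have h2 : Tendsto (fun t : ℝ => p.eval (t : ℂ)) (𝓝[≠] 0) (𝓝 (p.eval ((0 : ℝ) : ℂ))) :=
      ((p.continuous.comp Complex.continuous_ofReal).tendsto 0).mono_left nhdsWithin_le_nhds
    rw [Polynomial.coeff_zero_eq_eval_zero]
    simpa using tendsto_nhds_unique h2 h1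
  induction k with
  | zero =>
    intro p hp j hj
    rw [Nat.le_zero.1 hj]
    exact hzero hp
  | succ k ih =>
    intro p hp j hj
    obtain ⟨q, rfl⟩ := Polynomial.X_dvd_iff.2 (hzero hp)
    cases j with
    | zero => simp
    | succ j =>
      rw [Polynomial.coeff_X_mul]
      refine ih ?_ j (Nat.le_of_succ_le_succ hj)
      rw [isLittleO_iff] at hp ⊢
      intro c hc
      filter_upwards [hp hc, self_mem_nhdsWithin] with t ht ht0
      have ht1 : 0 < ‖t‖ := norm_pos_iff.2 ht0
      rw [Polynomial.eval_mul, Polynomial.eval_X, norm_mul, Complex.norm_real, pow_succ', norm_mul,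
        mul_left_comm] at ht
      exact le_of_mul_le_mul_left ht ht1

lemma MvPolynomial.coeff_aeval_C_mul_X {σ : Type*} (R : MvPolynomial σ ℂ) (x : σ → ℂ) (d : ℕ) :
    (MvPolynomial.aeval (fun i => Polynomial.C (x i) * Polynomial.X) R).coeff d =
      MvPolynomial.eval x (MvPolynomial.homogeneousComponent d R) := by
  induction R using MvPolynomial.induction_on' with
  | monomial α c =>
    rw [MvPolynomial.homogeneousComponent_of_mem (m := d)
      (MvPolynomial.isHomogeneous_monomial c rfl), MvPolynomial.aeval_monomial]
    have h1 : (α.prod fun i n => (Polynomial.C (x i) * Polynomial.X) ^ n) =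
        Polynomial.C (α.prod fun i n => x i ^ n) * Polynomial.X ^ α.degree := by
      simp only [Finsupp.prod, mul_pow, Finset.prod_mul_distrib, Finset.prod_pow_eq_pow_sum,
        map_prod, map_pow, Finsupp.degree]
      rfl
    rw [h1, Polynomial.algebraMap_eq, ← mul_assoc, ← Polynomial.C_mul,
      Polynomial.coeff_C_mul_X_pow]
    split_ifs
    · rw [MvPolynomial.eval_monomial]
    · simp
  | add p q hp hq => simp [hp, hq]

lemma MvPolynomial.coeff_eq_zero_of_isLittleO {k : ℕ} {R : MvPolynomial ι ℂ}
    (hR : (fun x => R.evalReal x) =o[𝓝 0] fun x => ‖x‖ ^ k) (α : ι →₀ ℕ) (hα : α.degree ≤ k) :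
    R.coeff α = 0 := by
  have hline : ∀ x : ι → ℝ, ∀ d ≤ k,
      MvPolynomial.eval (fun i => (x i : ℂ)) (MvPolynomial.homogeneousComponent d R) = 0 := by
    intro x d hd
    rw [← MvPolynomial.coeff_aeval_C_mul_X]
    refine Polynomial.coeff_eq_zero_of_isLittleO k ?_ d hd
    have ht : Tendsto (fun t : ℝ => t • x) (𝓝[≠] 0) (𝓝 0) := by
      have : Continuous fun t : ℝ => t • x := by fun_prop
      simpa using (this.tendsto 0).mono_left nhdsWithin_le_nhds
    have h1 := hR.comp_tendsto ht
    have h2 : (fun t : ℝ => (MvPolynomial.aeval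
        (fun i => Polynomial.C (x i : ℂ) * Polynomial.X) R).eval (t : ℂ)) =
        (fun x => R.evalReal x) ∘ fun t : ℝ => t • x := by
      ext t
      have hom : (Polynomial.aeval (t : ℂ)).comp (MvPolynomial.aeval
          (fun i => Polynomial.C (x i : ℂ) * Polynomial.X)) =
          MvPolynomial.aeval (fun i => (((t • x) i : ℝ) : ℂ)) := by
        refine MvPolynomial.algHom_ext fun i => ?_
        simp [mul_comm (t : ℂ)]
      have h3 := DFunLike.congr_fun hom R
      rwa [AlgHom.comp_apply, Polynomial.coe_aeval_eq_eval, MvPolynomial.aeval_eq_eval] at h3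
    rw [h2]
    refine h1.trans_isBigO (IsBigO.of_bound (‖x‖ ^ k) (Eventually.of_forall fun t => ?_))
    simp [norm_smul, mul_pow, mul_comm]
  have hcomp : MvPolynomial.homogeneousComponent α.degree R = 0 := by
    refine MvPolynomial.funext_set (fun _ : ι => Set.range ((↑) : ℝ → ℂ))
      (fun _ => Set.infinite_range_of_injective Complex.ofReal_injective) fun y hy => ?_
    choose x hx using fun i => hy i (Set.mem_univ i)
    rw [map_zero, ← _root_.funext hx]
    exact hline x _ hα
  have := congrArg (MvPolynomial.coeff α) hcomp
  rwa [MvPolynomial.coeff_homogeneousComponent, if_pos rfl, MvPolynomial.coeff_zero] at this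

lemma MvPolynomial.coeff_aeval_eq_zero {σ τ : Type*} {k : ℕ} {R : MvPolynomial σ ℂ}
    (hR : ∀ α, α.degree ≤ k → R.coeff α = 0) {F : σ → MvPolynomial τ ℂ}
    (hF : ∀ i, (F i).IsHomogeneous 1) (β : τ →₀ ℕ) (hβ : β.degree ≤ k) :
    (MvPolynomial.aeval F R).coeff β = 0 := by
  rw [R.as_sum, map_sum, MvPolynomial.coeff_sum]
  refine Finset.sum_eq_zero fun α hα => ?_
  have hk : k < α.degree := by
    by_contra! h
    exact MvPolynomial.mem_support_iff.1 hα (hR α h)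
  have := (MvPolynomial.isHomogeneous_monomial (R.coeff α) (rfl : α.degree = α.degree)).aeval F hF
  rw [one_mul] at this
  exact this.coeff_eq_zero (by omega)

end jets

namespace ConvergentSeries

variable {N : ℕ}

lemma exists_forall_wnorm_ne_top {ι : Type*} [Finite ι] (F : ι → conv N) :
    ∃ s, ∀ i, wnorm s (F i : MvPowerSeries (Fin N) ℂ) ≠ ∞ := by
  cases nonempty_fintype ι
  choose s hs using fun i => mem_conv.1 (F i).2
  exact ⟨Finset.univ.sup s, fun i =>
    ne_top_of_le_ne_top (hs i) (wnorm_antitone _ (Finset.le_sup (Finset.mem_univ i)))⟩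

lemma coeff_mul_eq_zero_of_degree_le {k : ℕ} {f g : MvPowerSeries (Fin N) ℂ}
    (hf : ∀ α, α.degree ≤ k → MvPowerSeries.coeff α f = 0) (α : Fin N →₀ ℕ) (hα : α.degree ≤ k) :
    MvPowerSeries.coeff α (f * g) = 0 := by
  classical
  rw [MvPowerSeries.coeff_mul]
  refine Finset.sum_eq_zero fun p hp => ?_
  rw [← Finset.HasAntidiagonal.mem_antidiagonal.1 hp, map_add] at hα
  rw [hf p.1 (by omega), zero_mul]

/-- The point of `ℂ^N` with given real and imaginary parts. -/
noncomputable def ofReIm (x : Fin N ⊕ Fin N → ℝ) : Fin N → ℂ := fun i =>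
  (x (Sum.inl i) : ℂ) + Complex.I * x (Sum.inr i)

lemma ofReIm_zero : ofReIm (0 : Fin N ⊕ Fin N → ℝ) = 0 := by
  ext i
  simp [ofReIm]

lemma contDiff_ofReIm {n : WithTop ℕ∞} : ContDiff ℝ n (ofReIm (N := N)) := by
  refine contDiff_pi.2 fun i => ?_
  have h : ∀ a : Fin N ⊕ Fin N, ContDiff ℝ n fun x : Fin N ⊕ Fin N → ℝ => (x a : ℂ) := fun a =>
    Complex.ofRealCLM.contDiff.comp (contDiff_apply ℝ ℝ a)
  exact (h _).add (contDiff_const.mul (h _))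

lemma tendsto_ofReIm : Tendsto (ofReIm (N := N)) (𝓝 0) (𝓝 0) := by
  simpa [ofReIm_zero] using (contDiff_ofReIm (N := N) (n := 0)).continuous.tendsto 0

lemma norm_ofReIm_le (x : Fin N ⊕ Fin N → ℝ) : ‖ofReIm x‖ ≤ 2 * ‖x‖ := by
  rw [pi_norm_le_iff_of_nonneg (by positivity)]
  intro i
  refine (norm_add_le _ _).trans ?_
  rw [norm_mul, Complex.norm_I, one_mul, Complex.norm_real, Complex.norm_real, two_mul]
  exact add_le_add (norm_le_pi_norm x _) (norm_le_pi_norm x _)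

/-- Substitution of `x + i y` for the complex variables. -/
noncomputable def realify : MvPolynomial (Fin N) ℂ →ₐ[ℂ] MvPolynomial (Fin N ⊕ Fin N) ℂ :=
  MvPolynomial.aeval fun i =>
    MvPolynomial.X (Sum.inl i) + MvPolynomial.C Complex.I * MvPolynomial.X (Sum.inr i)

/-- Substitution of `z / 2` for `x` and of `-i z / 2` for `y`: this keeps the part of a polynomial
in `z` and its conjugate that only involves `z`. -/
noncomputable def holomorphicPart :
    MvPolynomial (Fin N ⊕ Fin N) ℂ →ₐ[ℂ] MvPolynomial (Fin N) ℂ :=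
  MvPolynomial.aeval (Sum.elim (fun i => MvPolynomial.C (1 / 2) * MvPolynomial.X i)
    fun i => MvPolynomial.C (-Complex.I / 2) * MvPolynomial.X i)

lemma holomorphicPart_realify (p : MvPolynomial (Fin N) ℂ) : holomorphicPart (realify p) = p := by
  have h : holomorphicPart.comp (realify (N := N)) = AlgHom.id ℂ _ := by
    refine MvPolynomial.algHom_ext fun i => ?_
    simp only [holomorphicPart, realify, AlgHom.comp_apply, MvPolynomial.aeval_X, map_add, map_mul,
      MvPolynomial.aeval_C, MvPolynomial.algebraMap_eq, Sum.elim_inl, Sum.elim_inr, AlgHom.id_apply]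
    rw [← mul_assoc, ← MvPolynomial.C_mul, ← add_mul, ← MvPolynomial.C_add]
    have : (1 / 2 + Complex.I * (-Complex.I / 2) : ℂ) = 1 := by
      rw [mul_div_assoc', mul_neg, Complex.I_mul_I]
      norm_num
    rw [this, MvPolynomial.C_1, one_mul]
  exact DFunLike.congr_fun h p

lemma evalReal_realify (p : MvPolynomial (Fin N) ℂ) (x : Fin N ⊕ Fin N → ℝ) :
    (realify p).evalReal x = MvPolynomial.eval (ofReIm x) p := by
  have h : (MvPolynomial.aeval fun i => (x i : ℂ)).comp (realify (N := N)) =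
      MvPolynomial.aeval (ofReIm x) := by
    refine MvPolynomial.algHom_ext fun i => ?_
    simp [realify, ofReIm]
  have := DFunLike.congr_fun h p
  rwa [AlgHom.comp_apply, MvPolynomial.aeval_eq_eval, MvPolynomial.aeval_eq_eval] at this

lemma constantCoeff_holomorphicPart (p : MvPolynomial (Fin N ⊕ Fin N) ℂ) :
    MvPolynomial.constantCoeff (holomorphicPart p) = p.evalReal 0 := by
  have h : (MvPolynomial.aeval fun _ => (0 : ℂ)).comp (holomorphicPart (N := N)) =
      MvPolynomial.aeval fun _ => (0 : ℂ) := by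
    refine MvPolynomial.algHom_ext fun i => ?_
    cases i <;> simp [holomorphicPart]
  have := DFunLike.congr_fun h p
  rw [AlgHom.comp_apply, MvPolynomial.aeval_eq_eval, MvPolynomial.aeval_eq_eval] at this
  rw [← MvPolynomial.eval_zero']
  simpa [MvPolynomial.evalReal] using this

lemma coeff_holomorphicPart_eq_zero {k : ℕ} {p : MvPolynomial (Fin N ⊕ Fin N) ℂ}
    (hp : ∀ α, α.degree ≤ k → p.coeff α = 0) (β : Fin N →₀ ℕ) (hβ : β.degree ≤ k) :
    (holomorphicPart p).coeff β = 0 := by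
  refine MvPolynomial.coeff_aeval_eq_zero hp (fun i => ?_) β hβ
  cases i
  · exact MvPolynomial.isHomogeneous_C_mul_X _ _
  · exact MvPolynomial.isHomogeneous_C_mul_X _ _

/-- If `∑ A j * g j` vanishes near the origin, then the holomorphic parts of the Taylor polynomials
of the `g j` solve the equation `∑ A j * P j = 0` up to order `k`. -/
lemma coeff_sum_mul_holomorphicPart_eq_zero {m k : ℕ} (A : Fin m → conv N)
    {g : Fin m → (Fin N ⊕ Fin N → ℝ) → ℂ} (hg : ∀ j, ContinuousAt (g j) 0)
    {R : Fin m → MvPolynomial (Fin N ⊕ Fin N) ℂ}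
    (hR : ∀ j, (fun x => g j x - (R j).evalReal x) =o[𝓝 0] fun x => ‖x‖ ^ k)
    (hA : ∀ᶠ x in 𝓝 0,
      ∑ j, evalSeries (A j : MvPowerSeries (Fin N) ℂ) (ofReIm x) * g j x = 0)
    (α : Fin N →₀ ℕ) (hα : α.degree ≤ k) :
    MvPowerSeries.coeff α (∑ j, (A j : MvPowerSeries (Fin N) ℂ) *
      (holomorphicPart (R j) : MvPowerSeries (Fin N) ℂ)) = 0 := by
  obtain ⟨s, hs⟩ := exists_forall_wnorm_ne_top A
  set T : Fin m → MvPolynomial (Fin N) ℂ := fun j =>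
    MvPowerSeries.truncTotal (k + 1) (A j : MvPowerSeries (Fin N) ℂ) with hT
  set B : Fin m → MvPowerSeries (Fin N) ℂ := fun j =>
    (A j : MvPowerSeries (Fin N) ℂ) - (T j : MvPowerSeries (Fin N) ℂ) with hB
  have hAB : ∀ j, (A j : MvPowerSeries (Fin N) ℂ) = (T j : MvPowerSeries (Fin N) ℂ) + B j :=
    fun j => by simp [hB]
  have hBk : ∀ j α, α.degree ≤ k → MvPowerSeries.coeff α (B j) = 0 := fun j α hα => by
    rw [hB, map_sub, MvPolynomial.coeff_coe, hT,
      MvPowerSeries.coeff_truncTotal _ (Nat.lt_succ_of_le hα), sub_self]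
  have hBs : ∀ j, wnorm s (B j) ≠ ∞ := fun j => by
    simp only [hB, sub_eq_add_neg]
    refine ne_top_of_le_ne_top (ENNReal.add_ne_top.2 ⟨hs j, ?_⟩) (wnorm_add_le _ _ _)
    rw [wnorm_neg]
    exact wnorm_coe_ne_top s (T j)
  have hball : ∀ᶠ x in 𝓝 (0 : Fin N ⊕ Fin N → ℝ), ‖ofReIm x‖ ≤ polyradius N s := by
    filter_upwards [tendsto_ofReIm.eventually
      (Metric.closedBall_mem_nhds 0 (polyradius_pos N s))] with x hx
    exact mem_closedBall_zero_iff.1 hx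
  have hE : (fun x => (∑ j, realify (T j) * R j).evalReal x) =o[𝓝 0] fun x => ‖x‖ ^ k := by
    have h1 : ∀ j, (fun x => MvPolynomial.eval (ofReIm x) (T j) *
        (g j x - (R j).evalReal x)) =o[𝓝 0] fun x => ‖x‖ ^ k := fun j => by
      have hb : (fun x => MvPolynomial.eval (ofReIm x) (T j)) =O[𝓝 0] fun _ => (1 : ℝ) :=
        (((MvPolynomial.continuous_eval (T j)).tendsto 0).comp tendsto_ofReIm).isBigO_one ℝ
      simpa using hb.mul_isLittleO (hR j)
    have h2 : ∀ j, (fun x => evalSeries (B j) (ofReIm x) * g j x) =o[𝓝 0] fun x => ‖x‖ ^ k := by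
      intro j
      have hb : g j =O[𝓝 0] fun _ => (1 : ℝ) := (hg j).tendsto.isBigO_one ℝ
      have hB1 := (evalSeries_isLittleO (hBs j) (hBk j)).comp_tendsto tendsto_ofReIm
      have hB2 : ((fun z : Fin N → ℂ => ‖z‖ ^ k) ∘ ofReIm) =O[𝓝 0]
          fun x : Fin N ⊕ Fin N → ℝ => ‖x‖ ^ k := by
        refine IsBigO.of_bound (2 ^ k) (Eventually.of_forall fun x => ?_)
        rw [Function.comp_apply, norm_pow, norm_norm, norm_pow, norm_norm, ← mul_pow]
        exact pow_le_pow_left₀ (norm_nonneg _) (norm_ofReIm_le x) k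
      simpa using (hB1.trans_isBigO hB2).mul_isBigO hb
    have h3 := IsLittleO.fun_sum (s := Finset.univ) fun j _ => (h1 j).add (h2 j)
    refine h3.neg_left.congr' ?_ EventuallyEq.rfl
    filter_upwards [hA, hball] with x hx hxs
    have hev : ∀ j, evalSeries (A j : MvPowerSeries (Fin N) ℂ) (ofReIm x) =
        MvPolynomial.eval (ofReIm x) (T j) + evalSeries (B j) (ofReIm x) := fun j => by
      rw [hAB, evalSeries_add (wnorm_coe_ne_top s (T j)) (hBs j) hxs, evalSeries_coe]
    have hsum : (∑ j, realify (T j) * R j).evalReal x =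
        ∑ j, MvPolynomial.eval (ofReIm x) (T j) * (R j).evalReal x := by
      simp only [← evalReal_realify, MvPolynomial.evalReal, map_sum, map_mul]
    rw [hsum, ← sub_eq_zero, ← neg_eq_zero, neg_sub, sub_neg_eq_add, ← Finset.sum_add_distrib, ← hx]
    refine Finset.sum_congr rfl fun j _ => ?_
    rw [hev]
    ring
  have hzero := coeff_holomorphicPart_eq_zero
    (fun β hβ => MvPolynomial.coeff_eq_zero_of_isLittleO hE β hβ) α hα
  simp only [map_sum, map_mul, holomorphicPart_realify, MvPolynomial.coeff_sum] at hzero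
  rw [map_sum, ← hzero]
  refine Finset.sum_congr rfl fun j _ => ?_
  rw [hAB, add_mul, map_add, coeff_mul_eq_zero_of_degree_le (hBk j) α hα, add_zero,
    ← MvPolynomial.coe_mul, MvPolynomial.coeff_coe]

end ConvergentSeries

open ConvergentSeries

open Matrix in
/-- Spallek's theorem (smooth case): for a holomorphic matrix function `M` and a point
`ξ` there is a `k ∈ ℕ` such that every `C^k` solution of `M f = 0` near `ξ` can be
replaced by a holomorphic solution with the same value at `ξ`. -/
theorem spallek_smooth_case (N n m : ℕ) (Ω : Set (Fin N → ℂ)) (hΩ : IsOpen Ω)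
    (M : (Fin N → ℂ) → Matrix (Fin n) (Fin m) ℂ) (hM : MatHoloOn M Ω)
    (ξ : Fin N → ℂ) (hξ : ξ ∈ Ω) :
    ∃ k : ℕ, ∀ U : Set (Fin N → ℂ), IsOpen U → ξ ∈ U → U ⊆ Ω →
      ∀ f : (Fin N → ℂ) → (Fin m → ℂ),
        ContDiffOn ℝ (k : WithTop ℕ∞) f U →
        (∀ ζ ∈ U, M ζ *ᵥ f ζ = 0) →
        ∃ V : Set (Fin N → ℂ), IsOpen V ∧ ξ ∈ V ∧ V ⊆ U ∧
          ∃ h : (Fin N → ℂ) → (Fin m → ℂ), DifferentiableOn ℂ h V ∧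
            (∀ ζ ∈ V, M ζ *ᵥ h ζ = 0) ∧ h ξ = f ξ := by
  have hshift : Tendsto (fun z : Fin N → ℂ => ξ + z) (𝓝 0) (𝓝 ξ) := by
    simpa using (continuous_const_add ξ).tendsto 0
  have hseries : ∀ i j, ∃ F : conv N, ∀ᶠ z in 𝓝 0,
      evalSeries (F : MvPowerSeries (Fin N) ℂ) z = M (ξ + z) i j := fun i j =>
    exists_evalSeries_eq (hshift (hΩ.mem_nhds hξ)) ((hM i j).comp (by fun_prop) fun _ hz => hz)
  choose A hA using hseries
  obtain ⟨k, hk⟩ := exists_order_forall_exists_kernel (Matrix.of A)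
  refine ⟨k, fun U hU hξU _ f hf hMf => ?_⟩
  set g : Fin m → (Fin N ⊕ Fin N → ℝ) → ℂ := fun j x => f (ξ + ofReIm x) j with hgdef
  have hg : ∀ j, ContDiffAt ℝ k (g j) 0 := fun j => by
    have h1 : ContDiffAt ℝ k f (ξ + ofReIm 0) := by
      rw [ofReIm_zero, add_zero]
      exact hf.contDiffAt (hU.mem_nhds hξU)
    have h2 : ContDiffAt ℝ k (fun x => ξ + ofReIm x) (0 : Fin N ⊕ Fin N → ℝ) :=
      (contDiff_const.add contDiff_ofReIm).contDiffAt
    exact contDiffAt_pi.1 (h1.comp 0 h2) j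
  choose R hR using fun j => (hg j).exists_mvPolynomial_isLittleO
  have hR0 : ∀ j, (R j).evalReal 0 = f ξ j := fun j => by
    have h1 : ‖g j 0 - (R j).evalReal 0‖ ≤ 0 := by
      refine le_of_forall_pos_le_add fun c hc => ?_
      have := (isLittleO_iff.1 (hR j) hc).self_of_nhds
      rw [zero_add]
      refine this.trans (mul_le_of_le_one_right hc.le ?_)
      rw [norm_zero, norm_pow, norm_zero]
      exact pow_le_one₀ le_rfl zero_le_one
    rw [norm_le_zero_iff, sub_eq_zero] at h1
    rw [← h1, hgdef]
    simp [ofReIm_zero]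
  set P : Fin m → conv N := fun j =>
    ⟨holomorphicPart (R j), mem_conv.2 ⟨0, wnorm_coe_ne_top 0 _⟩⟩ with hP
  obtain ⟨h, hAh, hhP⟩ := hk P fun i α hα => by
    have hzero : ∀ᶠ x in 𝓝 (0 : Fin N ⊕ Fin N → ℝ),
        ∑ j, evalSeries (A i j : MvPowerSeries (Fin N) ℂ) (ofReIm x) * g j x = 0 := by
      filter_upwards [tendsto_ofReIm.eventually (eventually_all.2 fun j => hA i j),
        (hshift.comp tendsto_ofReIm).eventually (hU.mem_nhds hξU)] with x hx hxU
      have := congrFun (hMf _ hxU) i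
      simp only [hx]
      exact this
    have := coeff_sum_mul_holomorphicPart_eq_zero (A i) (fun j => (hg j).continuousAt) hR hzero α hα
    simpa [Matrix.mulVec, dotProduct, hP] using this
  obtain ⟨s, hs⟩ := exists_forall_wnorm_ne_top h
  obtain ⟨t, ht⟩ := exists_forall_wnorm_ne_top fun p : Fin n × Fin m => A p.1 p.2
  have hhs : ∀ j, wnorm (max s t) (h j : MvPowerSeries (Fin N) ℂ) ≠ ∞ := fun j =>
    ne_top_of_le_ne_top (hs j) (wnorm_antitone _ (le_max_left s t))
  have hAs : ∀ i j, wnorm (max s t) (A i j : MvPowerSeries (Fin N) ℂ) ≠ ∞ := fun i j =>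
    ne_top_of_le_ne_top (ht (i, j)) (wnorm_antitone _ (le_max_right s t))
  have hρ := polyradius_pos N (max s t)
  have hback : Tendsto (fun ζ : Fin N → ℂ => ζ - ξ) (𝓝 ξ) (𝓝 0) := by
    simpa using (continuous_sub_right ξ).tendsto ξ
  have hnhds : ∀ᶠ ζ in 𝓝 ξ, ζ ∈ U ∧ ζ - ξ ∈ Metric.ball 0 (polyradius N (max s t) / 2) ∧
      ∀ i j, evalSeries (A i j : MvPowerSeries (Fin N) ℂ) (ζ - ξ) = M ζ i j := by
    filter_upwards [hU.mem_nhds hξU, hback (Metric.ball_mem_nhds 0 (half_pos hρ)),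
      hback.eventually (eventually_all.2 fun i => eventually_all.2 fun j => hA i j)] with ζ h1 h2 h3
    exact ⟨h1, h2, fun i j => by simpa using h3 i j⟩
  obtain ⟨V, hVsub, hV, hξV⟩ := mem_nhds_iff.1 hnhds
  refine ⟨V, hV, hξV, fun ζ hζ => (hVsub hζ).1,
    fun ζ j => evalSeries (h j : MvPowerSeries (Fin N) ℂ) (ζ - ξ), ?_, fun ζ hζ => ?_, ?_⟩
  · exact differentiableOn_pi.2 fun j =>
      (differentiableOn_evalSeries (hhs j)).comp (by fun_prop) fun ζ hζ => (hVsub hζ).2.1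
  · obtain ⟨_, hζb, hζA⟩ := hVsub hζ
    have hζ' : ‖ζ - ξ‖ ≤ polyradius N (max s t) := by
      have := mem_ball_zero_iff.1 hζb
      linarith
    ext i
    have h1 := congrArg (fun F : conv N => evalSeries (F : MvPowerSeries (Fin N) ℂ) (ζ - ξ))
      (congrFun hAh i)
    simp only [Matrix.mulVec, dotProduct, Matrix.of_apply, AddSubmonoidClass.coe_finsetSum,
      Subring.coe_mul, Pi.zero_apply, ZeroMemClass.coe_zero, evalSeries_zero_left] at h1
    rw [evalSeries_sum (s := max s t) _ (fun j _ => ne_top_of_le_ne_top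
      (ENNReal.mul_ne_top (hAs i j) (hhs j)) (wnorm_mul_le _ _ _)) hζ'] at h1
    simp only [Matrix.mulVec, dotProduct, Pi.zero_apply]
    rw [← h1]
    refine Finset.sum_congr rfl fun j _ => ?_
    rw [evalSeries_mul (hAs i j) (hhs j) hζ', hζA]
  · ext j
    beta_reduce
    rw [sub_self, evalSeries_zero_right, hhP j, ← hR0 j, ← constantCoeff_holomorphicPart]
    simp [hP, ← MvPowerSeries.coeff_zero_eq_constantCoeff_apply, MvPolynomial.constantCoeff_eq]
end

section
/- Fix ℓ ∈ ℕ and define A, B : ℂ² → Mat(2×2, ℂ) by A(z,w) = [[z^{2+ℓ} w^{2+ℓ}, z^{3+ℓ}], [w^{3+ℓ}, 0]] and B(z,w) = [[0, z^{3+ℓ}], [w^{3+ℓ}, z^{2+ℓ} w^{2+ℓ}]]. Let U be an open neighborhood of the origin in ℂ² and H = [[a,b],[c,d]] : U → Mat(2×2, ℂ) holomorphic. Then: (i) if A H = H B on U, or if H A = B H on U, then H(0,0) = 0; (ii) if A H = H A on U, or if B H = H B on U, then H(0,0) = λ·I₂ for some λ ∈ ℂ, where I₂ is the 2×2 identity matrix.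 -/
/-- The matrix `A` of the local counterexample. -/
noncomputable def exA (ℓ : ℕ) (p : ℂ × ℂ) : Matrix (Fin 2) (Fin 2) ℂ :=
  !![p.1 ^ (2 + ℓ) * p.2 ^ (2 + ℓ), p.1 ^ (3 + ℓ); p.2 ^ (3 + ℓ), 0]

/-- The matrix `B` of the local counterexample. -/
noncomputable def exB (ℓ : ℕ) (p : ℂ × ℂ) : Matrix (Fin 2) (Fin 2) ℂ :=
  !![0, p.1 ^ (3 + ℓ); p.2 ^ (3 + ℓ), p.1 ^ (2 + ℓ) * p.2 ^ (2 + ℓ)]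

open Filter Topology in
/-- The coefficients of a holomorphic relation `w ^ (m + 1) * b = z ^ (m + 1) * c + z ^ m * w ^ m * a`
near the origin, with `m` positive, all vanish at the origin. -/
theorem eq_zero_of_pow_relation {m : ℕ} (hm : m ≠ 0) {U : Set (ℂ × ℂ)} (hU : IsOpen U)
    (h0 : (0 : ℂ × ℂ) ∈ U) {a b c : ℂ × ℂ → ℂ} (ha : DifferentiableOn ℂ a U)
    (hb : DifferentiableOn ℂ b U) (hc : DifferentiableOn ℂ c U)
    (h : ∀ p ∈ U, p.2 ^ (m + 1) * b p = p.1 ^ (m + 1) * c p + p.1 ^ m * p.2 ^ m * a p) :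
    a 0 = 0 ∧ b 0 = 0 ∧ c 0 = 0 := by
  have cont {f : ℂ × ℂ → ℂ} (hf : DifferentiableOn ℂ f U) : ContinuousAt f 0 :=
    (hf.differentiableAt (hU.mem_nhds h0)).continuousAt
  have tendsto_left : Tendsto (fun z : ℂ => ((z, 0) : ℂ × ℂ)) (𝓝[≠] 0) (𝓝 0) :=
    Continuous.tendsto' (by fun_prop) _ _ rfl |>.mono_left nhdsWithin_le_nhds
  have tendsto_right : Tendsto (fun w : ℂ => ((0, w) : ℂ × ℂ)) (𝓝[≠] 0) (𝓝 0) :=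
    Continuous.tendsto' (by fun_prop) _ _ rfl |>.mono_left nhdsWithin_le_nhds
  refine ⟨?_, ?_, ?_⟩
  · have hbdd : ∀ᶠ p in 𝓝 (0 : ℂ × ℂ), p ∈ U ∧ ‖b p‖ < ‖b 0‖ + 1 :=
      (hU.eventually_mem h0).and ((cont hb).norm.eventually_lt_const (lt_add_one _))
    obtain ⟨r, hr, hball⟩ := Metric.nhds_basis_closedBall.mem_iff.1 hbdd
    have mem {z w : ℂ} (hz : ‖z‖ ≤ r) (hw : ‖w‖ ≤ r) : (z, w) ∈ U ∧ ‖b (z, w)‖ < ‖b 0‖ + 1 :=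
      hball (by simpa [Prod.norm_def] using ⟨hz, hw⟩)
    -- The maximum principle in `z` on the disc of radius `r`, for fixed `w`.
    have bound {w : ℂ} (hw0 : w ≠ 0) (hw : ‖w‖ ≤ r) :
        ‖a (0, w)‖ ≤ (‖b 0‖ + 1) / r ^ m * ‖w‖ := by
      have slice {f : ℂ × ℂ → ℂ} (hf : DifferentiableOn ℂ f U) :
          DifferentiableOn ℂ (fun z => f (z, w)) (Metric.closedBall 0 r) :=
        hf.comp (by fun_prop) fun z hz => (mem (by simpa using hz) hw).1
      have hG : DifferentiableOn ℂ (fun z => z * c (z, w) + w ^ m * a (z, w))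
          (Metric.closedBall 0 r) :=
        (differentiableOn_id.mul (slice hc)).add ((slice ha).const_mul _)
      have hmax := Complex.norm_le_of_forall_mem_frontier_norm_le Metric.isBounded_ball
        (hG.diffContOnCl_ball subset_rfl) (C := ‖w‖ ^ (m + 1) * (‖b 0‖ + 1) / r ^ m) ?_
        (subset_closure (Metric.mem_ball_self hr))
      · simp only [zero_mul, zero_add, norm_mul, norm_pow] at hmax
        have hwm : 0 < ‖w‖ ^ m := pow_pos (norm_pos_iff.2 hw0) m
        refine le_of_mul_le_mul_left (hmax.trans_eq ?_) hwm
        ring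
      · intro z hz
        rw [frontier_ball _ hr.ne', mem_sphere_zero_iff_norm] at hz
        obtain ⟨hzU, hzb⟩ := mem hz.le hw
        have key : z ^ m * (z * c (z, w) + w ^ m * a (z, w)) = w ^ (m + 1) * b (z, w) := by
          rw [h _ hzU]
          ring
        have key' := congrArg norm key
        rw [norm_mul, norm_mul, norm_pow, norm_pow, hz] at key'
        rw [le_div_iff₀ (pow_pos hr m), mul_comm, key']
        gcongr
    have lim : Tendsto (fun w : ℂ => a (0, w)) (𝓝[≠] 0) (𝓝 0) := by
      refine squeeze_zero_norm' (a := fun w => (‖b 0‖ + 1) / r ^ m * ‖w‖) ?_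
        (Continuous.tendsto' (by fun_prop) _ _ (by simp) |>.mono_left nhdsWithin_le_nhds)
      filter_upwards [self_mem_nhdsWithin,
        nhdsWithin_le_nhds (Metric.closedBall_mem_nhds (0 : ℂ) hr)] with w hw0 hw
      exact bound hw0 (by simpa using hw)
    exact tendsto_nhds_unique ((cont ha).tendsto.comp tendsto_right) lim
  · refine tendsto_nhds_unique_of_eventuallyEq ((cont hb).tendsto.comp tendsto_right)
      tendsto_const_nhds ?_
    filter_upwards [self_mem_nhdsWithin, tendsto_right (hU.mem_nhds h0)] with w hw0 hw
    have hw0' : w ≠ 0 := hw0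
    simpa [hm, hw0'] using h _ hw
  · refine tendsto_nhds_unique_of_eventuallyEq ((cont hc).tendsto.comp tendsto_left)
      tendsto_const_nhds ?_
    filter_upwards [self_mem_nhdsWithin, tendsto_left (hU.mem_nhds h0)] with z hz0 hz
    have hz0' : z ≠ 0 := hz0
    simpa [hm, hz0'] using (h _ hz).symm

/-- Any holomorphic intertwiner of `A` and `B` near the origin vanishes at the
origin, and any holomorphic matrix commuting with `A` (or with `B`) near the origin
is scalar at the origin. -/
theorem local_counterexample_intertwiners (ℓ : ℕ)
    (U : Set (ℂ × ℂ)) (hU : IsOpen U) (h0 : (0 : ℂ × ℂ) ∈ U)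
    (H : ℂ × ℂ → Matrix (Fin 2) (Fin 2) ℂ) (hH : MatHoloOn H U) :
    ((∀ p ∈ U, exA ℓ p * H p = H p * exB ℓ p) → H 0 = 0) ∧
    ((∀ p ∈ U, H p * exA ℓ p = exB ℓ p * H p) → H 0 = 0) ∧
    ((∀ p ∈ U, exA ℓ p * H p = H p * exA ℓ p) →
      ∃ lam : ℂ, H 0 = lam • (1 : Matrix (Fin 2) (Fin 2) ℂ)) ∧
    ((∀ p ∈ U, exB ℓ p * H p = H p * exB ℓ p) →
      ∃ lam : ℂ, H 0 = lam • (1 : Matrix (Fin 2) (Fin 2) ℂ)) := by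
  have vanish {a b c : ℂ × ℂ → ℂ} := eq_zero_of_pow_relation (m := 2 + ℓ) (by lia) hU h0
    (a := a) (b := b) (c := c)
  have hconst : DifferentiableOn ℂ (fun _ : ℂ × ℂ => (0 : ℂ)) U := differentiableOn_const 0
  have hdiag : DifferentiableOn ℂ (fun p => H p 0 0 - H p 1 1) U := (hH 0 0).sub (hH 1 1)
  refine ⟨fun h => ?_, fun h => ?_, fun h => ?_, fun h => ?_⟩
  all_goals
    have entry (i j : Fin 2) (p : ℂ × ℂ) (hp : p ∈ U) := congrFun (congrFun (h p hp) i) j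
    have e00 := entry 0 0
    have e01 := entry 0 1
    simp only [exA, exB, Matrix.mul_apply, Fin.sum_univ_two, Matrix.of_apply, Matrix.cons_val',
      Matrix.cons_val_zero, Matrix.cons_val_one, Matrix.cons_val_fin_one] at e00 e01
  · obtain ⟨ha, hb, hc⟩ := vanish (hH 0 0) (hH 0 1) (hH 1 0)
      fun p hp => by linear_combination -e00 p hp
    have hd := (vanish hconst hconst hdiag fun p hp => by linear_combination e01 p hp).2.2
    have hd' : H 0 1 1 = 0 := by linear_combination ha - hd
    ext i j
    fin_cases i <;> fin_cases j <;> assumption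
  · obtain ⟨ha, hb, hc⟩ := vanish (hH 0 0).neg (hH 0 1) (hH 1 0)
      fun p hp => by
        simp only [Pi.neg_apply]
        linear_combination e00 p hp
    have hd := (vanish hconst hconst hdiag fun p hp => by linear_combination -e01 p hp).2.2
    have ha' : H 0 0 0 = 0 := neg_eq_zero.1 ha
    have hd' : H 0 1 1 = 0 := by linear_combination ha' - hd
    ext i j
    fin_cases i <;> fin_cases j <;> assumption
  · obtain ⟨-, hb, hc⟩ := vanish hconst (hH 0 1) (hH 1 0)
      fun p hp => by linear_combination -e00 p hp
    have hd := (vanish (hH 0 1).neg hconst hdiag fun p hp => by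
      simp only [Pi.neg_apply]
      linear_combination e01 p hp).2.2
    refine ⟨H 0 0 0, ?_⟩
    ext i j
    fin_cases i <;> fin_cases j <;> simp [hb, hc, ← sub_eq_zero.1 hd]
  · obtain ⟨-, hb, hc⟩ := vanish hconst (hH 0 1) (hH 1 0)
      fun p hp => by linear_combination -e00 p hp
    have hd := (vanish (hH 0 1) hconst hdiag fun p hp => by linear_combination e01 p hp).2.2
    refine ⟨H 0 0 0, ?_⟩
    ext i j
    fin_cases i <;> fin_cases j <;> simp [hb, hc, ← sub_eq_zero.1 hd]
end

section
/- Fix ℓ ∈ ℕ and define A, B : ℂ² → Mat(2×2, ℂ) by A(z,w) = [[z^{2+ℓ} w^{2+ℓ}, z^{3+ℓ}], [w^{3+ℓ}, 0]] and B(z,w) = [[0, z^{3+ℓ}], [w^{3+ℓ}, z^{2+ℓ} w^{2+ℓ}]]. Let 𝔹² = {(z,w) ∈ ℂ² : |z|² + |w|² < 1}. Then: (1) A and B are globally C^ℓ similar on 𝔹², i.e., there exists an ℓ-times continuously real-differentiable map S : 𝔹² → GL(2, ℂ) with S(ζ) B(ζ) S(ζ)⁻¹ = A(ζ) for all ζ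 ∈ 𝔹²; but (2) A and B are not locally holomorphically similar at the origin, i.e., there do not exist an open neighborhood U of (0,0) in ℂ² and a holomorphic map H : U → GL(2, ℂ) with B(ζ) = H(ζ)⁻¹ A(ζ) H(ζ) for all ζ ∈ U. -/
/-- The open unit ball in `ℂ²`. -/
def unitBall2 : Set (ℂ × ℂ) :=
  {p : ℂ × ℂ | Complex.normSq p.1 + Complex.normSq p.2 < 1}

theorem exists_norm_le_mul_norm_pow_of_homogeneous {E F : Type*} [NormedAddCommGroup E]
    [NormedSpace ℝ E] [ProperSpace E] [NormedAddCommGroup F] [NormedSpace ℝ F] (n : ℕ)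
    (f : E → F) (h0 : f 0 = 0) (hf : ∀ x, x ≠ 0 → ContinuousAt f x)
    (hom : ∀ t : ℝ, 0 < t → ∀ x, f (t • x) = t ^ n • f x) :
    ∃ C : ℝ, ∀ x, ‖f x‖ ≤ C * ‖x‖ ^ n := by
  have hc : ContinuousOn f (Metric.sphere 0 1) := fun x hx =>
    (hf x (ne_zero_of_mem_unit_sphere ⟨x, hx⟩)).continuousWithinAt
  obtain ⟨C, hC⟩ := (isCompact_sphere (0 : E) 1).exists_bound_of_continuousOn hc
  refine ⟨max C 0, fun x => ?_⟩
  rcases eq_or_ne x 0 with rfl | hx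
  · rw [h0, norm_zero]
    positivity
  have hx' : 0 < ‖x‖ := norm_pos_iff.2 hx
  have h1 := hom ‖x‖ hx' (‖x‖⁻¹ • x)
  rw [smul_inv_smul₀ hx'.ne'] at h1
  have h2 := (hC (‖x‖⁻¹ • x) (by simp [norm_smul, hx'.ne'])).trans (le_max_left C 0)
  rw [h1, norm_smul, norm_pow, norm_norm, mul_comm]
  gcongr

open Filter Topology in
/-- A map that is smooth away from the origin and positively homogeneous of degree `n + 1`
is of class `C^n` everywhere. -/
theorem contDiff_of_homogeneous.{u} {E : Type u} [NormedAddCommGroup E] [NormedSpace ℝ E]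
    [ProperSpace E] (n : ℕ) {F : Type u} [NormedAddCommGroup F] [NormedSpace ℝ F] (f : E → F)
    (h0 : f 0 = 0) (hf : ∀ x, x ≠ 0 → ContDiffAt ℝ (⊤ : ℕ∞) f x)
    (hom : ∀ t : ℝ, 0 < t → ∀ x, f (t • x) = t ^ (n + 1) • f x) :
    ContDiff ℝ n f := by
  obtain ⟨C, hC⟩ := exists_norm_le_mul_norm_pow_of_homogeneous (n + 1) f h0
    (fun x hx => (hf x hx).continuousAt) hom
  induction n generalizing F C with
  | zero =>
    rw [Nat.cast_zero, contDiff_zero, continuous_iff_continuousAt]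
    intro x
    rcases eq_or_ne x 0 with rfl | hx
    · rw [ContinuousAt, h0]
      refine squeeze_zero_norm hC ?_
      have : Continuous fun x : E => C * ‖x‖ ^ (0 + 1) := by fun_prop
      simpa using this.tendsto 0
    · exact (hf x hx).continuousAt
  | succ n ih =>
    have hd0 : HasFDerivAt f (0 : E →L[ℝ] F) 0 := by
      rw [hasFDerivAt_iff_isLittleO_nhds_zero]
      have h1 : (fun h : E => f (0 + h) - f 0 - (0 : E →L[ℝ] F) h) =O[𝓝 0]
          fun h : E => ‖h‖ ^ (n + 1 + 1) :=
        Asymptotics.IsBigO.of_bound C (Eventually.of_forall fun x => by simpa [h0] using hC x)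
      exact h1.trans_isLittleO (Asymptotics.isLittleO_norm_pow_id (by omega))
    have hdiff : Differentiable ℝ f := fun x => by
      rcases eq_or_ne x 0 with rfl | hx
      · exact hd0.differentiableAt
      · exact (hf x hx).differentiableAt (by simp)
    have hhom : ∀ t : ℝ, 0 < t → ∀ x, fderiv ℝ f (t • x) = t ^ (n + 1) • fderiv ℝ f x := by
      intro t ht x
      have h1 : fderiv ℝ (fun y => f (t • y)) x = t • fderiv ℝ f (t • x) := fderiv_comp_smul t
      have h2 : (fun y => f (t • y)) = fun y => t ^ (n + 1 + 1) • f y := funext (hom t ht)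
      rw [h2, fderiv_fun_const_smul (hdiff x), pow_succ', mul_smul] at h1
      exact (smul_right_injective _ ht.ne' h1).symm
    have hsm : ∀ x, x ≠ 0 → ContDiffAt ℝ (⊤ : ℕ∞) (fderiv ℝ f) x := fun x hx =>
      (hf x hx).fderiv_right (by simp)
    obtain ⟨D, hD⟩ := exists_norm_le_mul_norm_pow_of_homogeneous (n + 1) _ hd0.fderiv
      (fun x hx => (hsm x hx).continuousAt) hhom
    rw [Nat.cast_succ, contDiff_succ_iff_fderiv]
    exact ⟨hdiff, by simp, ih _ hd0.fderiv hsm hhom D hD⟩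

theorem normSq_add_normSq_ne_zero {p : ℂ × ℂ} (hp : p ≠ 0) :
    ((Complex.normSq p.1 + Complex.normSq p.2 : ℝ) : ℂ) ≠ 0 := by
  rw [Complex.ofReal_ne_zero]
  intro h
  have h1 := Complex.normSq_nonneg p.1
  have h2 := Complex.normSq_nonneg p.2
  exact hp (Prod.ext (Complex.normSq_eq_zero.1 (by linarith))
    (Complex.normSq_eq_zero.1 (by linarith)))

/-- The off-diagonal entry `z ^ (2 + ℓ) * conj w / (|z|² + |w|²)` of the similarity. -/
noncomputable def similarityEntry (ℓ : ℕ) (p : ℂ × ℂ) : ℂ :=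
  p.1 ^ (2 + ℓ) * (starRingEnd ℂ) p.2 / ((Complex.normSq p.1 + Complex.normSq p.2 : ℝ) : ℂ)

theorem contDiff_similarityEntry (ℓ : ℕ) : ContDiff ℝ ℓ (similarityEntry ℓ) := by
  refine contDiff_of_homogeneous ℓ _ (by simp [similarityEntry]) (fun p hp => ?_) ?_
  · have hconj : ContDiff ℝ (⊤ : ℕ∞) fun q : ℂ × ℂ => (starRingEnd ℂ) q.2 :=
      Complex.conjCLE.contDiff.comp contDiff_snd
    have hre : ContDiff ℝ (⊤ : ℕ∞) Complex.re := Complex.reCLM.contDiff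
    have him : ContDiff ℝ (⊤ : ℕ∞) Complex.im := Complex.imCLM.contDiff
    have hnum : ContDiff ℝ (⊤ : ℕ∞) fun q : ℂ × ℂ => q.1 ^ (2 + ℓ) * (starRingEnd ℂ) q.2 :=
      (contDiff_fst.pow _).mul hconj
    have hsq : ContDiff ℝ (⊤ : ℕ∞) fun z : ℂ => Complex.normSq z := by
      simp only [Complex.normSq_apply]
      exact (hre.mul hre).add (him.mul him)
    have hden : ContDiff ℝ (⊤ : ℕ∞) fun q : ℂ × ℂ =>
        ((Complex.normSq q.1 + Complex.normSq q.2 : ℝ) : ℂ) :=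
      Complex.ofRealCLM.contDiff.comp
        ((hsq.comp contDiff_fst).add (hsq.comp contDiff_snd))
    simp only [funext fun q => show similarityEntry ℓ q = _ from div_eq_mul_inv _ _]
    exact hnum.contDiffAt.mul (hden.contDiffAt.inv (normSq_add_normSq_ne_zero hp))
  · intro t ht p
    have ht' : (t : ℂ) ≠ 0 := by exact_mod_cast ht.ne'
    rcases eq_or_ne p 0 with rfl | hp
    · simp [similarityEntry]
    have hd := normSq_add_normSq_ne_zero hp
    have hd' : ((Complex.normSq (t * p.1) + Complex.normSq (t * p.2) : ℝ) : ℂ)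
        = t ^ 2 * ((Complex.normSq p.1 + Complex.normSq p.2 : ℝ) : ℂ) := by
      simp only [Complex.normSq_mul, Complex.normSq_ofReal]
      push_cast
      ring
    simp only [similarityEntry, Prod.smul_fst, Prod.smul_snd, Complex.real_smul,
      Complex.ofReal_pow, hd']
    rw [map_mul, Complex.conj_ofReal]
    field_simp
    ring

theorem mul_similarityEntry_add (ℓ : ℕ) (p : ℂ × ℂ) :
    p.2 ^ (3 + ℓ) * similarityEntry ℓ p + p.1 ^ (3 + ℓ) * similarityEntry ℓ p.swap
      = p.1 ^ (2 + ℓ) * p.2 ^ (2 + ℓ) := by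
  rcases eq_or_ne p 0 with rfl | hp
  · simp [similarityEntry]
  have hd := normSq_add_normSq_ne_zero hp
  simp only [similarityEntry, Prod.fst_swap, Prod.snd_swap]
  rw [add_comm (Complex.normSq p.2)]
  field_simp
  rw [Complex.ofReal_add, ← Complex.mul_conj, ← Complex.mul_conj]
  ring

theorem norm_similarityEntry_mul_lt_one (ℓ : ℕ) {p : ℂ × ℂ} (hp : p ∈ unitBall2) :
    ‖similarityEntry ℓ p * similarityEntry ℓ p.swap‖ < 1 := by
  rcases eq_or_ne p 0 with rfl | hp0
  · simp [similarityEntry]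
  have hd := normSq_add_normSq_ne_zero hp0
  rw [Complex.ofReal_ne_zero] at hd
  have hb : Complex.normSq p.1 + Complex.normSq p.2 < 1 := hp
  have hpos : 0 < Complex.normSq p.1 + Complex.normSq p.2 :=
    lt_of_le_of_ne (add_nonneg (Complex.normSq_nonneg _) (Complex.normSq_nonneg _)) hd.symm
  simp only [similarityEntry, Prod.fst_swap, Prod.snd_swap]
  rw [add_comm (Complex.normSq p.2), norm_mul, norm_div, norm_div, Complex.norm_real,
    Real.norm_of_nonneg hpos.le, div_mul_div_comm, div_lt_one (by positivity)]
  simp only [norm_mul, norm_pow, RCLike.norm_conj]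
  simp only [Complex.normSq_eq_norm_sq] at hb hpos ⊢
  set a := ‖p.1‖
  set b := ‖p.2‖
  have hab : a * b ≤ (a ^ 2 + b ^ 2) / 2 := by nlinarith [sq_nonneg (a - b)]
  have h0 : 0 ≤ a * b := by positivity
  have h1 : (a * b) ^ (1 + ℓ) ≤ 1 := pow_le_one₀ h0 (by linarith)
  calc a ^ (2 + ℓ) * b * (b ^ (2 + ℓ) * a) = (a * b) ^ 2 * (a * b) ^ (1 + ℓ) := by ring
    _ ≤ (a * b) ^ 2 * 1 := by gcongr
    _ < (a ^ 2 + b ^ 2) * (a ^ 2 + b ^ 2) := by nlinarith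

open Filter Topology in
/-- If `w ^ (m + 1) * f₂ - z ^ (m + 1) * f₃ = z ^ m * w ^ m * f₁` for holomorphic `f₁, f₂, f₃`
near the origin, then `f₁` vanishes at the origin. -/
theorem eq_zero_of_holomorphic_relation (m : ℕ) {U : Set (ℂ × ℂ)} (hU : IsOpen U)
    (h0 : (0 : ℂ × ℂ) ∈ U) {f₁ f₂ f₃ : ℂ × ℂ → ℂ} (h₁ : DifferentiableOn ℂ f₁ U)
    (h₂ : DifferentiableOn ℂ f₂ U) (h₃ : ContinuousOn f₃ U)
    (h : ∀ p ∈ U, p.2 ^ (m + 1) * f₂ p - p.1 ^ (m + 1) * f₃ p = p.1 ^ m * p.2 ^ m * f₁ p) :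
    f₁ 0 = 0 := by
  have hnhds : U ∈ 𝓝 (0 : ℂ × ℂ) := hU.mem_nhds h0
  have hbd : ∀ᶠ p in 𝓝 (0 : ℂ × ℂ), ‖f₃ p‖ < ‖f₃ 0‖ + 1 :=
    (h₃.continuousAt hnhds).norm.eventually_lt_const (lt_add_one _)
  obtain ⟨δ, hδ, hball⟩ := Metric.eventually_nhds_iff_ball.1 (hbd.and hnhds)
  set M := ‖f₃ 0‖ + 1
  set r := δ / 2
  have hr : 0 < r := half_pos hδ
  have hmem : ∀ z w : ℂ, ‖z‖ < δ → ‖w‖ ≤ r → (z, w) ∈ Metric.ball (0 : ℂ × ℂ) δ := by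
    intro z w hz hw
    rw [mem_ball_zero_iff, Prod.norm_def]
    exact max_lt hz (hw.trans_lt (half_lt_self hδ))
  have key : ∀ z : ℂ, z ≠ 0 → ‖z‖ < δ → ‖f₁ (z, 0)‖ ≤ ‖z‖ * (M / r ^ m) := by
    intro z hz hzδ
    have hslice : ∀ f : ℂ × ℂ → ℂ, DifferentiableOn ℂ f U →
        DifferentiableOn ℂ (fun w => f (z, w)) (Metric.closedBall 0 r) := fun f hf =>
      hf.comp (by fun_prop) fun w hw =>
        (hball _ (hmem z w hzδ (mem_closedBall_zero_iff.1 hw))).2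
    have hg : DiffContOnCl ℂ (fun w => f₁ (z, w) - w * f₂ (z, w) / z ^ m) (Metric.ball 0 r) := by
      refine DifferentiableOn.diffContOnCl ?_
      rw [closure_ball _ hr.ne']
      exact (hslice f₁ h₁).sub ((differentiableOn_id.mul (hslice f₂ h₂)).div_const _)
    have hmax := Complex.norm_le_of_forall_mem_frontier_norm_le (C := ‖z‖ * (M / r ^ m))
      Metric.isBounded_ball hg ?_ (subset_closure (Metric.mem_ball_self hr))
    · simpa using hmax
    intro w hw
    rw [frontier_ball _ hr.ne', mem_sphere_zero_iff_norm] at hw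
    have hw0 : w ≠ 0 := norm_pos_iff.1 (hw ▸ hr)
    obtain ⟨hM, hpU⟩ := hball _ (hmem z w hzδ hw.le)
    have hrel := h _ hpU
    have heq : f₁ (z, w) - w * f₂ (z, w) / z ^ m = -(z * (f₃ (z, w) / w ^ m)) := by
      simp only at hrel
      field_simp
      linear_combination -hrel
    rw [heq, norm_neg, norm_mul, norm_div, norm_pow, hw]
    gcongr
  have hlim : Tendsto (fun z : ℂ => f₁ (z, 0)) (𝓝[≠] 0) (𝓝 0) := by
    refine squeeze_zero_norm' (a := fun z : ℂ => ‖z‖ * (M / r ^ m)) ?_ ?_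
    · filter_upwards [self_mem_nhdsWithin, nhdsWithin_le_nhds (Metric.ball_mem_nhds 0 hδ)]
        with z hz hzδ
      exact key z hz (mem_ball_zero_iff.1 hzδ)
    · have : Continuous fun z : ℂ => ‖z‖ * (M / r ^ m) := by fun_prop
      simpa using (this.tendsto 0).mono_left nhdsWithin_le_nhds
  have hcont : ContinuousAt (fun z : ℂ => f₁ (z, 0)) 0 :=
    (h₁.continuousOn.continuousAt hnhds).comp_of_eq (f := fun z : ℂ => (z, (0 : ℂ)))
      (by fun_prop) rfl
  exact tendsto_nhds_unique (hcont.tendsto.mono_left nhdsWithin_le_nhds) hlim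

open Filter Topology in
theorem eq_zero_of_pow_mul_eq_zero (k : ℕ) {U : Set (ℂ × ℂ)} (hU : IsOpen U)
    (h0 : (0 : ℂ × ℂ) ∈ U) {f : ℂ × ℂ → ℂ} (hf : ContinuousOn f U)
    (h : ∀ w : ℂ, (0, w) ∈ U → w ^ k * f (0, w) = 0) : f 0 = 0 := by
  have hnhds : U ∈ 𝓝 (0 : ℂ × ℂ) := hU.mem_nhds h0
  have hi : ContinuousAt (fun w : ℂ => ((0 : ℂ), w)) 0 := by fun_prop
  have hcont : ContinuousAt (fun w : ℂ => f (0, w)) 0 :=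
    (hf.continuousAt hnhds).comp_of_eq hi rfl
  have hlim : Tendsto (fun w : ℂ => f (0, w)) (𝓝[≠] 0) (𝓝 0) := by
    refine tendsto_const_nhds.congr' ?_
    filter_upwards [self_mem_nhdsWithin, nhdsWithin_le_nhds (hi.preimage_mem_nhds hnhds)]
      with w hw hwU
    exact ((mul_eq_zero.1 (h w hwU)).resolve_left (pow_ne_zero _ hw)).symm
  exact tendsto_nhds_unique (hcont.tendsto.mono_left nhdsWithin_le_nhds) hlim

/-- On the unit ball of `ℂ²`, the matrices `A` and `B` are globally `C^ℓ` similar,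
but not locally holomorphically similar at the origin. -/
theorem local_counterexample_Ck_but_not_holomorphic (ℓ : ℕ) :
    (∃ S : ℂ × ℂ → Matrix (Fin 2) (Fin 2) ℂ,
      (∀ i j, ContDiffOn ℝ (ℓ : WithTop ℕ∞) (fun p => S p i j) unitBall2) ∧
      ∀ p ∈ unitBall2, IsUnit (S p) ∧ S p * exB ℓ p * (S p)⁻¹ = exA ℓ p) ∧
    ¬ ∃ U : Set (ℂ × ℂ), IsOpen U ∧ (0 : ℂ × ℂ) ∈ U ∧
      ∃ H : ℂ × ℂ → Matrix (Fin 2) (Fin 2) ℂ, MatHoloOn H U ∧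
        ∀ p ∈ U, IsUnit (H p) ∧ exB ℓ p = (H p)⁻¹ * exA ℓ p * H p := by
  refine ⟨⟨fun p => !![1, similarityEntry ℓ p; -similarityEntry ℓ p.swap, 1], ?_, ?_⟩, ?_⟩
  · have hs := contDiff_similarityEntry ℓ
    have hswap : ContDiff ℝ ℓ fun p : ℂ × ℂ => -similarityEntry ℓ p.swap :=
      (hs.comp (contDiff_snd.prodMk contDiff_fst)).neg
    intro i j
    refine ContDiff.contDiffOn ?_
    fin_cases i <;> fin_cases j
    exacts [contDiff_const, hs, hswap, contDiff_const]
  · intro p hp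
    have hlt := norm_similarityEntry_mul_lt_one ℓ hp
    have hrel := mul_similarityEntry_add ℓ p
    have hdet : IsUnit !![1, similarityEntry ℓ p; -similarityEntry ℓ p.swap, 1].det := by
      rw [isUnit_iff_ne_zero, Matrix.det_fin_two_of]
      intro h
      have : similarityEntry ℓ p * similarityEntry ℓ p.swap = -1 := by linear_combination h
      simp [this] at hlt
    refine ⟨(Matrix.isUnit_iff_isUnit_det _).2 hdet, ?_⟩
    suffices hcomm : !![1, similarityEntry ℓ p; -similarityEntry ℓ p.swap, 1] * exB ℓ p
        = exA ℓ p * !![1, similarityEntry ℓ p; -similarityEntry ℓ p.swap, 1] by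
      rw [hcomm, Matrix.mul_nonsing_inv_cancel_right _ _ hdet]
    ext i j
    fin_cases i <;> fin_cases j <;> simp [exA, exB, Matrix.mul_apply, Fin.sum_univ_two]
    exacts [by linear_combination hrel, by ring, by linear_combination -hrel]
  · rintro ⟨U, hU, h0, H, hH, hsim⟩
    have hrel : ∀ p ∈ U, p.2 ^ (2 + ℓ + 1) * H p 0 1 - p.1 ^ (2 + ℓ + 1) * H p 1 0
        = p.1 ^ (2 + ℓ) * p.2 ^ (2 + ℓ) * H p 0 0 := by
      intro p hp
      obtain ⟨hu, hB⟩ := hsim p hp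
      have hcomm : H p * exB ℓ p = exA ℓ p * H p := by
        rw [hB, Matrix.mul_assoc,
          Matrix.mul_nonsing_inv_cancel_left _ _ ((Matrix.isUnit_iff_isUnit_det _).1 hu)]
      have h00 := congrFun (congrFun hcomm 0) 0
      simp only [exA, exB, Matrix.mul_apply, Fin.sum_univ_two, Matrix.of_apply, Matrix.cons_val',
        Matrix.cons_val_zero, Matrix.cons_val_one, Matrix.cons_val_fin_one] at h00
      linear_combination h00
    have hz₁ : H 0 0 0 = 0 := eq_zero_of_holomorphic_relation (2 + ℓ) hU h0 (hH 0 0) (hH 0 1)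
      (hH 1 0).continuousOn hrel
    have hz₂ : H 0 0 1 = 0 := eq_zero_of_pow_mul_eq_zero (2 + ℓ + 1) hU h0
      (hH 0 1).continuousOn fun w hw => by simpa using hrel _ hw
    have hdet := ((Matrix.isUnit_iff_isUnit_det _).1 (hsim 0 h0).1).ne_zero
    exact hdet (by rw [Matrix.det_fin_two, hz₁, hz₂]; ring)
end

section
/- Fix ℓ ∈ ℕ and let t₁, …, t_{2ℓ+5} be pairwise different complex numbers. Let X = ⋃_{j=1}^{2ℓ+5} {(z,w) ∈ ℂ² : w = t_j z}. Suppose U is an open neighborhood of the origin in ℂ² and α, β, γ : U → ℂ are holomorphic functions such that α(z,w)·z^{ℓ+3} + β(z,w)·w^{ℓ+3} + γ(z,w)·z^{ℓ+2} w^{ℓ+2} = 0 for all (z,w) ∈ X ∩ U. Then α(0,0) = β(0,0) = γ(0,0) = 0. -/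
open Metric Polynomial

/-- Directional derivatives of a holomorphic function of several variables are holomorphic. -/
theorem differentiableOn_fderiv_apply_const {E : Type*} [NormedAddCommGroup E] [NormedSpace ℂ E]
    [FiniteDimensional ℂ E] {f : E → ℂ} {U : Set E} (hU : IsOpen U)
    (hf : DifferentiableOn ℂ f U) (v : E) :
    DifferentiableOn ℂ (fun x => fderiv ℂ f x v) U := by
  intro x hx
  refine DifferentiableAt.differentiableWithinAt ?_
  obtain ⟨δ, hδ, hball⟩ : ∃ δ > 0, ∀ y ∈ ball x δ, y ∈ U ∧ f y ∈ ball (f x) 1 := by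
    have h1 := (hf.differentiableAt (hU.mem_nhds hx)).continuousAt (ball_mem_nhds _ one_pos)
    exact Metric.mem_nhds_iff.1 (Filter.inter_mem (hU.mem_nhds hx) h1)
  obtain ⟨r, hr, rfl⟩ : ∃ r > 0, δ = 3 * r := ⟨δ / 3, by positivity, by ring⟩
  obtain ⟨ρ, hρ, hρv⟩ : ∃ ρ > 0, ρ * ‖v‖ < r := by
    refine ⟨r / (‖v‖ + 1), by positivity, ?_⟩
    rw [div_mul_eq_mul_div, div_lt_iff₀ (by positivity)]
    nlinarith
  have hmem : ∀ y ∈ ball x r, ∀ ζ ∈ closedBall (0 : ℂ) ρ, y + ζ • v ∈ ball x (2 * r) := by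
    intro y hy ζ hζ
    rw [mem_ball_iff_norm] at hy ⊢
    rw [mem_closedBall_zero_iff] at hζ
    calc ‖y + ζ • v - x‖ = ‖(y - x) + ζ • v‖ := by congr 1; abel
      _ ≤ ‖y - x‖ + ‖ζ‖ * ‖v‖ := (norm_add_le _ _).trans_eq (by rw [norm_smul])
      _ < 2 * r := by nlinarith [mul_le_mul_of_nonneg_right hζ (norm_nonneg v)]
  have hsub : ball x (2 * r) ⊆ ball x (3 * r) := ball_subset_ball (by linarith)
  have hdiff : ∀ y ∈ ball x (2 * r), DifferentiableAt ℂ f y := fun y hy =>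
    hf.differentiableAt (hU.mem_nhds (hball y (hsub hy)).1)
  have hbound : ∀ y ∈ ball x (2 * r), ‖fderiv ℂ f y‖ ≤ 2 / r := by
    intro y hy
    have hyr : ball y r ⊆ ball x (3 * r) := by
      refine ball_subset_ball' ?_
      rw [mem_ball] at hy
      linarith
    refine Complex.norm_fderiv_le_div_of_mapsTo_ball
      (hf.mono fun z hz => (hball z (hyr hz)).1) (fun z hz => ?_) hr
    have h1 := (hball z (hyr hz)).2
    have h2 := (hball y (hsub hy)).2
    rw [mem_ball] at h1
    rw [mem_ball'] at h2
    rw [mem_closedBall]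
    linarith [dist_triangle (f z) (f x) (f y)]
  have hcirc : ∀ θ : ℝ, circleMap 0 ρ θ ∈ closedBall (0 : ℂ) ρ :=
    circleMap_mem_closedBall 0 hρ.le
  have hcauchy : ∀ y ∈ ball x r, fderiv ℂ f y v =
      (2 * Real.pi * Complex.I)⁻¹ * ∮ ζ in C(0, ρ), (1 / (ζ - 0) ^ 2) • f (y + ζ • v) := by
    intro y hy
    have hline : ∀ ζ ∈ closedBall (0 : ℂ) ρ, HasDerivAt (fun ζ : ℂ => f (y + ζ • v))
        (fderiv ℂ f (y + ζ • v) v) ζ := by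
      intro ζ hζ
      have h := ((hasDerivAt_id ζ).smul_const v).const_add y
      simpa [Function.comp_def] using (hdiff _ (hmem y hy ζ hζ)).hasFDerivAt.comp_hasDerivAt ζ h
    rw [DifferentiableOn.deriv_eq_smul_circleIntegral hρ
      fun ζ hζ => (hline ζ hζ).differentiableAt.differentiableWithinAt,
      (hline 0 (by simpa using hρ.le)).deriv, smul_eq_mul, inv_mul_cancel_left₀]
    · simp
    · simp [Real.pi_ne_zero]
  have hdint : DifferentiableAt ℂ
      (fun y => ∮ ζ in C(0, ρ), (1 / (ζ - 0) ^ 2) • f (y + ζ • v)) x := by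
    borelize E
    have := FiniteDimensional.proper ℂ E
    have := FiniteDimensional.proper ℂ (E →L[ℂ] ℂ)
    have hk : Continuous fun θ : ℝ =>
        deriv (circleMap 0 ρ) θ * (1 / (circleMap 0 ρ θ - 0) ^ 2) := by
      have h2 : ∀ θ : ℝ, (circleMap 0 ρ θ - 0) ^ 2 ≠ 0 := fun θ => by
        simp [hρ.ne']
      simp only [deriv_circleMap]
      fun_prop (disch := assumption)
    have hcont : ∀ y ∈ ball x r, Continuous fun θ : ℝ =>
        deriv (circleMap 0 ρ) θ • (1 / (circleMap 0 ρ θ - 0) ^ 2) • f (y + circleMap 0 ρ θ • v) := by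
      intro y hy
      have h1 : Continuous fun θ : ℝ => f (y + circleMap 0 ρ θ • v) := by
        refine continuous_iff_continuousAt.2 fun θ => ?_
        exact ContinuousAt.comp (f := fun θ : ℝ => y + circleMap 0 ρ θ • v)
          (hdiff _ (hmem y hy _ (hcirc θ))).continuousAt (by fun_prop)
      simpa only [smul_eq_mul, mul_assoc] using hk.fun_mul h1
    refine (intervalIntegral.hasFDerivAt_integral_of_dominated_of_fderiv_le
      (F' := fun y θ => (deriv (circleMap 0 ρ) θ * (1 / (circleMap 0 ρ θ - 0) ^ 2)) •
        fderiv ℂ f (y + circleMap 0 ρ θ • v))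
      (bound := fun θ => ‖deriv (circleMap 0 ρ) θ * (1 / (circleMap 0 ρ θ - 0) ^ 2)‖ * (2 / r))
      (ball_mem_nhds x hr) ?_ ?_ ?_ ?_ ?_ ?_).differentiableAt
    · filter_upwards [ball_mem_nhds x hr] with y hy
      exact (hcont y hy).aestronglyMeasurable
    · exact (hcont x (mem_ball_self hr)).intervalIntegrable _ _
    · refine hk.aestronglyMeasurable.smul (Measurable.aestronglyMeasurable ?_)
      exact (measurable_fderiv ℂ f).comp (by fun_prop)
    · refine .of_forall fun θ _ y hy => ?_
      rw [norm_smul]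
      exact mul_le_mul_of_nonneg_left (hbound _ (hmem y hy _ (hcirc θ))) (norm_nonneg _)
    · exact (hk.norm.mul continuous_const).intervalIntegrable _ _
    · refine .of_forall fun θ _ y hy => ?_
      have h := (hdiff _ (hmem y hy _ (hcirc θ))).hasFDerivAt.comp y
        ((hasFDerivAt_id y).add_const (circleMap 0 ρ θ • v))
      simpa only [smul_eq_mul, ← mul_assoc, Function.comp_def, id_eq,
        ContinuousLinearMap.comp_id] using
        h.const_mul (deriv (circleMap 0 ρ) θ * (1 / (circleMap 0 ρ θ - 0) ^ 2))
  exact (hdint.const_mul _).congr_of_eventuallyEq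
    (Filter.eventually_of_mem (ball_mem_nhds x hr) hcauchy)

theorem eventually_mk_mul_mem {U : Set (ℂ × ℂ)} (hU : IsOpen U) (h0 : (0 : ℂ × ℂ) ∈ U) (s : ℂ) :
    ∀ᶠ z in nhds (0 : ℂ), (z, s * z) ∈ U := by
  have hc : Continuous fun z : ℂ => (z, s * z) := by fun_prop
  exact hc.continuousAt.preimage_mem_nhds (hU.mem_nhds (by simpa [Prod.mk_zero_zero] using h0))

theorem analyticAt_comp_mk_mul {U : Set (ℂ × ℂ)} (hU : IsOpen U) (h0 : (0 : ℂ × ℂ) ∈ U)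
    {f : ℂ × ℂ → ℂ} (hf : DifferentiableOn ℂ f U) (s : ℂ) :
    AnalyticAt ℂ (fun z => f (z, s * z)) 0 := by
  rw [Complex.analyticAt_iff_eventually_differentiableAt]
  filter_upwards [eventually_mk_mul_mem hU h0 s] with z hz
  exact DifferentiableAt.comp (f := fun z : ℂ => (z, s * z)) z
    (hf.differentiableAt (hU.mem_nhds hz)) (by fun_prop)

/-- The `n`-th Taylor coefficient of a holomorphic function along the line `w = s z` depends
polynomially on the slope `s`, with degree at most `n`. -/
theorem exists_polynomial_eval_eq_iteratedDeriv_comp_mk_mul {U : Set (ℂ × ℂ)} (hU : IsOpen U)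
    (h0 : (0 : ℂ × ℂ) ∈ U) (n : ℕ) {f : ℂ × ℂ → ℂ} (hf : DifferentiableOn ℂ f U) :
    ∃ p : ℂ[X], p.natDegree ≤ n ∧
      ∀ s, iteratedDeriv n (fun z => f (z, s * z)) 0 = p.eval s := by
  induction n generalizing f with
  | zero => exact ⟨C (f 0), by simp, fun s => by simp [Prod.mk_zero_zero]⟩
  | succ n ih =>
    have hz := differentiableOn_fderiv_apply_const hU hf (1, 0)
    have hw := differentiableOn_fderiv_apply_const hU hf (0, 1)
    obtain ⟨p, hp, hpe⟩ := ih hz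
    obtain ⟨q, hq, hqe⟩ := ih hw
    refine ⟨p + q * X, ?_, fun s => ?_⟩
    · refine (natDegree_add_le _ _).trans (max_le (by omega) ?_)
      exact natDegree_mul_le.trans (add_le_add hq natDegree_X_le)
    · have hderiv : deriv (fun z => f (z, s * z)) =ᶠ[nhds 0] fun z =>
          fderiv ℂ f (z, s * z) (1, 0) + s * fderiv ℂ f (z, s * z) (0, 1) := by
        filter_upwards [eventually_mk_mul_mem hU h0 s] with z hzU
        have hline : HasDerivAt (fun z : ℂ => (z, s * z)) (1, s) z := by
          simpa using (hasDerivAt_id z).prodMk ((hasDerivAt_id z).const_mul s)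
        have hd := (hf.differentiableAt (hU.mem_nhds hzU)).hasFDerivAt.comp_hasDerivAt z hline
        have hs : ((1, s) : ℂ × ℂ) = (1, 0) + s • (0, 1) := by simp
        rw [hs, map_add, map_smul, smul_eq_mul] at hd
        exact hd.deriv
      have hza := (analyticAt_comp_mk_mul hU h0 hz s).contDiffAt (n := n)
      have hwa := (analyticAt_comp_mk_mul hU h0 hw s).contDiffAt (n := n)
      rw [iteratedDeriv_succ', hderiv.iteratedDeriv_eq,
        iteratedDeriv_fun_add hza (contDiffAt_const.mul hwa), iteratedDeriv_const_mul_field,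
        hpe, hqe]
      simp [mul_comm]

theorem iteratedDeriv_pow_mul_zero (n : ℕ) {h : ℂ → ℂ} (hh : AnalyticAt ℂ h 0) :
    iteratedDeriv n (fun z => z ^ n * h z) 0 = n.factorial * h 0 := by
  induction n generalizing h with
  | zero => simp
  | succ n ih =>
    have hderiv : deriv (fun z => z ^ (n + 1) * h z) =ᶠ[nhds 0] fun z =>
        z ^ n * ((n + 1) * h z + z * deriv h z) := by
      filter_upwards [hh.eventually_analyticAt] with z hz
      rw [((hasDerivAt_pow (n + 1) z).fun_mul hz.differentiableAt.hasDerivAt).deriv]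
      push_cast
      ring_nf
    have hanalytic : AnalyticAt ℂ (fun z => (n + 1) * h z + z * deriv h z) 0 :=
      (analyticAt_const.fun_mul hh).fun_add (analyticAt_id.fun_mul hh.deriv)
    rw [iteratedDeriv_succ', hderiv.iteratedDeriv_eq, ih hanalytic, Nat.factorial_succ]
    push_cast
    ring


/-- On a union of `2ℓ+5` distinct complex lines through the origin, the relation
`α z^{ℓ+3} + β w^{ℓ+3} + γ z^{ℓ+2} w^{ℓ+2} = 0` with holomorphic coefficients forces
all three coefficients to vanish at the origin. -/
theorem coefficients_vanish_on_lines (ℓ : ℕ)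
    (t : Fin (2 * ℓ + 5) → ℂ) (ht : Function.Injective t)
    (U : Set (ℂ × ℂ)) (hU : IsOpen U) (h0 : (0 : ℂ × ℂ) ∈ U)
    (α β γ : ℂ × ℂ → ℂ)
    (hα : DifferentiableOn ℂ α U) (hβ : DifferentiableOn ℂ β U)
    (hγ : DifferentiableOn ℂ γ U)
    (heq : ∀ ζ ∈ U, (∃ j, ζ.2 = t j * ζ.1) →
      α ζ * ζ.1 ^ (ℓ + 3) + β ζ * ζ.2 ^ (ℓ + 3)
        + γ ζ * (ζ.1 ^ (ℓ + 2) * ζ.2 ^ (ℓ + 2)) = 0) :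
    α 0 = 0 ∧ β 0 = 0 ∧ γ 0 = 0 := by
  have hA := analyticAt_comp_mk_mul hU h0 hα
  have hB := analyticAt_comp_mk_mul hU h0 hβ
  have hG := analyticAt_comp_mk_mul hU h0 hγ
  have hline : ∀ j, (fun z => α (z, t j * z) + t j ^ (ℓ + 3) * β (z, t j * z)
      + t j ^ (ℓ + 2) * (z ^ (ℓ + 1) * γ (z, t j * z))) =ᶠ[nhds 0] fun _ => 0 := by
    intro j
    refine (ContinuousAt.eventuallyEq_nhds_iff_eventuallyEq_nhdsNE ?_ continuousAt_const).1 ?_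
    · exact (((hA _).continuousAt.add (continuousAt_const.mul (hB _).continuousAt)).add
        (continuousAt_const.mul ((continuousAt_id.pow _).mul (hG _).continuousAt)))
    · filter_upwards [self_mem_nhdsWithin,
        nhdsWithin_le_nhds (eventually_mk_mul_mem hU h0 (t j))] with z hz hzU
      have h := heq _ hzU ⟨j, rfl⟩
      refine (mul_eq_zero.1 ?_).resolve_left (pow_ne_zero (ℓ + 3) hz)
      rw [← h]
      ring
  have hzero : ∀ j, α 0 + t j ^ (ℓ + 3) * β 0 = 0 := fun j => by
    simpa [Prod.mk_zero_zero] using (hline j).eq_of_nhds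
  have hvanish : ∀ p : ℂ[X], p.natDegree < 2 * ℓ + 5 → (∀ j, p.eval (t j) = 0) → p = 0 :=
    fun p hp hroot => eq_zero_of_natDegree_lt_card_of_eval_eq_zero p ht hroot (by simpa using hp)
  have hfirst : C (α 0) + C (β 0) * X ^ (ℓ + 3) = (0 : ℂ[X]) := by
    refine hvanish _ ?_ fun j => ?_
    · refine (natDegree_add_le _ _).trans_lt (max_lt (by simp) ?_)
      exact (natDegree_C_mul_X_pow_le _ _).trans_lt (by omega)
    · simp only [eval_add, eval_mul, eval_pow, eval_X, eval_C]
      linear_combination hzero j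
  obtain ⟨p, hp, hpe⟩ :=
    exists_polynomial_eval_eq_iteratedDeriv_comp_mk_mul hU h0 (ℓ + 1) hα
  obtain ⟨q, hq, hqe⟩ :=
    exists_polynomial_eval_eq_iteratedDeriv_comp_mk_mul hU h0 (ℓ + 1) hβ
  have hsecond : p + q * X ^ (ℓ + 3) + C ((ℓ + 1).factorial * γ 0) * X ^ (ℓ + 2) = 0 := by
    refine hvanish _ ?_ fun j => ?_
    · refine (natDegree_add_le _ _).trans_lt (max_lt ?_ ?_)
      · refine (natDegree_add_le _ _).trans_lt (max_lt (by omega) ?_)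
        exact (natDegree_mul_le.trans (add_le_add hq (natDegree_X_pow_le _))).trans_lt (by omega)
      · exact (natDegree_C_mul_X_pow_le _ _).trans_lt (by omega)
    · have h := (hline j).iteratedDeriv_eq (ℓ + 1)
      have hpow : ContDiffAt ℂ (ℓ + 1 : ℕ) (fun z : ℂ => z ^ (ℓ + 1)) 0 := by fun_prop
      have hAc := (hA (t j)).contDiffAt (n := (ℓ + 1 : ℕ))
      have hBc := (hB (t j)).contDiffAt (n := (ℓ + 1 : ℕ))
      have hGc := (hG (t j)).contDiffAt (n := (ℓ + 1 : ℕ))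
      rw [iteratedDeriv_fun_add (hAc.add (contDiffAt_const.mul hBc))
          (contDiffAt_const.mul (hpow.mul hGc)),
        iteratedDeriv_fun_add hAc (contDiffAt_const.mul hBc), iteratedDeriv_const_mul_field,
        iteratedDeriv_const_mul_field, iteratedDeriv_pow_mul_zero _ (hG _), hpe, hqe] at h
      rw [iteratedDeriv_const, if_neg (Nat.succ_ne_zero ℓ), mul_zero, Prod.mk_zero_zero] at h
      simp only [eval_add, eval_mul, eval_pow, eval_X, eval_C]
      linear_combination h
  refine ⟨?_, ?_, ?_⟩
  · simpa using congrArg (coeff · 0) hfirst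
  · simpa [coeff_C] using congrArg (coeff · (ℓ + 3)) hfirst
  · have h := congrArg (coeff · (ℓ + 2)) hsecond
    have hpc : p.coeff (ℓ + 2) = 0 := coeff_eq_zero_of_natDegree_lt (by omega)
    simpa [hpc, coeff_mul_X_pow', Nat.factorial_ne_zero] using h
end

section
/- Fix ℓ ∈ ℕ and define A, B : ℂ² → Mat(2×2, ℂ) by A(z,w) = [[z^{2+ℓ} w^{2+ℓ}, z^{3+ℓ}], [w^{3+ℓ}, 0]] and B(z,w) = [[0, z^{3+ℓ}], [w^{3+ℓ}, z^{2+ℓ} w^{2+ℓ}]]. Let p, q ∈ ℕ be relatively prime with ℓ+2 < q < p, and let X = {(z,w) ∈ ℂ² : z^p = w^q}. Then there do not exist an open neighborhood U of the origin in ℂ² and a holomorphic map H : U → GL(2, ℂ) with H(ζ)⁻¹ A(ζ) H(ζ) = B(ζ) for all ζ ∈ X ∩ U; that is, the restrictions A|_X and B|_X are not locally holomorphically similar at the origin. -/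
open Metric Set Filter Topology Asymptotics Polynomial

/-- Bounded, separately holomorphic functions on the bidisc of radius `r`. -/
structure IsBoundedSepHolo (r : ℝ) (f : ℂ → ℂ → ℂ) : Prop where
  left : ∀ y ∈ ball (0 : ℂ) r, DifferentiableOn ℂ (fun x => f x y) (ball 0 r)
  right : ∀ x ∈ ball (0 : ℂ) r, DifferentiableOn ℂ (f x) (ball 0 r)
  bound : ∃ M, ∀ x ∈ ball (0 : ℂ) r, ∀ y ∈ ball (0 : ℂ) r, ‖f x y‖ ≤ M

namespace IsBoundedSepHolo

variable {r : ℝ} {f : ℂ → ℂ → ℂ}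

theorem restrict_left (hr : 0 < r) (hf : IsBoundedSepHolo r f) :
    IsBoundedSepHolo r fun _ y => f 0 y := by
  obtain ⟨M, hM⟩ := hf.bound
  have h0 : (0 : ℂ) ∈ ball (0 : ℂ) r := mem_ball_self hr
  exact ⟨fun y _ => differentiableOn_const _, fun _ _ => hf.right 0 h0,
    M, fun _ _ y hy => hM 0 h0 y hy⟩

theorem swap (hf : IsBoundedSepHolo r f) : IsBoundedSepHolo r fun x y => f y x := by
  obtain ⟨M, hM⟩ := hf.bound
  exact ⟨hf.right, hf.left, M, fun x hx y hy => hM y hy x hx⟩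

theorem mapsTo_closedBall_of_norm_le (hr : 0 < r) {g : ℂ → ℂ} {M : ℝ}
    (hg : ∀ x ∈ ball (0 : ℂ) r, ‖g x‖ ≤ M) : MapsTo g (ball 0 r) (closedBall (g 0) (M + M)) := fun x hx => by
  rw [mem_closedBall, dist_eq_norm]
  exact (norm_sub_le _ _).trans (add_le_add (hg x hx) (hg 0 (mem_ball_self hr)))

theorem dslope_left (hr : 0 < r) (hf : IsBoundedSepHolo r f) :
    IsBoundedSepHolo r fun x y => dslope (fun x => f x y) 0 x := by
  obtain ⟨M, hM⟩ := hf.bound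
  set K := (M + M) / r
  have hleft : ∀ y ∈ ball (0 : ℂ) r,
      DifferentiableOn ℂ (fun x => dslope (fun x => f x y) 0 x) (ball 0 r) := fun y hy =>
    (Complex.differentiableOn_dslope (ball_mem_nhds _ hr)).2 (hf.left y hy)
  have hbound : ∀ x ∈ ball (0 : ℂ) r, ∀ y ∈ ball (0 : ℂ) r,
      ‖dslope (fun x => f x y) 0 x‖ ≤ K := fun x hx y hy =>
    Complex.norm_dslope_le_div_of_mapsTo_ball (hf.left y hy)
      (mapsTo_closedBall_of_norm_le hr fun x hx => hM x hx y hy) hx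
  have hne : ∀ x ∈ ball (0 : ℂ) r, x ≠ 0 →
      DifferentiableOn ℂ (fun y => dslope (fun x => f x y) 0 x) (ball 0 r) := fun x hx h => by
    simp only [dslope_of_ne _ h, slope_def_module]
    exact ((hf.right x hx).sub (hf.right 0 (mem_ball_self hr))).const_smul (x - 0)⁻¹
  refine ⟨hleft, fun x hx => ?_, K, hbound⟩
  rcases eq_or_ne x 0 with rfl | h
  swap
  · exact hne x hx h
  have hmem : ∀ᶠ x : ℂ in 𝓝[≠] 0, x ∈ ball (0 : ℂ) r :=
    mem_nhdsWithin_of_mem_nhds (ball_mem_nhds _ hr)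
  have hlim : TendstoUniformlyOn (fun x y => dslope (fun x => f x y) 0 x)
      (fun y => dslope (fun x => f x y) 0 0) (𝓝[≠] (0 : ℂ)) (ball 0 r) := by
    rw [Metric.tendstoUniformlyOn_iff]
    intro ε hε
    have hsmall : Tendsto (fun x : ℂ => (K + K) / r * dist x 0) (𝓝[≠] 0) (𝓝 0) := by
      have : Continuous fun x : ℂ => (K + K) / r * dist x 0 := by fun_prop
      simpa using (this.tendsto 0).mono_left nhdsWithin_le_nhds
    filter_upwards [hmem, hsmall.eventually (gt_mem_nhds hε)] with x hx hlt y hy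
    rw [dist_comm]
    exact (Complex.dist_le_div_mul_dist_of_mapsTo_ball (hleft y hy)
      (mapsTo_closedBall_of_norm_le hr fun x hx => hbound x hx y hy) hx).trans_lt hlt
  refine hlim.tendstoLocallyUniformlyOn.differentiableOn ?_ isOpen_ball
  filter_upwards [hmem, self_mem_nhdsWithin] with x hx h using hne x hx h

/-- Hadamard decomposition of a bounded, separately holomorphic function. -/
theorem exists_decomposition (hr : 0 < r) (hf : IsBoundedSepHolo r f) :
    ∃ g h, IsBoundedSepHolo r g ∧ IsBoundedSepHolo r h ∧
      ∀ x y, f x y = f 0 0 + x * g x y + y * h x y := by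
  refine ⟨_, _, hf.dslope_left hr, ((hf.restrict_left hr).swap.dslope_left hr).swap,
    fun x y => ?_⟩
  have h1 := sub_smul_dslope (fun x => f x y) 0 x
  have h2 := sub_smul_dslope (fun y => f 0 y) 0 y
  simp only [smul_eq_mul, sub_zero] at h1 h2
  rw [h1, h2]
  ring

/-- Along the curve `t ↦ (t ^ q, t ^ p)`, a bounded, separately holomorphic function has Taylor
polynomials of every order whose exponents lie in the semigroup generated by `q` and `p`. -/
theorem exists_polynomial_curve {p q : ℕ} (hr : 0 < r) (hq : q ≠ 0) (hp : p ≠ 0) (N : ℕ) :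
    ∀ {f : ℂ → ℂ → ℂ}, IsBoundedSepHolo r f → ∃ P : ℂ[X],
      (∀ k, P.coeff k ≠ 0 → ∃ i j, k = i * q + j * p) ∧ (N ≠ 0 → P.coeff 0 = f 0 0) ∧
        (fun t => f (t ^ q) (t ^ p) - P.eval t) =O[𝓝 0] fun t => t ^ N := by
  have hmem : ∀ n : ℕ, n ≠ 0 → ∀ᶠ t : ℂ in 𝓝 0, t ^ n ∈ ball (0 : ℂ) r := fun n hn => by
    have : Tendsto (fun t : ℂ => t ^ n) (𝓝 0) (𝓝 0) := by
      simpa [hn] using (continuous_pow n).tendsto (0 : ℂ)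
    exact this (ball_mem_nhds _ hr)
  induction N with
  | zero =>
    intro f hf
    obtain ⟨M, hM⟩ := hf.bound
    refine ⟨0, by simp, by simp, IsBigO.of_bound M ?_⟩
    filter_upwards [hmem q hq, hmem p hp] with t h1 h2
    simpa using hM _ h1 _ h2
  | succ N ih =>
    intro f hf
    obtain ⟨g, h, hg, hh, hfgh⟩ := hf.exists_decomposition hr
    obtain ⟨P, hP, -, hPO⟩ := ih hg
    obtain ⟨Q, hQ, -, hQO⟩ := ih hh
    have hpow : ∀ n : ℕ, n ≠ 0 → (fun t : ℂ => t ^ n) =O[𝓝 0] fun t => t ^ 1 := fun n hn => by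
      refine IsBigO.of_bound 1 ?_
      filter_upwards [ball_mem_nhds (0 : ℂ) one_pos] with t ht
      rw [mem_ball_zero_iff] at ht
      simpa using pow_le_of_le_one (norm_nonneg t) ht.le hn
    refine ⟨C (f 0 0) + X ^ q * P + X ^ p * Q, fun k hk => ?_, fun _ => ?_, ?_⟩
    · simp only [coeff_add, coeff_C, coeff_X_pow_mul'] at hk
      by_cases h0 : k = 0
      · exact ⟨0, 0, by simp [h0]⟩
      rw [if_neg h0, zero_add] at hk
      by_cases hk1 : (if q ≤ k then P.coeff (k - q) else 0) = 0
      · rw [hk1, zero_add, ite_ne_right_iff] at hk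
        obtain ⟨i, j, hij⟩ := hQ _ hk.2
        exact ⟨i, j + 1, by rw [add_mul]; omega⟩
      · rw [← ne_eq, ite_ne_right_iff] at hk1
        obtain ⟨i, j, hij⟩ := hP _ hk1.2
        exact ⟨i + 1, j, by rw [add_mul]; omega⟩
    · simp [hq.symm, hp.symm]
    · have key := ((hpow q hq).mul hPO).add ((hpow p hp).mul hQO)
      refine (key.congr (fun t => ?_) fun t => ?_)
      · rw [hfgh (t ^ q)]
        simp
        ring
      · ring

end IsBoundedSepHolo

theorem DifferentiableOn.eventually_isBoundedSepHolo {f : ℂ × ℂ → ℂ} {U : Set (ℂ × ℂ)}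
    (hf : DifferentiableOn ℂ f U) (hU : IsOpen U) (h0 : (0 : ℂ × ℂ) ∈ U) :
    ∀ᶠ r in 𝓝[>] (0 : ℝ), IsBoundedSepHolo r fun x y => f (x, y) := by
  have hc := (hf.continuousOn.continuousAt (hU.mem_nhds h0)).norm
  obtain ⟨R, hR, hRU⟩ := Metric.mem_nhds_iff.1 (inter_mem (hU.mem_nhds h0)
    (hc.eventually (gt_mem_nhds (lt_add_one _))))
  filter_upwards [Ioo_mem_nhdsGT hR] with r hr
  have hmem : ∀ x ∈ ball (0 : ℂ) r, ∀ y ∈ ball (0 : ℂ) r, (x, y) ∈ ball (0 : ℂ × ℂ) R := by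
    intro x hx y hy
    rw [mem_ball_zero_iff] at *
    exact (max_lt hx hy).trans hr.2
  exact ⟨fun y hy => hf.comp (by fun_prop) fun x hx => (hRU (hmem x hx y hy)).1,
    fun x hx => hf.comp (by fun_prop) fun y hy => (hRU (hmem x hx y hy)).1,
    _, fun x hx y hy => (hRU (hmem x hx y hy)).2.le⟩

theorem Polynomial.coeff_eq_zero_of_isBigO_pow {N : ℕ} :
    ∀ {P : ℂ[X]}, (fun t => P.eval t) =O[𝓝[≠] 0] (fun t : ℂ => t ^ N) →
      ∀ k < N, P.coeff k = 0 := by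
  induction N with
  | zero => simp
  | succ N ih =>
    intro P hP
    have hP0 : P.coeff 0 = 0 := by
      have h1 : Tendsto (fun t : ℂ => t ^ (N + 1)) (𝓝[≠] 0) (𝓝 0) := by
        simpa using ((continuous_pow (N + 1)).tendsto (0 : ℂ)).mono_left nhdsWithin_le_nhds
      rw [coeff_zero_eq_eval_zero]
      exact tendsto_nhds_unique ((P.continuous.tendsto 0).mono_left nhdsWithin_le_nhds)
        (hP.trans_tendsto h1)
    have hdiv : (fun t => P.divX.eval t) =O[𝓝[≠] 0] (fun t : ℂ => t ^ N) := by
      have h2 := (isBigO_refl (fun t : ℂ => t⁻¹) (𝓝[≠] 0)).mul hP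
      refine h2.congr' ?_ ?_
      · filter_upwards [self_mem_nhdsWithin] with t (ht : t ≠ 0)
        conv_lhs => rw [← P.divX_mul_X_add, hP0]
        simp
        field_simp
      · filter_upwards [self_mem_nhdsWithin] with t (ht : t ≠ 0)
        rw [pow_succ]
        field_simp
    intro k hk
    cases k with
    | zero => exact hP0
    | succ k => rw [← coeff_divX]; exact ih hdiv k (by omega)

/-- On the cusp curve `X = {z^p = w^q}` with `p, q` coprime and `ℓ+2 < q < p`, the
restrictions of `A` and `B` to `X` are not locally holomorphically similar at the
origin. -/
theorem not_locally_similar_on_cusp (ℓ p q : ℕ)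
    (hpq : Nat.Coprime p q) (hq : ℓ + 2 < q) (hqp : q < p) :
    ¬ ∃ U : Set (ℂ × ℂ), IsOpen U ∧ (0 : ℂ × ℂ) ∈ U ∧
      ∃ H : ℂ × ℂ → Matrix (Fin 2) (Fin 2) ℂ, MatHoloOn H U ∧
        (∀ ζ ∈ U, IsUnit (H ζ)) ∧
        ∀ ζ ∈ U, ζ.1 ^ p = ζ.2 ^ q →
          (H ζ)⁻¹ * exA ℓ ζ * H ζ = exB ℓ ζ := by
  rintro ⟨U, hU, h0, H, hH, hunit, hsim⟩
  have hp0 : p ≠ 0 := by omega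
  have hq0 : q ≠ 0 := by omega
  obtain ⟨r, hra, hrb, hrc, hr⟩ := (((hH 0 0).eventually_isBoundedSepHolo hU h0).and
    (((hH 0 1).eventually_isBoundedSepHolo hU h0).and
      (((hH 1 0).eventually_isBoundedSepHolo hU h0).and self_mem_nhdsWithin))).exists
  set m := ℓ + 2 with hm
  set N := m * (p + q) + 1
  obtain ⟨a, -, ha0, haO⟩ := hra.exists_polynomial_curve hr hq0 hp0 N
  obtain ⟨b, hb, -, hbO⟩ := hrb.exists_polynomial_curve hr hq0 hp0 N
  obtain ⟨c, hc, hc0, hcO⟩ := hrc.exists_polynomial_curve hr hq0 hp0 N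
  specialize ha0 (Nat.succ_ne_zero _)
  specialize hc0 (Nat.succ_ne_zero _)
  have hcurve : ∀ᶠ t : ℂ in 𝓝 0, (t ^ q, t ^ p) ∈ U := by
    have : Continuous fun t : ℂ => (t ^ q, t ^ p) := by fun_prop
    refine this.continuousAt.eventually (hU.mem_nhds ?_)
    simp only [zero_pow hp0, zero_pow hq0]
    exact h0
  have hrel : ∀ᶠ t : ℂ in 𝓝 0,
      t ^ (m * (p + q)) * H (t ^ q, t ^ p) 0 0 + t ^ ((m + 1) * q) * H (t ^ q, t ^ p) 1 0
        - t ^ ((m + 1) * p) * H (t ^ q, t ^ p) 0 1 = 0 := by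
    filter_upwards [hcurve] with t ht
    have hs := hsim _ ht (by simp only [← pow_mul]; rw [mul_comm])
    have hinv := (Matrix.isUnit_iff_isUnit_det _).1 (hunit _ ht)
    have hAB : exA ℓ (t ^ q, t ^ p) * H (t ^ q, t ^ p) =
        H (t ^ q, t ^ p) * exB ℓ (t ^ q, t ^ p) := by
      rw [← hs, Matrix.mul_assoc, Matrix.mul_nonsing_inv_cancel_left _ _ hinv]
    have h00 := congrFun (congrFun hAB 0) 0
    simp only [Matrix.mul_apply, Fin.sum_univ_two, exA, exB, Matrix.of_apply, Matrix.cons_val',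
      Matrix.cons_val_zero, Matrix.cons_val_one, Matrix.cons_val_fin_one] at h00
    rw [sub_eq_zero]
    calc _ = (t ^ q) ^ (2 + ℓ) * (t ^ p) ^ (2 + ℓ) * H (t ^ q, t ^ p) 0 0 +
          (t ^ q) ^ (3 + ℓ) * H (t ^ q, t ^ p) 1 0 := by rw [hm]; ring
      _ = _ := h00
      _ = _ := by rw [hm]; ring
  have hmul : ∀ (k : ℕ) {g : ℂ → ℂ}, (g =O[𝓝 0] fun t : ℂ => t ^ N) →
      (fun t => t ^ k * g t) =O[𝓝 0] fun t : ℂ => t ^ N := fun k g hg => by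
    have hk : (fun t : ℂ => t ^ k) =O[𝓝 0] fun _ => (1 : ℂ) :=
      ((continuous_pow k).tendsto (0 : ℂ)).isBigO_one ℂ
    simpa using hk.mul hg
  have hO : (fun t => (X ^ (m * (p + q)) * a + X ^ ((m + 1) * q) * c
      - X ^ ((m + 1) * p) * b).eval t) =O[𝓝[≠] 0] (fun t : ℂ => t ^ N) := by
    refine IsBigO.mono ?_ nhdsWithin_le_nhds
    refine ((((hmul (m * (p + q)) haO).add (hmul ((m + 1) * q) hcO)).sub
      (hmul ((m + 1) * p) hbO)).neg_left).congr' ?_ EventuallyEq.rfl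
    filter_upwards [hrel] with t ht
    simp only [eval_sub, eval_add, eval_mul, eval_pow, eval_X]
    linear_combination -ht
  have hcoeff := Polynomial.coeff_eq_zero_of_isBigO_pow hO
  simp only [coeff_add, coeff_sub, coeff_X_pow_mul'] at hcoeff
  have hmqp : m * q < m * p := Nat.mul_lt_mul_of_pos_left hqp (by omega)
  have hqmp : q < m * p := by nlinarith
  have hA : a.coeff 0 = 0 := by
    have h := hcoeff (m * (p + q)) (by omega)
    have h1 : (if (m + 1) * q ≤ m * (p + q) then c.coeff (m * (p + q) - (m + 1) * q) else 0)
        = 0 := by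
      rw [ite_eq_right_iff]
      intro hle
      by_contra hne
      obtain ⟨i, j, hij⟩ := hc _ hne
      have e : (1 + i) * q + j * p = m * p := by
        have : m * (p + q) = (m + 1) * q + (i * q + j * p) := by omega
        linarith
      have hjm : j < m := by
        by_contra hjm
        have : m * p ≤ j * p := Nat.mul_le_mul_right p (by omega)
        have : 0 < (1 + i) * q := Nat.mul_pos (by omega) (by omega)
        omega
      have hd : q ∣ (m - j) * p := ⟨1 + i, by rw [Nat.sub_mul, mul_comm q]; omega⟩
      have := Nat.le_of_dvd (by omega) (hpq.symm.dvd_of_dvd_mul_right hd)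
      omega
    have h2 : (if (m + 1) * p ≤ m * (p + q) then b.coeff (m * (p + q) - (m + 1) * p) else 0)
        = 0 := by
      rw [ite_eq_right_iff]
      intro hle
      by_contra hne
      obtain ⟨i, j, hij⟩ := hb _ hne
      have e : (1 + j) * p + i * q = m * q := by
        have : m * (p + q) = (m + 1) * p + (i * q + j * p) := by omega
        linarith
      have him : i < m := by
        by_contra him
        have : m * q ≤ i * q := Nat.mul_le_mul_right q (by omega)
        have : 0 < (1 + j) * p := Nat.mul_pos (by omega) (by omega)
        omega
      have hd : p ∣ (m - i) * q := ⟨1 + j, by rw [Nat.sub_mul, mul_comm p]; omega⟩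
      have := Nat.le_of_dvd (by omega) (hpq.dvd_of_dvd_mul_right hd)
      omega
    rw [h1, h2] at h
    simpa using h
  have hC : c.coeff 0 = 0 := by
    have hlt : (m + 1) * q < m * (p + q) := by linarith
    have hlt' : (m + 1) * q < (m + 1) * p := Nat.mul_lt_mul_of_pos_left hqp (by omega)
    have h := hcoeff ((m + 1) * q) (by omega)
    rw [if_neg hlt.not_ge, if_neg hlt'.not_ge] at h
    simpa using h
  have hdet := ((Matrix.isUnit_iff_isUnit_det _).1 (hunit _ h0)).ne_zero
  rw [ha0] at hA
  rw [hc0] at hC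
  apply hdet
  rw [Matrix.det_fin_two]
  change H (0, 0) 0 0 * _ - _ * H (0, 0) 1 0 = 0
  rw [hA, hC]
  ring
end

section
/- Fix ℓ ∈ ℕ and define A, B : ℂ² → Mat(2×2, ℂ) by A(z,w) = [[z^{2+ℓ} w^{2+ℓ}, z^{3+ℓ}], [w^{3+ℓ}, 0]] and B(z,w) = [[0, z^{3+ℓ}], [w^{3+ℓ}, z^{2+ℓ} w^{2+ℓ}]]. Let t₁, …, t_{2ℓ+5} be pairwise different complex numbers and X = ⋃_{j=1}^{2ℓ+5} {(z,w) ∈ ℂ² : w = t_j z}. Then there do not exist an open neighborhood U of the origin in ℂ² and a holomorphic map H : U → GL(2, ℂ) with H(ζ)⁻¹ A(ζ) H(ζ) = B(ζ) for all ζ ∈ X ∩ U; that is, the restrictions A|_X and B|_X are not locally holomorphically similar at the origin. -/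
/-- The `j`-th Cauchy coefficient at the origin, computed on the circle of radius `R`. -/
noncomputable def cauchyCoeff (R : ℝ) (j : ℕ) (g : ℂ → ℂ) : ℂ :=
  (2 * Real.pi * Complex.I : ℂ)⁻¹ • ∮ ζ in C(0, R), ζ⁻¹ ^ j * (ζ⁻¹ * g ζ)

section CauchyCoeff

open Metric

variable {R M : ℝ} {g h : ℂ → ℂ}

lemma continuousOn_cauchyCoeff_integrand (hR : 0 < R) (j : ℕ) (hg : ContinuousOn g (sphere 0 R)) :
    ContinuousOn (fun ζ => ζ⁻¹ ^ j * (ζ⁻¹ * g ζ)) (sphere 0 R) := by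
  have h0 : ∀ ζ ∈ sphere (0 : ℂ) R, ζ ≠ 0 := fun ζ hζ => ne_of_mem_sphere hζ hR.ne'
  have hi : ContinuousOn (fun ζ : ℂ => ζ⁻¹) (sphere 0 R) := continuousOn_id.inv₀ h0
  exact (hi.pow j).mul (hi.mul hg)

lemma norm_cauchyCoeff_le (hR : 0 < R) (j : ℕ) (hg : ∀ ζ ∈ sphere (0 : ℂ) R, ‖g ζ‖ ≤ M) :
    ‖cauchyCoeff R j g‖ ≤ M * R⁻¹ ^ j := by
  refine (circleIntegral.norm_two_pi_i_inv_smul_integral_le_of_norm_le_const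
    (C := R⁻¹ ^ j * (R⁻¹ * M)) hR.le fun ζ hζ => ?_).trans_eq ?_
  · have : ‖ζ‖ = R := by simpa using hζ
    rw [norm_mul, norm_mul, norm_pow, norm_inv, this]
    gcongr
    exact hg ζ hζ
  · field_simp

lemma cauchyCoeff_sub (hR : 0 < R) (j : ℕ) (hg : ContinuousOn g (sphere 0 R))
    (hh : ContinuousOn h (sphere 0 R)) :
    cauchyCoeff R j (fun ζ => g ζ - h ζ) = cauchyCoeff R j g - cauchyCoeff R j h := by
  simp only [cauchyCoeff, ← smul_sub, mul_sub]
  rw [circleIntegral.integral_sub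
    ((continuousOn_cauchyCoeff_integrand hR j hg).circleIntegrable hR.le)
    ((continuousOn_cauchyCoeff_integrand hR j hh).circleIntegrable hR.le)]

lemma cauchyCoeff_sum_mul (hR : 0 < R) (j : ℕ) {ι : Type*} (s : Finset ι) (c : ι → ℂ)
    (G : ι → ℂ → ℂ) (hG : ∀ i ∈ s, ContinuousOn (G i) (sphere 0 R)) :
    cauchyCoeff R j (fun ζ => ∑ i ∈ s, c i * G i ζ) = ∑ i ∈ s, c i * cauchyCoeff R j (G i) := by
  have key : ∀ ζ : ℂ, ζ⁻¹ ^ j * (ζ⁻¹ * ∑ i ∈ s, c i * G i ζ) =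
      ∑ i ∈ s, c i * (ζ⁻¹ ^ j * (ζ⁻¹ * G i ζ)) := fun ζ => by
    simp only [Finset.mul_sum]
    exact Finset.sum_congr rfl fun i _ => by ring
  simp only [cauchyCoeff, key]
  rw [circleIntegral.integral_fun_sum, Finset.smul_sum]
  · refine Finset.sum_congr rfl fun i _ => ?_
    rw [circleIntegral.integral_const_mul]
    simp only [smul_eq_mul]
    ring
  · exact fun i hi => ContinuousOn.circleIntegrable hR.le
      (continuousOn_const.mul (continuousOn_cauchyCoeff_integrand hR j (hG i hi)))

/-- Taylor's formula with a remainder controlled by a bound on the circle only. -/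
lemma norm_sub_sum_cauchyCoeff_le (hR : 0 < R) (hg : DifferentiableOn ℂ g (closedBall 0 R))
    (hM : ∀ ζ ∈ sphere (0 : ℂ) R, ‖g ζ‖ ≤ M) (K : ℕ) {w : ℂ} (hw : ‖w‖ ≤ R / 2) :
    ‖g w - ∑ j ∈ Finset.range K, w ^ j * cauchyCoeff R j g‖ ≤ 2 * M * (‖w‖ / R) ^ K := by
  have hwR : ‖w‖ < R := by linarith
  lift R to NNReal using hR.le
  have hs : HasSum (fun j => w ^ j * cauchyCoeff R j g) (g w) := by
    have hc : ∀ j, (cauchyPowerSeries g 0 R j fun _ => w) = w ^ j * cauchyCoeff R j g := fun j => by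
      simp only [cauchyPowerSeries, ContinuousMultilinearMap.mkPiRing_apply, cauchyCoeff,
        Fin.prod_const, smul_eq_mul, sub_zero]
    have := (hg.hasFPowerSeriesOnBall (by exact_mod_cast hR)).hasSum (y := w)
      (by simpa [enorm_lt_coe] using hwR)
    simpa only [hc, zero_add] using this
  have hr : ‖w‖ / R ≤ 1 / 2 := by rw [div_le_iff₀ hR]; linarith
  have hr0 : 0 ≤ ‖w‖ / R := by positivity
  have hM0 : 0 ≤ M := (norm_nonneg _).trans (hM R (by simp))
  have htail := (hasSum_nat_add_iff' K).2 hs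
  have hgeo := (hasSum_geometric_of_lt_one hr0 (by linarith)).mul_left (M * (‖w‖ / R) ^ K)
  have hle := tsum_of_norm_bounded hgeo (f := fun j => w ^ (j + K) * cauchyCoeff R (j + K) g)
    fun j => by
      rw [norm_mul, norm_pow]
      calc ‖w‖ ^ (j + K) * ‖cauchyCoeff R (j + K) g‖
          ≤ ‖w‖ ^ (j + K) * (M * (R : ℝ)⁻¹ ^ (j + K)) := by
            gcongr
            exact norm_cauchyCoeff_le hR _ hM
        _ = _ := by rw [div_eq_mul_inv]; ring
  rw [htail.tsum_eq] at hle
  refine hle.trans ?_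
  have : (1 - ‖w‖ / R)⁻¹ ≤ 2 := by
    rw [inv_le_comm₀ (by linarith) (by norm_num)]; linarith
  calc M * (‖w‖ / R) ^ K * (1 - ‖w‖ / R)⁻¹ ≤ M * (‖w‖ / R) ^ K * 2 := by gcongr
    _ = _ := by ring

lemma continuousOn_cauchyCoeff (hR : 0 < R) (j : ℕ) {f : ℂ × ℂ → ℂ}
    (hf : ContinuousOn f (closedBall 0 R)) :
    ContinuousOn (fun η => cauchyCoeff R j fun z => f (z, η)) (sphere 0 R) := by
  rw [continuousOn_iff_continuous_domRestrict]
  suffices h : Continuous fun η : sphere (0 : ℂ) R =>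
      ∮ z in C(0, R), z⁻¹ ^ j * (z⁻¹ * f (z, (η : ℂ))) by
    change Continuous fun η : sphere (0 : ℂ) R =>
      (2 * Real.pi * Complex.I : ℂ)⁻¹ * ∮ z in C(0, R), z⁻¹ ^ j * (z⁻¹ * f (z, (η : ℂ)))
    exact continuous_const.mul h
  refine intervalIntegral.continuous_parametric_intervalIntegral_of_continuous' ?_ _ _
  have hmem : ∀ p : sphere (0 : ℂ) R × ℝ, (circleMap 0 R p.2, (p.1 : ℂ)) ∈
      closedBall (0 : ℂ × ℂ) R := fun p => by
    have : ‖(p.1 : ℂ)‖ = R := by simp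
    simp [Prod.norm_def, this, abs_of_pos hR]
  have h1 : Continuous fun p : sphere (0 : ℂ) R × ℝ => f (circleMap 0 R p.2, (p.1 : ℂ)) :=
    hf.comp_continuous (by fun_prop) hmem
  have h2 : Continuous fun p : sphere (0 : ℂ) R × ℝ => (circleMap 0 R p.2)⁻¹ :=
    Continuous.inv₀ (by fun_prop) fun p => circleMap_ne_center hR.ne'
  simp only [deriv_circleMap, Function.uncurry_def, smul_eq_mul]
  have h3 : Continuous fun p : sphere (0 : ℂ) R × ℝ => circleMap 0 R p.2 * Complex.I := by
    fun_prop
  exact h3.mul ((h2.pow j).mul (h2.mul h1))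

end CauchyCoeff

section TwoVariables

open Metric Filter Topology Asymptotics Polynomial

/-- Taylor's formula for a holomorphic function of two variables. -/
lemma exists_isBigO_sub_taylor {f : ℂ × ℂ → ℂ} {U : Set (ℂ × ℂ)} (hU : U ∈ 𝓝 0)
    (hf : DifferentiableOn ℂ f U) (K : ℕ) :
    ∃ a : ℕ → ℕ → ℂ, (fun p : ℂ × ℂ => f p - ∑ j ∈ Finset.range K, ∑ i ∈ Finset.range K,
      a i j * p.1 ^ i * p.2 ^ j) =O[𝓝 0] fun p => ‖p‖ ^ K := by
  obtain ⟨R, hR, hRU⟩ := nhds_basis_closedBall.mem_iff.1 hU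
  replace hf := hf.mono hRU
  obtain ⟨M, hM⟩ := (isCompact_closedBall (0 : ℂ × ℂ) R).exists_bound_of_continuousOn
    hf.continuousOn
  have hM0 : 0 ≤ M := (norm_nonneg _).trans (hM 0 (mem_closedBall_self hR.le))
  have hmem : ∀ {z w : ℂ}, ‖z‖ ≤ R → ‖w‖ ≤ R → (z, w) ∈ closedBall (0 : ℂ × ℂ) R :=
    fun hz hw => by simpa [Prod.norm_def] using ⟨hz, hw⟩
  have hsph : ∀ {ζ : ℂ}, ζ ∈ sphere (0 : ℂ) R → ‖ζ‖ ≤ R := fun h => by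
    rw [mem_sphere_zero_iff_norm.1 h]
  let b : ℕ → ℂ → ℂ := fun i η => cauchyCoeff R i fun z => f (z, η)
  refine ⟨fun i j => cauchyCoeff R j (b i), ?_⟩
  refine IsBigO.of_bound (2 * M * R⁻¹ ^ K * (1 + K)) ?_
  filter_upwards [closedBall_mem_nhds (0 : ℂ × ℂ) (half_pos hR)] with ⟨z, w⟩ hp
  have hp' : ‖(z, w)‖ ≤ R / 2 := by simpa using hp
  have hz : ‖z‖ ≤ R / 2 := (norm_fst_le (z, w)).trans hp'
  have hw : ‖w‖ ≤ R / 2 := (norm_snd_le (z, w)).trans hp'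
  have hzR : ‖z‖ ≤ R := by linarith
  have hwR : ‖w‖ ≤ R := by linarith
  have hslice_fst : ∀ η : ℂ, ‖η‖ ≤ R →
      DifferentiableOn ℂ (fun z => f (z, η)) (closedBall 0 R) := fun η hη =>
    hf.comp (by fun_prop) fun ζ hζ => hmem (by simpa using hζ) hη
  have hslice_snd : ∀ ζ : ℂ, ‖ζ‖ ≤ R →
      DifferentiableOn ℂ (fun w => f (ζ, w)) (closedBall 0 R) := fun ζ hζ =>
    hf.comp (by fun_prop) fun η hη => hmem hζ (by simpa using hη)
  have hcont : ∀ i, ContinuousOn (b i) (sphere 0 R) := fun i =>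
    continuousOn_cauchyCoeff hR i hf.continuousOn
  have hsum : ContinuousOn (fun η => ∑ i ∈ Finset.range K, z ^ i * b i η) (sphere 0 R) :=
    continuousOn_finsetSum _ fun i _ => continuousOn_const.mul (hcont i)
  have hw_exp := norm_sub_sum_cauchyCoeff_le hR (hslice_snd z hzR)
    (fun η hη => hM _ (hmem hzR (hsph hη))) K hw
  have hz_exp : ∀ j, ‖cauchyCoeff R j (fun η => f (z, η)) -
      ∑ i ∈ Finset.range K, z ^ i * cauchyCoeff R j (b i)‖ ≤
      2 * M * (‖z‖ / R) ^ K * R⁻¹ ^ j := fun j => by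
    rw [← cauchyCoeff_sum_mul hR j _ _ b fun i _ => hcont i, ← cauchyCoeff_sub hR j
      ((hslice_snd z hzR).continuousOn.mono sphere_subset_closedBall) hsum]
    exact norm_cauchyCoeff_le hR j fun η hη => norm_sub_sum_cauchyCoeff_le hR
      (hslice_fst η (hsph hη)) (fun ζ hζ => hM _ (hmem (hsph hζ) (hsph hη))) K hz
  have hsplit : f (z, w) - ∑ j ∈ Finset.range K, ∑ i ∈ Finset.range K,
      cauchyCoeff R j (b i) * z ^ i * w ^ j =
      (f (z, w) - ∑ j ∈ Finset.range K, w ^ j * cauchyCoeff R j fun η => f (z, η)) +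
      ∑ j ∈ Finset.range K, w ^ j * (cauchyCoeff R j (fun η => f (z, η)) -
        ∑ i ∈ Finset.range K, z ^ i * cauchyCoeff R j (b i)) := by
    simp only [mul_sub, Finset.sum_sub_distrib, Finset.mul_sum, sub_add_sub_cancel]
    congr 1
    exact Finset.sum_congr rfl fun j _ => Finset.sum_congr rfl fun i _ => by ring
  have hterm : ∀ j ∈ Finset.range K, ‖w ^ j * (cauchyCoeff R j (fun η => f (z, η)) -
      ∑ i ∈ Finset.range K, z ^ i * cauchyCoeff R j (b i))‖ ≤
      2 * M * (‖(z, w)‖ / R) ^ K := fun j _ => by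
    rw [norm_mul, norm_pow]
    calc ‖w‖ ^ j * _ ≤ ‖w‖ ^ j * (2 * M * (‖z‖ / R) ^ K * R⁻¹ ^ j) := by
          gcongr
          exact hz_exp j
      _ = (‖w‖ / R) ^ j * (2 * M * (‖z‖ / R) ^ K) := by rw [div_eq_mul_inv ‖w‖]; ring
      _ ≤ 1 * (2 * M * (‖(z, w)‖ / R) ^ K) := by
          gcongr
          · exact pow_le_one₀ (by positivity) ((div_le_one hR).2 hwR)
          · exact norm_fst_le (z, w)
      _ = _ := one_mul _
  change ‖f (z, w) - ∑ j ∈ Finset.range K, ∑ i ∈ Finset.range K,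
      cauchyCoeff R j (b i) * z ^ i * w ^ j‖ ≤ _
  rw [hsplit]
  calc _ ≤ 2 * M * (‖w‖ / R) ^ K + ∑ _j ∈ Finset.range K, 2 * M * (‖(z, w)‖ / R) ^ K :=
        (norm_add_le _ _).trans (add_le_add hw_exp (norm_sum_le_of_le _ hterm))
    _ ≤ 2 * M * (‖(z, w)‖ / R) ^ K + ∑ _j ∈ Finset.range K, 2 * M * (‖(z, w)‖ / R) ^ K := by
        gcongr
        exact norm_snd_le (z, w)
    _ = _ := by
        rw [Finset.sum_const, Finset.card_range, nsmul_eq_mul, norm_pow, norm_norm,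
          div_eq_mul_inv, mul_pow]
        ring

/-- Along the lines `w = t z`, a holomorphic function has Taylor coefficients that are polynomials
in the slope `t`, the `k`-th one of degree at most `k`. -/
lemma exists_polynomial_isBigO_slope {f : ℂ × ℂ → ℂ} {U : Set (ℂ × ℂ)} (hU : U ∈ 𝓝 0)
    (hf : DifferentiableOn ℂ f U) (K : ℕ) :
    ∃ p : ℂ[X][X], (∀ k, (p.coeff k).natDegree ≤ k) ∧ ∀ t : ℂ,
      (fun s : ℂ => f (s, t * s) - (p.map (evalRingHom t)).eval s) =O[𝓝 0] fun s => s ^ K := by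
  obtain ⟨a, ha⟩ := exists_isBigO_sub_taylor hU hf K
  refine ⟨∑ j ∈ Finset.range K, ∑ i ∈ Finset.range K, C (C (a i j) * X ^ j) * X ^ (i + j),
    fun k => ?_, fun t => ?_⟩
  · simp only [finsetSum_coeff, coeff_C_mul, coeff_X_pow]
    refine natDegree_sum_le_of_forall_le _ _ fun j _ =>
      natDegree_sum_le_of_forall_le _ _ fun i _ => ?_
    split_ifs with h
    · rw [mul_one]
      exact (natDegree_C_mul_X_pow_le _ _).trans (by omega)
    · simp
  · have hlim : Tendsto (fun s : ℂ => (s, t * s)) (𝓝 0) (𝓝 0) := by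
      have : Continuous fun s : ℂ => (s, t * s) := by fun_prop
      have h0 := this.tendsto 0
      rwa [mul_zero] at h0
    have hO : (fun s : ℂ => ‖((s, t * s) : ℂ × ℂ)‖ ^ K) =O[𝓝 0] fun s => s ^ K :=
      (((isBigO_refl _ _).prod_left (isBigO_const_mul_self t _ _)).norm_left).pow K
    refine ((ha.comp_tendsto hlim).trans hO).congr_left fun s => ?_
    simp only [Function.comp, Polynomial.map_sum, eval_finsetSum]
    congr 1
    refine Finset.sum_congr rfl fun j _ => Finset.sum_congr rfl fun i _ => ?_
    simp
    ring

end TwoVariables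

section Jet

open Filter Topology Asymptotics Polynomial

/-- A polynomial that is `O(s ^ K)` at the origin has no coefficients below degree `K`. -/
lemma coeff_eq_zero_of_isBigO {q : ℂ[X]} {K : ℕ}
    (h : (fun s => q.eval s) =O[𝓝[≠] 0] fun s : ℂ => s ^ K) {k : ℕ} (hk : k < K) :
    q.coeff k = 0 := by
  suffices X ^ K ∣ q from X_pow_dvd_iff.1 this k hk
  clear hk k
  induction K generalizing q with
  | zero => simp
  | succ K ih =>
    have hlim : Tendsto (fun s => q.eval s) (𝓝[≠] 0) (𝓝 (q.eval 0)) :=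
      q.continuous.continuousAt.mono_left nhdsWithin_le_nhds
    have hpow : Tendsto (fun s : ℂ => s ^ (K + 1)) (𝓝[≠] 0) (𝓝 0) := by
      have := (continuous_pow (M := ℂ) (K + 1)).tendsto 0
      rw [zero_pow K.succ_ne_zero] at this
      exact this.mono_left nhdsWithin_le_nhds
    have h0 : q.eval 0 = 0 := tendsto_nhds_unique hlim (h.trans_tendsto hpow)
    obtain ⟨r, rfl⟩ := X_dvd_iff.2 (q.coeff_zero_eq_eval_zero.trans h0)
    rw [pow_succ']
    refine mul_dvd_mul_left _ (ih ?_)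
    have := (isBigO_refl (fun s : ℂ => s⁻¹) (𝓝[≠] 0)).mul h
    refine this.congr' ?_ ?_ <;> filter_upwards [self_mem_nhdsWithin] with s hs
    · rw [eval_mul, eval_X, inv_mul_cancel_left₀ hs]
    · rw [pow_succ', inv_mul_cancel_left₀ hs]

end Jet

open Filter Topology Asymptotics Polynomial in
/-- If `tⁿ⁺¹ b - c = tⁿ sⁿ⁻¹ a` along `2n + 1` different lines `s ↦ (s, t s)`, then `a` vanishes
at the origin. -/
lemma eq_zero_of_eq_on_lines {n : ℕ} (hn : 1 ≤ n) {a b c : ℂ × ℂ → ℂ} {U : Set (ℂ × ℂ)}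
    (hU : U ∈ 𝓝 0) (ha : DifferentiableOn ℂ a U) (hb : DifferentiableOn ℂ b U)
    (hc : DifferentiableOn ℂ c U) {T : Finset ℂ} (hT : 2 * n < T.card)
    (h : ∀ t ∈ T, ∀ᶠ s in 𝓝[≠] (0 : ℂ),
      t ^ (n + 1) * b (s, t * s) - c (s, t * s) = t ^ n * (s ^ (n - 1) * a (s, t * s))) :
    a 0 = 0 := by
  obtain ⟨p, hp, hpO⟩ := exists_polynomial_isBigO_slope hU hb n
  obtain ⟨q, hq, hqO⟩ := exists_polynomial_isBigO_slope hU hc n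
  have hroot : ∀ t ∈ T, t ^ (n + 1) * (p.coeff (n - 1)).eval t - (q.coeff (n - 1)).eval t -
      t ^ n * a 0 = 0 := fun t ht => by
    have haO : (fun s : ℂ => s ^ (n - 1) * (a (s, t * s) - a 0)) =O[𝓝 0] fun s => s ^ n := by
      have hline : DifferentiableAt ℂ (fun s : ℂ => a (s, t * s)) 0 := by
        have ha0 : DifferentiableAt ℂ a ((0 : ℂ), t * 0) := by
          rw [mul_zero]
          exact ha.differentiableAt hU
        exact ha0.comp (f := fun s : ℂ => (s, t * s)) 0 (by fun_prop)
      have := (isBigO_refl (fun s : ℂ => s ^ (n - 1)) (𝓝 0)).mul hline.isBigO_sub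
      simpa [← pow_succ, Nat.sub_add_cancel hn, ← Prod.zero_eq_mk] using this
    have hO := (((hqO t).sub ((hpO t).const_mul_left (t ^ (n + 1)))).add
      (haO.const_mul_left (t ^ n))).mono (nhdsWithin_le_nhds (s := {0}ᶜ))
    have key := coeff_eq_zero_of_isBigO (k := n - 1)
      (q := C (t ^ (n + 1)) * p.map (evalRingHom t) - q.map (evalRingHom t) -
        C (t ^ n * a 0) * X ^ (n - 1))
      (hO.congr' (by
        filter_upwards [h t ht] with s hs
        simp only [eval_sub, eval_mul, eval_C, eval_pow, eval_X]
        linear_combination -hs) EventuallyEq.rfl) (by omega)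
    simpa only [coeff_sub, coeff_C_mul, coeff_map, coeff_X_pow_self, mul_one,
      coe_evalRingHom] using key
  have hzero : X ^ (n + 1) * p.coeff (n - 1) - q.coeff (n - 1) - C (a 0) * X ^ n = 0 := by
    refine eq_zero_of_natDegree_lt_card_of_eval_eq_zero' _ T (fun t ht => ?_) ?_
    · have := hroot t ht
      simp only [eval_sub, eval_mul, eval_C, eval_pow, eval_X]
      linear_combination this
    · refine lt_of_le_of_lt ?_ hT
      refine (natDegree_sub_le _ _).trans (max_le ((natDegree_sub_le _ _).trans
        (max_le ?_ ((hq _).trans (by omega)))) ((natDegree_C_mul_X_pow_le _ _).trans (by omega)))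
      refine natDegree_mul_le.trans ?_
      rw [natDegree_X_pow]
      have := hp (n - 1)
      omega
  have hcoeff := congrArg (fun r => coeff r n) hzero
  have hq0 : (q.coeff (n - 1)).coeff n = 0 :=
    coeff_eq_zero_of_natDegree_lt ((hq _).trans_lt (by omega))
  simpa [coeff_X_pow_mul', hq0] using hcoeff

open Polynomial in
/-- If `tⁿ⁺¹ b₀ = c₀` for more than `n + 1` values of `t`, then `b₀ = 0`. -/
lemma eq_zero_of_pow_mul_eq {n : ℕ} {b₀ c₀ : ℂ} {T : Finset ℂ}
    (hT : n + 1 < T.card) (h : ∀ t ∈ T, t ^ (n + 1) * b₀ = c₀) : b₀ = 0 := by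
  have hzero : C b₀ * X ^ (n + 1) - C c₀ = 0 := by
    refine eq_zero_of_natDegree_lt_card_of_eval_eq_zero' _ T (fun t ht => ?_)
      (lt_of_le_of_lt ?_ hT)
    · simp only [eval_sub, eval_mul, eval_C, eval_pow, eval_X]
      linear_combination h t ht
    · exact (natDegree_sub_le _ _).trans (max_le (natDegree_C_mul_X_pow_le _ _) (by simp))
  have h1 := congrArg (fun r => coeff r (n + 1)) hzero
  simpa [coeff_C] using h1

/-- The upper left entry of `A H = H B`. -/
lemma entry_eq_of_similar {ℓ : ℕ} {z w : ℂ} {H : Matrix (Fin 2) (Fin 2) ℂ}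
    (hH : IsUnit H) (h : H⁻¹ * exA ℓ (z, w) * H = exB ℓ (z, w)) :
    w ^ (3 + ℓ) * H 0 1 - z ^ (3 + ℓ) * H 1 0 = z ^ (2 + ℓ) * w ^ (2 + ℓ) * H 0 0 := by
  have hAB : exA ℓ (z, w) * H = H * exB ℓ (z, w) := by
    rw [← h, Matrix.mul_assoc, Matrix.mul_nonsing_inv_cancel_left _ _
      ((Matrix.isUnit_iff_isUnit_det H).1 hH)]
  have h00 := congrFun (congrFun hAB 0) 0
  simp only [exA, exB, Matrix.mul_apply, Fin.sum_univ_two, Matrix.of_apply, Matrix.cons_val',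
    Matrix.cons_val_zero, Matrix.cons_val_one, Matrix.cons_val_fin_one, mul_zero, zero_add]
    at h00
  linear_combination -h00

open Filter Topology in
/-- On a union `X` of `2ℓ+5` distinct complex lines through the origin, the
restrictions of `A` and `B` to `X` are not locally holomorphically similar at the
origin. -/
theorem not_locally_similar_on_lines (ℓ : ℕ)
    (t : Fin (2 * ℓ + 5) → ℂ) (ht : Function.Injective t) :
    ¬ ∃ U : Set (ℂ × ℂ), IsOpen U ∧ (0 : ℂ × ℂ) ∈ U ∧
      ∃ H : ℂ × ℂ → Matrix (Fin 2) (Fin 2) ℂ, MatHoloOn H U ∧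
        (∀ ζ ∈ U, IsUnit (H ζ)) ∧
        ∀ ζ ∈ U, (∃ j, ζ.2 = t j * ζ.1) →
          (H ζ)⁻¹ * exA ℓ ζ * H ζ = exB ℓ ζ := by
  rintro ⟨U, hUo, h0U, H, hH, hunit, hsim⟩
  have hU : U ∈ 𝓝 0 := hUo.mem_nhds h0U
  set T : Finset ℂ := Finset.univ.image t with hTdef
  have hT : T.card = 2 * ℓ + 5 := by
    rw [hTdef, Finset.card_image_of_injective _ ht, Finset.card_fin]
  have hline : ∀ τ : ℂ, Tendsto (fun s : ℂ => (s, τ * s)) (𝓝[≠] 0) (𝓝 0) := fun τ => by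
    have : Continuous fun s : ℂ => (s, τ * s) := by fun_prop
    have := this.tendsto 0
    rw [mul_zero] at this
    exact this.mono_left nhdsWithin_le_nhds
  have hentry : ∀ τ ∈ T, ∀ᶠ s in 𝓝[≠] (0 : ℂ),
      τ ^ (2 + ℓ + 1) * H (s, τ * s) 0 1 - H (s, τ * s) 1 0 =
        τ ^ (2 + ℓ) * (s ^ (2 + ℓ - 1) * H (s, τ * s) 0 0) := fun τ hτ => by
    obtain ⟨j, -, rfl⟩ := Finset.mem_image.1 hτ
    filter_upwards [hline (t j) hU, self_mem_nhdsWithin] with s hs hs0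
    have h := entry_eq_of_similar (hunit _ hs) (hsim _ hs ⟨j, rfl⟩)
    refine mul_left_cancel₀ (pow_ne_zero (3 + ℓ) hs0) ?_
    have hexp : 2 + ℓ - 1 = 1 + ℓ := by omega
    rw [hexp]
    linear_combination h
  have hlim : ∀ (i k : Fin 2) (τ : ℂ),
      Tendsto (fun s : ℂ => H (s, τ * s) i k) (𝓝[≠] 0) (𝓝 (H 0 i k)) := fun i k τ =>
    ((hH i k).continuousOn.continuousAt hU).tendsto.comp (hline τ)
  have ha : H 0 0 0 = 0 :=
    eq_zero_of_eq_on_lines (n := 2 + ℓ) (by omega) hU (hH 0 0) (hH 0 1) (hH 1 0)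
      (T := T) (by omega) hentry
  have hb : H 0 0 1 = 0 := by
    refine eq_zero_of_pow_mul_eq (n := 2 + ℓ) (c₀ := H 0 1 0) (T := T) (by omega)
      fun τ hτ => ?_
    have hpow : Tendsto (fun s : ℂ => s ^ (2 + ℓ - 1)) (𝓝[≠] 0) (𝓝 0) := by
      have := (continuous_pow (M := ℂ) (2 + ℓ - 1)).tendsto 0
      rw [zero_pow (by omega)] at this
      exact this.mono_left nhdsWithin_le_nhds
    have hl := ((hlim 0 1 τ).const_mul (τ ^ (2 + ℓ + 1))).sub (hlim 1 0 τ)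
    have hr := (hpow.mul (hlim 0 0 τ)).const_mul (τ ^ (2 + ℓ))
    rw [zero_mul, mul_zero] at hr
    exact sub_eq_zero.1 (tendsto_nhds_unique_of_eventuallyEq hl hr
      (hentry τ hτ))
  have hdet := (Matrix.isUnit_iff_isUnit_det _).1 (hunit 0 h0U)
  rw [Matrix.det_fin_two, ha, hb] at hdet
  simp at hdet
end

section
/- Let S² = {x ∈ ℝ³ : x₁² + x₂² + x₃² = 1} be the unit sphere, let 0 < ε < 1, and set U₊ = {x ∈ S² : x₃ > −ε} and U₋ = {x ∈ S² : x₃ < ε}. Then there do not exist continuous functions f₊ : U₊ → ℂ \ {0} and f₋ : U₋ → ℂ \ {0} such that x₁ + i·x₂ = f₊(x) / f₋(x) for all x ∈ U₊ ∩ U₋. -/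
/-- A continuous nowhere vanishing function `g : ℂ → ℂ` has a continuous logarithm. -/
theorem exists_continuous_log_of_ne_zero {g : ℂ → ℂ} (hg : Continuous g) (h0 : ∀ z, g z ≠ 0) :
    ∃ F : ℂ → ℂ, Continuous F ∧ ∀ z, Complex.exp (F z) = g z := by
  obtain ⟨F, ⟨-, hF⟩, -⟩ :=
    Complex.isCoveringMap_exp.existsUnique_continuousMap_lifts
      (f := ⟨fun z => ⟨g z, h0 z⟩, hg.subtype_mk h0⟩) (a₀ := 0) (e₀ := Complex.log (g 0))
      (Subtype.ext (Complex.exp_log (h0 0)))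
  exact ⟨F, F.continuous, fun z => congrArg Subtype.val (congrFun hF z)⟩

/-- There is no continuous logarithm on the unit circle. -/
theorem not_exists_continuous_log_on_circle {L : ℂ → ℂ} (hL : Continuous L) :
    ¬ ∀ z : ℂ, ‖z‖ = 1 → Complex.exp (L z) = z := by
  intro h
  let γ : ℝ → ℂ := fun t => Complex.exp (t * Complex.I)
  have key : (fun t : ℝ => L (γ t)) = fun t : ℝ => t * Complex.I + L 1 := by
    refine Complex.isCoveringMap_exp.eq_of_comp_eq (by fun_prop) (by fun_prop) ?_ 0 (by simp [γ])
    funext t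
    refine Subtype.ext ?_
    simp [γ, Complex.exp_add, h 1 (by simp), h _ (Complex.norm_exp_ofReal_mul_I t)]
  have h2 := congrFun key (2 * Real.pi)
  simp [γ, Complex.exp_two_pi_mul_I] at h2

/-- The unit disc as the graph of `σ * √(1 - |z|²)` over the plane, extended radially constantly
to all of `ℂ`; for `σ = ± 1` this parametrises a closed hemisphere. -/
noncomputable def hemisphere (σ : ℝ) (z : ℂ) : Fin 3 → ℝ :=
  ![z.re / max 1 ‖z‖, z.im / max 1 ‖z‖, σ * √(1 - (‖z‖ / max 1 ‖z‖) ^ 2)]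

theorem continuous_hemisphere (σ : ℝ) : Continuous (hemisphere σ) := by
  have h (z : ℂ) : max 1 ‖z‖ ≠ 0 := by positivity
  refine continuous_pi fun i => ?_
  fin_cases i <;> simp only [hemisphere] <;> simp <;> fun_prop (disch := exact h _)

theorem hemisphere_mem_sphere {σ : ℝ} (hσ : σ ^ 2 = 1) (z : ℂ) :
    hemisphere σ z 0 ^ 2 + hemisphere σ z 1 ^ 2 + hemisphere σ z 2 ^ 2 = 1 := by
  have hpos : 0 < max 1 ‖z‖ := by positivity
  have hle : (‖z‖ / max 1 ‖z‖) ^ 2 ≤ 1 :=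
    pow_le_one₀ (by positivity) ((div_le_one hpos).2 (le_max_right _ _))
  have hz : ‖z‖ ^ 2 = z.re ^ 2 + z.im ^ 2 := by
    rw [Complex.sq_norm, Complex.normSq_apply]; ring
  simp only [hemisphere, Matrix.cons_val_zero, Matrix.cons_val_one, Matrix.cons_val]
  rw [mul_pow, hσ, Real.sq_sqrt (sub_nonneg.2 hle), div_pow, div_pow, div_pow, hz]
  ring

theorem hemisphere_of_norm_eq_one (σ : ℝ) {z : ℂ} (hz : ‖z‖ = 1) :
    hemisphere σ z = ![z.re, z.im, 0] := by
  simp [hemisphere, hz]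


/-- There is no continuous nonvanishing quotient representation
`x₁ + i x₂ = f₊ / f₋` on the overlap of the two sphere caps
`U₊ = {x ∈ S² : x₃ > -ε}` and `U₋ = {x ∈ S² : x₃ < ε}`. -/
theorem no_continuous_quotient_on_sphere (ε : ℝ) (hε0 : 0 < ε) (hε1 : ε < 1) :
    ¬ ∃ fp fm : (Fin 3 → ℝ) → ℂ,
      ContinuousOn fp {x : Fin 3 → ℝ |
        x 0 ^ 2 + x 1 ^ 2 + x 2 ^ 2 = 1 ∧ -ε < x 2} ∧
      ContinuousOn fm {x : Fin 3 → ℝ |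
        x 0 ^ 2 + x 1 ^ 2 + x 2 ^ 2 = 1 ∧ x 2 < ε} ∧
      (∀ x : Fin 3 → ℝ, x 0 ^ 2 + x 1 ^ 2 + x 2 ^ 2 = 1 → -ε < x 2 → fp x ≠ 0) ∧
      (∀ x : Fin 3 → ℝ, x 0 ^ 2 + x 1 ^ 2 + x 2 ^ 2 = 1 → x 2 < ε → fm x ≠ 0) ∧
      ∀ x : Fin 3 → ℝ, x 0 ^ 2 + x 1 ^ 2 + x 2 ^ 2 = 1 → -ε < x 2 → x 2 < ε →
        (x 0 : ℂ) + Complex.I * (x 1 : ℂ) = fp x / fm x := by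
  rintro ⟨fp, fm, hfp, hfm, hp0, hm0, hq⟩
  have hp (z : ℂ) : -ε < hemisphere 1 z 2 := by
    have : 0 ≤ hemisphere 1 z 2 := by simp [hemisphere]
    linarith
  have hm (z : ℂ) : hemisphere (-1) z 2 < ε := by
    have : hemisphere (-1) z 2 ≤ 0 := by simp [hemisphere]
    linarith
  have hsp (z : ℂ) := hemisphere_mem_sphere (σ := 1) (by norm_num) z
  have hsm (z : ℂ) := hemisphere_mem_sphere (σ := -1) (by norm_num) z
  obtain ⟨P, hP, hPexp⟩ := exists_continuous_log_of_ne_zero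
    (hfp.comp_continuous (continuous_hemisphere 1) fun z => ⟨hsp z, hp z⟩)
    fun z => hp0 _ (hsp z) (hp z)
  obtain ⟨M, hM, hMexp⟩ := exists_continuous_log_of_ne_zero
    (hfm.comp_continuous (continuous_hemisphere (-1)) fun z => ⟨hsm z, hm z⟩)
    fun z => hm0 _ (hsm z) (hm z)
  refine not_exists_continuous_log_on_circle (hP.sub hM) fun z hz => ?_
  have hsz := hsp z
  rw [hemisphere_of_norm_eq_one 1 hz] at hsz
  have hqz := hq ![z.re, z.im, 0] hsz (by simpa using hε0) (by simpa using hε0)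
  rw [Pi.sub_apply, Complex.exp_sub, hPexp, hMexp, Function.comp_apply, Function.comp_apply,
    hemisphere_of_norm_eq_one 1 hz,
    hemisphere_of_norm_eq_one (-1) hz, ← hqz]
  simpa [mul_comm] using Complex.re_add_im z
end
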